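/- Let S and S̃ be relative Schottky sets of 2-dimensional Lebesgue measure zero in the open unit disc 𝔻 = {z ∈ ℂ : |z| < 1}, and let f : S → S̃ be a locally quasisymmetric homeomorphism. Then there exist a, b, c, d ∈ ℂ with ad − bc = 1 such that either (i) for every z ∈ S one has cz + d ≠ 0 and f(z) = (az + b)/(cz + d), or (ii) for every z ∈ S one has c·conj(z) + d ≠ 0 and f(z) = (a·conj(z) + b)/(c·conj(z) + d). (If f is orientation preserving, alternative (i) holds, i.e., f is the restriction to S of a Möbius transformation.) -/

import Mathlib

open Set Metric MeasureTheory Filter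
open scoped NNReal ENNReal Topology

noncomputable section

/-- A (nonempty, open, connected) domain in the complex plane. -/
def IsPlaneDomain (Ω : Set ℂ) : Prop := IsOpen Ω ∧ IsConnected Ω

/-- A family of open round discs (given by centers `c` and radii `r`) whose closures
are contained in `Ω` and are pairwise disjoint. -/
def IsSchottkyFamily {I : Type*} (Ω : Set ℂ) (c : I → ℂ) (r : I → ℝ) : Prop :=
  (∀ i, 0 < r i) ∧ (∀ i, closedBall (c i) (r i) ⊆ Ω) ∧
    Pairwise fun i j => Disjoint (closedBall (c i) (r i)) (closedBall (c j) (r j))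

/-- `S` is a relative Schottky set in the domain `Ω`. -/
def IsRelativeSchottkySet (Ω S : Set ℂ) : Prop :=
  IsPlaneDomain Ω ∧
    ∃ (I : Type) (c : I → ℂ) (r : I → ℝ),
      IsSchottkyFamily Ω c r ∧ S = Ω \ ⋃ i, ball (c i) (r i)

/-- A Jordan domain: a bounded domain whose boundary is an embedded circle, and which is
a connected component of the complement of its boundary. -/
def IsJordanDomain (Ω : Set ℂ) : Prop :=
  IsPlaneDomain Ω ∧ Bornology.IsBounded Ω ∧
    (∃ γ : ℂ → ℂ, ContinuousOn γ (sphere (0 : ℂ) 1) ∧ InjOn γ (sphere (0 : ℂ) 1) ∧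
      γ '' sphere (0 : ℂ) 1 = frontier Ω) ∧
    ∀ p ∈ Ω, connectedComponentIn (frontier Ω)ᶜ p = Ω

/-- `f : ℂ → ℂ` restricts to a homeomorphism from `S` onto `T`. -/
def IsHomeoOn (f : ℂ → ℂ) (S T : Set ℂ) : Prop :=
  ∃ e : S ≃ₜ T, ∀ z : S, (e z : ℂ) = f (z : ℂ)

/-- `f` is `η`-quasisymmetric on `X`. -/
def QuasisymmetricWith (η : ℝ≥0 ≃ₜ ℝ≥0) (f : ℂ → ℂ) (X : Set ℂ) : Prop :=
  ∀ p ∈ X, ∀ q ∈ X, ∀ s ∈ X, ∀ t : ℝ≥0,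
    dist p q ≤ (t : ℝ) * dist p s → dist (f p) (f q) ≤ (η t : ℝ) * dist (f p) (f s)

/-- `f` is locally quasisymmetric on `X`: its restriction to every compact subset of `X`
is quasisymmetric. -/
def LocallyQuasisymmetricOn (f : ℂ → ℂ) (X : Set ℂ) : Prop :=
  ∀ K ⊆ X, IsCompact K → ∃ η : ℝ≥0 ≃ₜ ℝ≥0, QuasisymmetricWith η f K

/-- `f` is locally bi-Lipschitz on `S`. -/
def LocallyBiLipschitzOn (f : ℂ → ℂ) (S : Set ℂ) : Prop :=
  ∀ p ∈ S, ∃ U ∈ 𝓝[S] p, ∃ L : ℝ, 1 ≤ L ∧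
    ∀ x ∈ U, ∀ y ∈ U,
      dist x y / L ≤ dist (f x) (f y) ∧ dist (f x) (f y) ≤ L * dist x y

theorem exists_continuous_log {A : Type*} [TopologicalSpace A] [SimplyConnectedSpace A]
    [LocallyPathConnectedSpace A] {w : A → ℂ} (hw : Continuous w) (h0 : ∀ a, w a ≠ 0) :
    ∃ L : A → ℂ, Continuous L ∧ ∀ a, w a = Complex.exp (L a) := by
  have a₀ : A := Classical.arbitrary A
  obtain ⟨F, ⟨-, hF⟩, -⟩ := Complex.isCoveringMap_exp.existsUnique_continuousMap_lifts
    (⟨fun a => (⟨w a, h0 a⟩ : {z : ℂ // z ≠ 0}), by fun_prop⟩ : C(A, {z : ℂ // z ≠ 0})) a₀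
    (Complex.log (w a₀)) (Subtype.ext (Complex.exp_log (h0 a₀)))
  refine ⟨F, F.continuous, fun a => ?_⟩
  have := congrArg Subtype.val (congrFun hF a)
  simpa using this.symm

theorem eqOn_const_of_exp_eq_one {A : Type*} [TopologicalSpace A] {s : Set A}
    (hs : IsPreconnected s) {d : A → ℂ} (hd : ContinuousOn d s)
    (h1 : ∀ a ∈ s, Complex.exp (d a) = 1) {a b : A} (ha : a ∈ s) (hb : b ∈ s) : d a = d b := by
  have : DiscreteTopology (AddSubgroup.zmultiples (2 * (Real.pi : ℂ) * Complex.I)) :=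
    NormedSpace.discreteTopology_zmultiples _
  refine hs.constant_of_mapsTo
    (T := (AddSubgroup.zmultiples (2 * (Real.pi : ℂ) * Complex.I) : Set ℂ)) ⟨this⟩ hd ?_ ha hb
  intro x hx
  obtain ⟨n, hn⟩ := Complex.exp_eq_one_iff.1 (h1 x hx)
  exact AddSubgroup.mem_zmultiples_iff.2 ⟨n, by simp [hn]⟩

theorem continuousOn_periodic_comp_arg {P : ℝ → ℂ} (hP : Continuous P)
    (hper : Function.Periodic P (2 * Real.pi)) :
    ContinuousOn (fun z : ℂ => P z.arg) {0}ᶜ := by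
  have hlift : Continuous (fun x : Real.Angle => hper.lift x) :=
    continuous_coinduced_dom.2 hP
  intro z hz
  exact (hlift.continuousAt.comp (Complex.continuousAt_arg_coe_angle hz)).continuousWithinAt

/-- `u` has a continuous logarithm on `X`. -/
def HasLogOn (u : ℂ → ℂ) (X : Set ℂ) : Prop :=
  ∃ L : ℂ → ℂ, ContinuousOn L X ∧ ∀ z ∈ X, u z = Complex.exp (L z)

namespace HasLogOn

variable {u v : ℂ → ℂ} {X Y : Set ℂ}

theorem ne_zero (h : HasLogOn u X) {z : ℂ} (hz : z ∈ X) : u z ≠ 0 := by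
  obtain ⟨L, -, hL⟩ := h
  rw [hL z hz]
  exact Complex.exp_ne_zero _

theorem continuousOn (h : HasLogOn u X) : ContinuousOn u X := by
  obtain ⟨L, hc, hL⟩ := h
  exact (Complex.continuous_exp.comp_continuousOn hc).congr hL

theorem mul (hu : HasLogOn u X) (hv : HasLogOn v X) : HasLogOn (fun z => u z * v z) X := by
  obtain ⟨L, hc, hL⟩ := hu
  obtain ⟨M, hc', hM⟩ := hv
  exact ⟨fun z => L z + M z, hc.add hc', fun z hz => by
    rw [Complex.exp_add, ← hL z hz, ← hM z hz]⟩

theorem inv (hu : HasLogOn u X) : HasLogOn (fun z => (u z)⁻¹) X := by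
  obtain ⟨L, hc, hL⟩ := hu
  exact ⟨fun z => -L z, hc.neg, fun z hz => by rw [Complex.exp_neg, ← hL z hz]⟩

theorem div (hu : HasLogOn u X) (hv : HasLogOn v X) : HasLogOn (fun z => u z / v z) X := by
  simpa only [div_eq_mul_inv] using hu.mul hv.inv

theorem zpow (hu : HasLogOn u X) (n : ℤ) : HasLogOn (fun z => u z ^ n) X := by
  obtain ⟨L, hc, hL⟩ := hu
  exact ⟨fun z => n * L z, continuousOn_const.mul hc, fun z hz => by
    rw [Complex.exp_int_mul, ← hL z hz]⟩

theorem mono (hu : HasLogOn u X) (h : Y ⊆ X) : HasLogOn u Y := by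
  obtain ⟨L, hc, hL⟩ := hu
  exact ⟨L, hc.mono h, fun z hz => hL z (h hz)⟩

theorem congr (hu : HasLogOn u X) (h : ∀ z ∈ X, v z = u z) : HasLogOn v X := by
  obtain ⟨L, hc, hL⟩ := hu
  exact ⟨L, hc, fun z hz => (h z hz).trans (hL z hz)⟩

theorem comp (hu : HasLogOn u X) {φ : ℂ → ℂ} (hφ : ContinuousOn φ Y) (hm : MapsTo φ Y X) :
    HasLogOn (fun z => u (φ z)) Y := by
  obtain ⟨L, hc, hL⟩ := hu
  exact ⟨fun z => L (φ z), hc.comp hφ hm, fun z hz => hL _ (hm hz)⟩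

theorem of_slitPlane (hu : ContinuousOn u X) (h : ∀ z ∈ X, u z ∈ Complex.slitPlane) :
    HasLogOn u X :=
  ⟨fun z => Complex.log (u z), hu.clog h,
    fun z hz => (Complex.exp_log (Complex.slitPlane_ne_zero (h z hz))).symm⟩

theorem of_norm_sub_one_lt (hu : ContinuousOn u X) (h : ∀ z ∈ X, ‖u z - 1‖ < 1) :
    HasLogOn u X :=
  of_slitPlane hu fun z hz => by
    simpa using Complex.mem_slitPlane_of_norm_lt_one (h z hz)

theorem const {a : ℂ} (ha : a ≠ 0) : HasLogOn (fun _ => a) X :=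
  ⟨fun _ => Complex.log a, continuousOn_const, fun _ _ => (Complex.exp_log ha).symm⟩

theorem prod {ι : Type*} {A : Finset ι} {w : ι → ℂ → ℂ} (h : ∀ i ∈ A, HasLogOn (w i) X) :
    HasLogOn (fun z => ∏ i ∈ A, w i z) X := by
  classical
  induction A using Finset.induction_on with
  | empty => simpa using const one_ne_zero
  | insert i A hi ih =>
    simp only [Finset.prod_insert hi]
    exact (h i (Finset.mem_insert_self i A)).mul
      (ih fun j hj => h j (Finset.mem_insert_of_mem hj))

end HasLogOn

theorem hasLogOn_closedBall {u : ℂ → ℂ} {R : ℝ} (hR : 0 < R)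
    (hu : ContinuousOn u (closedBall 0 R)) (h0 : ∀ z ∈ closedBall (0 : ℂ) R, u z ≠ 0) :
    HasLogOn u (closedBall 0 R) := by
  have hpos : ∀ z : ℂ, 0 < max R ‖z‖ := fun z => lt_max_of_lt_left hR
  have hc : Continuous fun z : ℂ => ((R / max R ‖z‖ : ℝ) : ℂ) * z := by
    refine (Complex.continuous_ofReal.comp ?_).mul continuous_id
    exact continuous_const.div (by fun_prop) fun z => (hpos z).ne'
  have hm : ∀ z : ℂ, ((R / max R ‖z‖ : ℝ) : ℂ) * z ∈ closedBall (0 : ℂ) R := fun z => by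
    rw [mem_closedBall_zero_iff, norm_mul, Complex.norm_real, Real.norm_eq_abs,
      abs_of_nonneg (div_nonneg hR.le (hpos z).le), div_mul_eq_mul_div, div_le_iff₀ (hpos z)]
    exact mul_le_mul_of_nonneg_left (le_max_right _ _) hR.le
  obtain ⟨L, hL, hw⟩ := exists_continuous_log (hu.comp_continuous hc hm) fun z => h0 _ (hm z)
  refine ⟨L, hL.continuousOn, fun z hz => ?_⟩
  rw [← hw z, Function.comp_apply, max_eq_left (mem_closedBall_zero_iff.1 hz), div_self hR.ne']
  simp

/-- `u` is, up to a factor with continuous logarithm, `(z - c) ^ n` on the circle `sphere c r`,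
i.e. `u` has winding number `n` around `0` along that circle. -/
def HasInd (u : ℂ → ℂ) (c : ℂ) (r : ℝ) (n : ℤ) : Prop :=
  HasLogOn (fun z => u z * (z - c) ^ (-n)) (sphere c r)

theorem sub_ne_zero_of_mem_sphere {c z : ℂ} {r : ℝ} (hr : 0 < r) (hz : z ∈ sphere c r) :
    z - c ≠ 0 := by
  rw [mem_sphere_iff_norm] at hz
  exact norm_pos_iff.1 (hz ▸ hr)

theorem circleMap_add_two_pi (c : ℂ) (r t : ℝ) :
    circleMap c r (t + 2 * Real.pi) = circleMap c r t := periodic_circleMap c r t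

theorem exists_hasInd {u : ℂ → ℂ} {c : ℂ} {r : ℝ} (hr : 0 < r)
    (hu : ContinuousOn u (sphere c r)) (h0 : ∀ z ∈ sphere c r, u z ≠ 0) :
    ∃ n, HasInd u c r n := by
  have hm : ∀ t, circleMap c r t ∈ sphere c r := fun t => circleMap_mem_sphere c hr.le t
  obtain ⟨L, hL, hw⟩ := exists_continuous_log
    (hu.comp_continuous (continuous_circleMap c r) hm) fun t => h0 _ (hm t)
  have hconst : ∀ t, L (t + 2 * Real.pi) - L t = L (0 + 2 * Real.pi) - L 0 := fun t => by
    refine eqOn_const_of_exp_eq_one (d := fun t => L (t + 2 * Real.pi) - L t)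
      isPreconnected_univ (by fun_prop) (fun s _ => ?_) (mem_univ t) (mem_univ 0)
    rw [Complex.exp_sub, ← hw, ← hw, Function.comp_apply,
      Function.comp_apply, circleMap_add_two_pi, div_self (h0 _ (hm s))]
  have h1 : Complex.exp (L (0 + 2 * Real.pi) - L 0) = 1 := by
    rw [Complex.exp_sub, ← hw, ← hw, Function.comp_apply,
      Function.comp_apply, circleMap_add_two_pi, div_self (h0 _ (hm 0))]
  obtain ⟨n, hn⟩ := Complex.exp_eq_one_iff.1 h1
  have hper : Function.Periodic (fun t : ℝ => L t - n * (t * Complex.I)) (2 * Real.pi) := by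
    intro t
    have := hconst t
    rw [hn] at this
    push_cast
    linear_combination this
  refine ⟨n, ?_⟩
  have hP := continuousOn_periodic_comp_arg (P := fun t : ℝ => L t - n * (t * Complex.I))
    (by fun_prop) hper
  have hlog : HasLogOn (fun z => u z * (z - c) ^ (-n) * (r : ℂ) ^ n) (sphere c r) := by
    refine ⟨fun z => L (z - c).arg - n * ((z - c).arg * Complex.I),
      hP.comp (t := {0}ᶜ) (f := fun z => z - c) (by fun_prop)
        fun z hz => sub_ne_zero_of_mem_sphere hr hz, fun z hz => ?_⟩
    have hz' : circleMap c r (z - c).arg = z := by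
      have := Complex.norm_mul_exp_arg_mul_I (z - c)
      rw [mem_sphere_iff_norm.1 hz] at this
      simp [circleMap, this]
    have hrc : (r : ℂ) ≠ 0 := by exact_mod_cast hr.ne'
    have h2 : z - c = r * Complex.exp ((z - c).arg * Complex.I) := by
      have := Complex.norm_mul_exp_arg_mul_I (z - c)
      rw [mem_sphere_iff_norm.1 hz] at this
      exact this.symm
    rw [Complex.exp_sub, ← hw, Function.comp_apply, hz', Complex.exp_int_mul]
    conv_lhs => beta_reduce; rw [h2]
    rw [mul_zpow, zpow_neg, zpow_neg]
    have := zpow_ne_zero n hrc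
    field_simp
  have hrc : (r : ℂ) ≠ 0 := by exact_mod_cast hr.ne'
  refine (hlog.mul (HasLogOn.const (zpow_ne_zero (-n) hrc))).congr fun z hz => ?_
  rw [zpow_neg (r : ℂ), mul_inv_cancel_right₀ (zpow_ne_zero n hrc)]

theorem hasInd_zero_iff {u : ℂ → ℂ} {c : ℂ} {r : ℝ} :
    HasInd u c r 0 ↔ HasLogOn u (sphere c r) := by
  simp [HasInd]

namespace HasInd

variable {u v : ℂ → ℂ} {c : ℂ} {r : ℝ} {n m : ℤ}

theorem congr (hu : HasInd u c r n) (h : ∀ z ∈ sphere c r, v z = u z) : HasInd v c r n :=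
  HasLogOn.congr hu fun z hz => by simp only [h z hz]

theorem mul (hr : 0 < r) (hu : HasInd u c r n) (hv : HasInd v c r m) :
    HasInd (fun z => u z * v z) c r (n + m) :=
  (HasLogOn.mul hu hv).congr fun z hz => by
    rw [neg_add, zpow_add₀ (sub_ne_zero_of_mem_sphere hr hz)]
    ring

theorem inv (hu : HasInd u c r n) : HasInd (fun z => (u z)⁻¹) c r (-n) :=
  (HasLogOn.inv hu).congr fun z hz => by
    rw [mul_inv, ← zpow_neg]

theorem div (hr : 0 < r) (hu : HasInd u c r n) (hv : HasInd v c r m) :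
    HasInd (fun z => u z / v z) c r (n - m) := by
  simpa only [div_eq_mul_inv, sub_eq_add_neg] using hu.mul hr hv.inv

theorem zpow (hu : HasInd u c r n) (k : ℤ) : HasInd (fun z => u z ^ k) c r (n * k) :=
  (HasLogOn.zpow hu k).congr fun z hz => by
    rw [mul_zpow, ← zpow_mul, neg_mul]

theorem self : HasInd (fun z => z - c) c r 1 ∨ r = 0 := by
  by_cases hr : r = 0
  · exact Or.inr hr
  refine Or.inl ((HasLogOn.const one_ne_zero).congr fun z hz => ?_)
  have : z - c ≠ 0 := by
    rw [mem_sphere_iff_norm] at hz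
    intro h
    exact hr (by rw [← hz, h, norm_zero])
  simp [this]

theorem unique (hr : 0 < r) (hn : HasInd u c r n) (hm : HasInd u c r m) : n = m := by
  obtain ⟨L, hL, h⟩ : HasLogOn (fun z => (z - c) ^ (m - n)) (sphere c r) := by
    refine (HasLogOn.div hn hm).congr fun z hz => ?_
    have h1 := sub_ne_zero_of_mem_sphere hr hz
    have h2 : u z ≠ 0 := fun h => by
      apply HasLogOn.ne_zero hn hz
      simp [h]
    rw [mul_div_mul_left _ _ h2, ← zpow_sub₀ h1]
    congr 1
    ring
  have hmem : ∀ t, circleMap c r t ∈ sphere c r := fun t => circleMap_mem_sphere c hr.le t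
  have hrc : (r : ℂ) ≠ 0 := by exact_mod_cast hr.ne'
  have key : ∀ t : ℝ, Complex.exp (L (circleMap c r t) - (m - n : ℤ) * (t * Complex.I)
      - (m - n : ℤ) * Complex.log r) = 1 := fun t => by
    rw [Complex.exp_sub, Complex.exp_sub, ← h _ (hmem t), Complex.exp_int_mul,
      Complex.exp_int_mul, Complex.exp_log hrc]
    simp only [circleMap, add_sub_cancel_left, mul_zpow]
    have := zpow_ne_zero (m - n) hrc
    have := zpow_ne_zero (m - n) (Complex.exp_ne_zero (t * Complex.I))
    field_simp
  have hc : Continuous fun t : ℝ => L (circleMap c r t) :=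
    hL.comp_continuous (continuous_circleMap c r) hmem
  have := eqOn_const_of_exp_eq_one (d := fun t : ℝ => L (circleMap c r t)
      - (m - n : ℤ) * (t * Complex.I) - (m - n : ℤ) * Complex.log r) isPreconnected_univ
    ((hc.sub (by fun_prop)).sub (by fun_prop)).continuousOn (fun t _ => key t)
    (mem_univ 0) (mem_univ (0 + 2 * Real.pi))
  rw [circleMap_add_two_pi] at this
  have h3 : ((m - n : ℤ) : ℂ) * (2 * Real.pi * Complex.I) = 0 := by
    push_cast at this ⊢
    linear_combination this
  rcases mul_eq_zero.1 h3 with h4 | h4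
  · have : m - n = 0 := by exact_mod_cast h4
    omega
  · exact absurd h4 Complex.two_pi_I_ne_zero

theorem of_hasLogOn_div (hr : 0 < r) (hu : HasInd u c r n)
    (h : HasLogOn (fun z => v z / u z) (sphere c r)) : HasInd v c r n := by
  refine (HasInd.mul hr hu (hasInd_zero_iff.2 h)).congr (fun z hz => ?_) |> (by simpa using ·)
  have h2 : u z ≠ 0 := fun h => by
    apply HasLogOn.ne_zero hu hz
    simp [h]
  field_simp

theorem ne_zero (hu : HasInd u c r n) {z : ℂ} (hz : z ∈ sphere c r) : u z ≠ 0 := fun h => by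
  apply HasLogOn.ne_zero hu hz
  simp [h]

theorem continuousOn (hr : 0 < r) (hu : HasInd u c r n) : ContinuousOn u (sphere c r) := by
  have h1 := HasLogOn.continuousOn hu
  have h2 : ContinuousOn (fun z => (z - c) ^ n) (sphere c r) :=
    ContinuousOn.zpow₀ (by fun_prop) _ fun z hz => Or.inl (sub_ne_zero_of_mem_sphere hr hz)
  refine (h1.mul h2).congr fun z hz => ?_
  have := zpow_ne_zero n (sub_ne_zero_of_mem_sphere hr hz)
  simp only [zpow_neg, Pi.mul_apply]
  field_simp

theorem sub_self (hr : 0 < r) : HasInd (fun z => z - c) c r 1 := self.resolve_right hr.ne'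

theorem sub_of_mem_ball {a : ℂ} (ha : a ∈ ball c r) : HasInd (fun z => z - a) c r 1 := by
  have hr : 0 < r := pos_of_mem_ball ha
  refine (sub_self hr).of_hasLogOn_div hr (HasLogOn.of_norm_sub_one_lt ?_ fun z hz => ?_)
  · exact ContinuousOn.div (by fun_prop) (by fun_prop) fun z hz => sub_ne_zero_of_mem_sphere hr hz
  · have h1 := sub_ne_zero_of_mem_sphere hr hz
    rw [div_sub_one h1, norm_div, div_lt_one (norm_pos_iff.2 h1), mem_sphere_iff_norm.1 hz,
      sub_sub_sub_cancel_left, ← dist_eq_norm, dist_comm]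
    exact ha

theorem sub_of_notMem_closedBall {a : ℂ} (ha : a ∉ closedBall c r) :
    HasInd (fun z => z - a) c r 0 := by
  rw [hasInd_zero_iff]
  rcases (sphere c r).eq_empty_or_nonempty with h0 | ⟨z0, hz0⟩
  · rw [h0]
    exact ⟨0, continuousOn_empty _, by simp⟩
  have hr : 0 ≤ r := by
    rw [← mem_sphere_iff_norm.1 hz0]
    exact norm_nonneg _
  have hca : c - a ≠ 0 := fun h => ha (by
    rw [← sub_eq_zero.1 h]
    exact mem_closedBall_self hr)
  refine ((HasLogOn.of_norm_sub_one_lt (u := fun z => (z - a) / (c - a)) (by fun_prop)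
    fun z hz => ?_).mul (HasLogOn.const hca)).congr fun z hz => by field_simp
  rw [div_sub_one hca, norm_div, div_lt_one (norm_pos_iff.2 hca), sub_sub_sub_cancel_right,
    mem_sphere_iff_norm.1 hz, ← dist_eq_norm, dist_comm]
  simpa using ha

theorem comp {h φ : ℂ → ℂ} {c' : ℂ} {r' : ℝ} (hr' : 0 < r')
    (hh : HasInd h c' r' n) (hφ : ContinuousOn φ (sphere c r))
    (hm : MapsTo φ (sphere c r) (sphere c' r')) (hi : HasInd (fun z => φ z - c') c r m)
    (hr : 0 < r) : HasInd (fun z => h (φ z)) c r (m * n) := by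
  have h1 : HasLogOn (fun z => h (φ z) * (φ z - c') ^ (-n)) (sphere c r) :=
    HasLogOn.comp hh hφ hm
  refine ((hi.zpow n).mul hr (hasInd_zero_iff.2 h1)).congr (fun z hz => ?_) |>
    (by simpa using ·)
  have := zpow_ne_zero n (sub_ne_zero_of_mem_sphere hr' (hm hz))
  simp only [zpow_neg]
  field_simp

end HasInd

theorem HasInd.prod {ι : Type*} {A : Finset ι} {w : ι → ℂ → ℂ} {n : ι → ℤ} {c : ℂ} {r : ℝ}
    (hr : 0 < r) (h : ∀ i ∈ A, HasInd (w i) c r (n i)) :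
    HasInd (fun z => ∏ i ∈ A, w i z) c r (∑ i ∈ A, n i) := by
  classical
  induction A using Finset.induction_on with
  | empty => simpa [hasInd_zero_iff] using HasLogOn.const one_ne_zero
  | insert i A hi ih =>
    simp only [Finset.prod_insert hi, Finset.sum_insert hi]
    exact (h i (Finset.mem_insert_self i A)).mul hr
      (ih fun j hj => h j (Finset.mem_insert_of_mem hj))

theorem continuousOn_of_isClosed_cover {α β : Type*} [TopologicalSpace α] [TopologicalSpace β]
    {f : α → β} {Y F G : Set α} (hF : IsClosed F) (hG : IsClosed G) (hFG : F ∪ G = univ)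
    (h1 : ContinuousOn f (Y ∩ F)) (h2 : ContinuousOn f (Y ∩ G)) : ContinuousOn f Y := by
  have aux : ∀ {E : Set α}, IsClosed E → ContinuousOn f (Y ∩ E) → ∀ z ∈ Y,
      ContinuousWithinAt f (Y ∩ E) z := fun {E} hE h z hz => by
    by_cases hzE : z ∈ E
    · exact h z ⟨hz, hzE⟩
    · refine continuousWithinAt_of_notMem_closure fun hc => hzE ?_
      exact hE.closure_subset_iff.2 inter_subset_right hc
  intro z hz
  have := (aux hF h1 z hz).union (aux hG h2 z hz)
  rwa [← inter_union_distrib_left, hFG, inter_univ] at this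

theorem exists_continuousOn_extension {Ω X : Set ℂ} {F : Set ℂ} (hF : IsClosed F)
    (hX : X = Ω ∩ F) {u : ℂ → ℂ} (hu : ContinuousOn u X) :
    ∃ W : ℂ → ℂ, ContinuousOn W Ω ∧ EqOn W u X := by
  classical
  have hcl : IsClosed ((↑) ⁻¹' F : Set Ω) := hF.preimage continuous_subtype_val
  obtain ⟨g, hg⟩ := ContinuousMap.exists_restrict_eq hcl
    (⟨fun x => u x.1, hu.comp_continuous (by fun_prop) fun x => hX ▸ ⟨x.1.2, x.2⟩⟩ :
      C(((↑) ⁻¹' F : Set Ω), ℂ))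
  refine ⟨fun z => if hz : z ∈ Ω then g ⟨z, hz⟩ else 0, ?_, fun z hz => ?_⟩
  · rw [continuousOn_iff_continuous_domRestrict]
    refine g.continuous.congr fun x => ?_
    simp
  · rw [hX] at hz
    have := DFunLike.congr_fun hg ⟨⟨z, hz.1⟩, hz.2⟩
    simpa [hz.1] using this

theorem exists_fill {I : Type*} {c : I → ℂ} {r : I → ℝ} {n : I → ℤ} (hr : ∀ i, 0 < r i)
    (hd : Pairwise fun i j => Disjoint (closedBall (c i) (r i)) (closedBall (c j) (r j)))
    {u : ℂ → ℂ} (A : Finset I) {Y : Set ℂ} (hY : ∀ i ∈ A, closedBall (c i) (r i) ⊆ Y)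
    (hu : ContinuousOn u (Y \ ⋃ i ∈ A, ball (c i) (r i)))
    (hn : ∀ i ∈ A, HasInd u (c i) (r i) (n i)) :
    ∃ U : ℂ → ℂ, ContinuousOn U Y ∧ (∀ i ∈ A, ∀ z ∈ closedBall (c i) (r i), U z ≠ 0) ∧
      ∀ z ∈ Y \ ⋃ i ∈ A, ball (c i) (r i), u z = U z * ∏ i ∈ A, (z - c i) ^ n i := by
  classical
  induction A using Finset.induction_on generalizing Y with
  | empty => exact ⟨u, by simpa using hu, by simp, by simp⟩
  | insert i A hi ih =>
    have hne : ∀ j ∈ A, i ≠ j := fun j hj h => hi (h ▸ hj)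
    have hset : (Y \ ball (c i) (r i)) \ ⋃ j ∈ A, ball (c j) (r j)
        = Y \ ⋃ j ∈ insert i A, ball (c j) (r j) := by
      rw [Finset.set_biUnion_insert, sdiff_sdiff]
    obtain ⟨U', hU', hU'0, hU'e⟩ := ih (Y := Y \ ball (c i) (r i))
      (fun j hj z hz => ⟨hY j (Finset.mem_insert_of_mem hj) hz, fun h =>
        (hd (hne j hj)).le_bot ⟨ball_subset_closedBall h, hz⟩⟩)
      (hset ▸ hu) fun j hj => hn j (Finset.mem_insert_of_mem hj)
    rw [hset] at hU'e
    have hsph : ∀ z ∈ sphere (c i) (r i), z ∈ Y \ ⋃ j ∈ insert i A, ball (c j) (r j) := by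
      intro z hz
      refine ⟨hY i (Finset.mem_insert_self i A) (sphere_subset_closedBall hz), fun h => ?_⟩
      simp only [mem_iUnion] at h
      obtain ⟨j, hj, hzj⟩ := h
      rcases Finset.mem_insert.1 hj with rfl | hj
      · exact (ne_of_lt hzj) hz
      · exact (hd (hne j hj)).le_bot ⟨sphere_subset_closedBall hz, ball_subset_closedBall hzj⟩
    have hzero : ∀ j ∈ A, ∀ z ∈ sphere (c i) (r i), z - c j ≠ 0 := fun j hj z hz h =>
      (hd (hne j hj)).le_bot ⟨sphere_subset_closedBall hz, by
        rw [sub_eq_zero.1 h]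
        exact mem_closedBall_self (hr j).le⟩
    have hprod : HasInd (fun z => ∏ j ∈ A, (z - c j) ^ n j) (c i) (r i) 0 := by
      have := HasInd.prod (n := fun j => 0 * n j) (A := A) (hr i)
        fun j hj => HasInd.zpow (HasInd.sub_of_notMem_closedBall (a := c j) (c := c i) (r := r i)
        fun h => (hd (hne j hj)).le_bot ⟨h, mem_closedBall_self (hr j).le⟩) (n j)
      simpa using this
    have hUi : HasInd U' (c i) (r i) (n i) := by
      have := (hn i (Finset.mem_insert_self i A)).div (hr i) hprod
      rw [sub_zero] at this
      refine this.congr fun z hz => ?_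
      have h2 : ∏ j ∈ A, (z - c j) ^ n j ≠ 0 :=
        Finset.prod_ne_zero_iff.2 fun j hj => zpow_ne_zero _ (hzero j hj z hz)
      rw [hU'e z (hsph z hz), mul_div_cancel_right₀ _ h2]
    obtain ⟨L, hL, hLe⟩ := hUi
    obtain ⟨W, hW, hWe⟩ := exists_continuousOn_extension (Ω := univ) isClosed_sphere
      (by rw [univ_inter]) hL
    set U : ℂ → ℂ := fun z =>
      if z ∈ ball (c i) (r i) then Complex.exp (W z) else U' z * (z - c i) ^ (-n i) with hU
    have hUin : ∀ z ∈ closedBall (c i) (r i), U z = Complex.exp (W z) := fun z hz => by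
      by_cases hb : z ∈ ball (c i) (r i)
      · simp only [hU, if_pos hb]
      · have hzs : z ∈ sphere (c i) (r i) := by
          rw [mem_ball, not_lt] at hb
          exact le_antisymm hz hb
        simp only [hU, if_neg hb]
        rw [hWe hzs, ← hLe z hzs]
    have hUout : ∀ z, z ∉ ball (c i) (r i) → U z = U' z * (z - c i) ^ (-n i) := fun z hz => by
      simp only [hU, if_neg hz]
    have hci : ∀ z, z ∉ ball (c i) (r i) → z - c i ≠ 0 := fun z hz h => hz (by
      rw [sub_eq_zero.1 h]
      exact mem_ball_self (hr i))
    refine ⟨U, ?_, ?_, ?_⟩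
    · refine continuousOn_of_isClosed_cover (F := closedBall (c i) (r i))
        (G := (ball (c i) (r i))ᶜ) isClosed_closedBall isOpen_ball.isClosed_compl ?_ ?_ ?_
      · rw [eq_univ_iff_forall]
        intro z
        by_cases hb : z ∈ ball (c i) (r i)
        · exact Or.inl (ball_subset_closedBall hb)
        · exact Or.inr hb
      · exact ((Complex.continuous_exp.comp_continuousOn hW).mono (subset_univ _)).congr
          fun z hz => hUin z hz.2
      · rw [← sdiff_eq]
        refine (hU'.mul (ContinuousOn.zpow₀ (by fun_prop) _ fun z hz => Or.inl (hci z hz.2))).congr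
          fun z hz => hUout z hz.2
    · intro j hj z hz
      rcases Finset.mem_insert.1 hj with rfl | hj
      · rw [hUin z hz]
        exact Complex.exp_ne_zero _
      · have hb : z ∉ ball (c i) (r i) := fun h =>
          (hd (hne j hj)).le_bot ⟨ball_subset_closedBall h, hz⟩
        rw [hUout z hb]
        exact mul_ne_zero (hU'0 j hj z hz) (zpow_ne_zero _ (hci z hb))
    · intro z hz
      have hb : z ∉ ball (c i) (r i) := by
        rw [← hset] at hz
        exact hz.1.2
      rw [hU'e z hz, Finset.prod_insert hi, hUout z hb, zpow_neg]
      have := zpow_ne_zero (n i) (hci z hb)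
      field_simp

theorem exists_factorization {I : Type*} {c : I → ℂ} {r : I → ℝ} {n : I → ℤ}
    (hr : ∀ i, 0 < r i)
    (hd : Pairwise fun i j => Disjoint (closedBall (c i) (r i)) (closedBall (c j) (r j)))
    {Ω X K : Set ℂ} (hΩ : ∀ i, closedBall (c i) (r i) ⊆ Ω)
    (hX : X = Ω \ ⋃ i, ball (c i) (r i)) {u : ℂ → ℂ} (hu : ContinuousOn u X)
    (hu0 : ∀ z ∈ X, u z ≠ 0) (hn : ∀ i, HasInd u (c i) (r i) (n i)) (hK : IsCompact K)
    (hKΩ : K ⊆ Ω) (A₀ : Finset I) :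
    ∃ A : Finset I, A₀ ⊆ A ∧ ∃ U : ℂ → ℂ, ContinuousOn U Ω ∧ (∀ z ∈ K, U z ≠ 0) ∧
      ∀ z ∈ X, u z = U z * ∏ i ∈ A, (z - c i) ^ n i := by
  classical
  obtain ⟨W, hW, hWe⟩ := exists_continuousOn_extension (Ω := Ω) (X := X)
    (isOpen_iUnion fun i => isOpen_ball (x := c i) (ε := r i)).isClosed_compl
    (by rw [hX, sdiff_eq]) hu
  have hsph : ∀ i, sphere (c i) (r i) ⊆ X := fun i z hz => by
    rw [hX]
    refine ⟨hΩ i (sphere_subset_closedBall hz), fun h => ?_⟩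
    obtain ⟨j, hj⟩ := mem_iUnion.1 h
    by_cases hij : i = j
    · subst hij
      exact (ne_of_lt hj) hz
    · exact (hd hij).le_bot ⟨sphere_subset_closedBall hz, ball_subset_closedBall hj⟩
  obtain ⟨O, hO, hOe⟩ := (_root_.continuousOn_iff'.1 hW) {0}ᶜ isOpen_compl_singleton
  have hcov : K \ O ⊆ ⋃ i, ball (c i) (r i) := fun z hz => by
    by_contra hzb
    have hzX : z ∈ X := hX ▸ ⟨hKΩ hz.1, hzb⟩
    have : z ∈ W ⁻¹' {0}ᶜ ∩ Ω := ⟨by simpa [hWe hzX] using hu0 z hzX, hKΩ hz.1⟩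
    rw [hOe] at this
    exact hz.2 this.1
  obtain ⟨A₁, hA₁⟩ := (hK.diff hO).elim_finite_subcover _ (fun i => isOpen_ball) hcov
  obtain ⟨U, hU, hU0, hUe⟩ := exists_fill (n := n) hr hd (u := W) (A₀ ∪ A₁) (Y := Ω)
    (fun i _ => hΩ i) (hW.mono sdiff_subset)
    fun i _ => (hn i).congr fun z hz => hWe (hsph i hz)
  refine ⟨A₀ ∪ A₁, Finset.subset_union_left, U, hU, fun z hz => ?_, fun z hz => ?_⟩
  · by_cases hzb : z ∈ ⋃ i ∈ A₀ ∪ A₁, ball (c i) (r i)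
    · simp only [mem_iUnion] at hzb
      obtain ⟨i, hi, hzi⟩ := hzb
      exact hU0 i hi z (ball_subset_closedBall hzi)
    · have hzO : z ∈ O := by
        by_contra h
        have := hA₁ ⟨hz, h⟩
        simp only [mem_iUnion] at this hzb
        obtain ⟨i, hi, hzi⟩ := this
        exact hzb ⟨i, Finset.mem_union_right _ hi, hzi⟩
      have h1 : z ∈ W ⁻¹' {0}ᶜ ∩ Ω := by
        rw [hOe]
        exact ⟨hzO, hKΩ hz⟩
      have h2 := hUe z ⟨hKΩ hz, hzb⟩
      intro h
      rw [h, zero_mul] at h2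
      exact h1.1 h2
  · rw [← hWe hz]
    rw [hX] at hz
    refine hUe z ⟨hz.1, fun h => hz.2 ?_⟩
    simp only [mem_iUnion] at h ⊢
    obtain ⟨i, -, hi⟩ := h
    exact ⟨i, hi⟩

theorem exists_sum_ind_eq_zero {I : Type*} {c : I → ℂ} {r : I → ℝ} {n : I → ℤ}
    (hr : ∀ i, 0 < r i)
    (hd : Pairwise fun i j => Disjoint (closedBall (c i) (r i)) (closedBall (c j) (r j)))
    (hΩ : ∀ i, closedBall (c i) (r i) ⊆ ball (0 : ℂ) 1) {S : Set ℂ}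
    (hS : S = ball (0 : ℂ) 1 \ ⋃ i, ball (c i) (r i)) {u : ℂ → ℂ} (hu : ContinuousOn u S)
    (hu0 : ∀ z ∈ S, u z ≠ 0) (hn : ∀ i, HasInd u (c i) (r i) (n i)) {R : ℝ} (hR : R < 1)
    (hlog : HasLogOn u (S ∩ {z | R < ‖z‖})) (A₀ : Finset I) :
    ∃ A : Finset I, A₀ ⊆ A ∧ ∑ i ∈ A, n i = 0 := by
  classical
  obtain ⟨ℓ, hℓ, hℓe⟩ := hlog
  obtain ⟨R₁, hR₁, hR₁'⟩ := exists_between hR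
  obtain ⟨R₂, hR₂, hR₂'⟩ := exists_between hR₁'
  set χ : ℂ → ℝ := fun z => max 0 (min 1 ((‖z‖ - R₁) / (R₂ - R₁))) with hχ
  have hχc : Continuous χ := by fun_prop
  have hχ0 : ∀ z : ℂ, ‖z‖ ≤ R₁ → χ z = 0 := fun z hz => by
    refine max_eq_left (min_le_of_right_le ?_)
    exact div_nonpos_of_nonpos_of_nonneg (by linarith) (by linarith)
  have hχ1 : ∀ z : ℂ, R₂ ≤ ‖z‖ → χ z = 1 := fun z hz => by
    have : 1 ≤ (‖z‖ - R₁) / (R₂ - R₁) := by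
      rw [one_le_div (by linarith)]
      linarith
    simp [hχ, min_eq_left this]
  set M : ℂ → ℂ := fun z => (χ z : ℂ) * ℓ z with hM
  have hMc : ContinuousOn M S := by
    refine continuousOn_of_isClosed_cover (F := {z : ℂ | ‖z‖ ≤ R₁}) (G := {z : ℂ | R₁ ≤ ‖z‖})
      (isClosed_le continuous_norm continuous_const)
      (isClosed_le continuous_const continuous_norm)
      (eq_univ_iff_forall.2 fun z => le_total ‖z‖ _) ?_ ?_
    · refine (continuousOn_const (c := (0 : ℂ))).congr fun z hz => ?_
      simp [hM, hχ0 z hz.2]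
    · refine ContinuousOn.mul (by fun_prop) (hℓ.mono fun z hz => ⟨hz.1, ?_⟩)
      exact lt_of_lt_of_le hR₁ hz.2
  set u' : ℂ → ℂ := fun z => if R₂ ≤ ‖z‖ then 1 else u z * Complex.exp (-M z) with hu'
  have hu'S : ∀ z ∈ S, u' z = u z * Complex.exp (-M z) := fun z hz => by
    by_cases h : R₂ ≤ ‖z‖
    · simp only [hu', if_pos h, hM, hχ1 z h]
      rw [hℓe z ⟨hz, hR₁.trans (hR₂.trans_le h)⟩, ← Complex.exp_add]
      simp
    · simp only [hu', if_neg h]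
  set X : Set ℂ := univ \ ⋃ i, ball (c i) (r i) with hX
  have hXS : X ∩ {z : ℂ | ‖z‖ ≤ R₂} ⊆ S := fun z hz => by
    rw [hS]
    exact ⟨mem_ball_zero_iff.2 (lt_of_le_of_lt hz.2 hR₂'), hz.1.2⟩
  have hsph : ∀ i, sphere (c i) (r i) ⊆ S := fun i z hz => by
    rw [hS]
    refine ⟨hΩ i (sphere_subset_closedBall hz), fun h => ?_⟩
    obtain ⟨j, hj⟩ := mem_iUnion.1 h
    by_cases hij : i = j
    · subst hij
      exact (ne_of_lt hj) hz
    · exact (hd hij).le_bot ⟨sphere_subset_closedBall hz, ball_subset_closedBall hj⟩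
  have hu'c : ContinuousOn u' X := by
    refine continuousOn_of_isClosed_cover (F := {z : ℂ | ‖z‖ ≤ R₂}) (G := {z : ℂ | R₂ ≤ ‖z‖})
      (isClosed_le continuous_norm continuous_const)
      (isClosed_le continuous_const continuous_norm)
      (eq_univ_iff_forall.2 fun z => le_total ‖z‖ _) ?_ ?_
    · refine ContinuousOn.congr ?_ fun z hz => hu'S z (hXS hz)
      exact (hu.mul (Complex.continuous_exp.comp_continuousOn hMc.neg)).mono hXS
    · refine (continuousOn_const (c := (1 : ℂ))).congr fun z hz => ?_
      simp only [hu']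
      exact if_pos hz.2
  have hu'0 : ∀ z ∈ X, u' z ≠ 0 := fun z hz => by
    by_cases h : R₂ ≤ ‖z‖
    · simp [hu', h]
    · have hzS := hXS ⟨hz, (not_le.1 h).le⟩
      rw [hu'S z hzS]
      exact mul_ne_zero (hu0 z hzS) (Complex.exp_ne_zero _)
  have hn' : ∀ i, HasInd u' (c i) (r i) (n i) := fun i => by
    have h1 : HasInd (fun z => Complex.exp (-M z)) (c i) (r i) 0 :=
      hasInd_zero_iff.2 ⟨fun z => -M z, hMc.neg.mono (hsph i), fun _ _ => rfl⟩
    have := (hn i).mul (hr i) h1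
    rw [add_zero] at this
    exact this.congr fun z hz => hu'S z (hsph i hz)
  obtain ⟨A, hA, U, hU, hU0, hUe⟩ := exists_factorization hr hd (Ω := univ)
    (fun i => subset_univ _) hX hu'c hu'0 hn' (isCompact_closedBall 0 1) (subset_univ _) A₀
  refine ⟨A, hA, ?_⟩
  have h1 : HasInd U 0 1 0 := hasInd_zero_iff.2
    ((hasLogOn_closedBall one_pos (hU.mono (subset_univ _)) hU0).mono sphere_subset_closedBall)
  have h2 : HasInd (fun z => ∏ i ∈ A, (z - c i) ^ n i) 0 1 (∑ i ∈ A, 1 * n i) :=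
    HasInd.prod one_pos fun i _ => (HasInd.sub_of_mem_ball
      (hΩ i (mem_closedBall_self (hr i).le))).zpow (n i)
  have h3 := h1.mul one_pos h2
  have h4 : HasInd (fun z => U z * ∏ i ∈ A, (z - c i) ^ n i) 0 1 0 := by
    refine hasInd_zero_iff.2 ((HasLogOn.const one_ne_zero).congr fun z hz => ?_)
    have hz1 : ‖z‖ = 1 := by simpa using hz
    rw [← hUe z ⟨mem_univ z, fun h => ?_⟩]
    · simp only [hu']
      exact if_pos (hz1 ▸ hR₂'.le)
    · obtain ⟨i, hi⟩ := mem_iUnion.1 h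
      have := hΩ i (ball_subset_closedBall hi)
      rw [mem_ball_zero_iff, hz1] at this
      exact lt_irrefl _ this
  have := h3.unique one_pos h4
  simpa using this

/-- The unit disc with the open discs `ball (c i) (r i)` removed. -/
def schottkySet {I : Type*} (c : I → ℂ) (r : I → ℝ) : Set ℂ :=
  ball (0 : ℂ) 1 \ ⋃ i, ball (c i) (r i)

theorem isPreconnected_sphere_complex (c : ℂ) (r : ℝ) : IsPreconnected (sphere c r) :=
  isPreconnected_sphere (by simp [Complex.rank_real_complex]) c r

section Topology

variable {I : Type*} {c : I → ℂ} {r : I → ℝ}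

theorem sphere_subset_schottkySet (h : IsSchottkyFamily (ball (0 : ℂ) 1) c r) (i : I) :
    sphere (c i) (r i) ⊆ schottkySet c r := fun z hz => by
  refine ⟨h.2.1 i (sphere_subset_closedBall hz), fun h' => ?_⟩
  obtain ⟨j, hj⟩ := mem_iUnion.1 h'
  by_cases hij : i = j
  · subst hij
    exact (ne_of_lt hj) hz
  · exact (h.2.2 hij).le_bot ⟨sphere_subset_closedBall hz, ball_subset_closedBall hj⟩

theorem notMem_ball_of_mem_schottkySet {z : ℂ} (hz : z ∈ schottkySet c r) (i : I) :
    z ∉ ball (c i) (r i) := fun h => hz.2 (mem_iUnion.2 ⟨i, h⟩)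

theorem notMem_closedBall_of_mem_sphere (h : IsSchottkyFamily (ball (0 : ℂ) 1) c r) {i j : I}
    (hij : i ≠ j) {z : ℂ} (hz : z ∈ closedBall (c i) (r i)) : z ∉ closedBall (c j) (r j) :=
  fun h' => (h.2.2 hij).le_bot ⟨hz, h'⟩

theorem norm_lt_one_of_mem_schottkySet {z : ℂ} (hz : z ∈ schottkySet c r) : ‖z‖ < 1 :=
  mem_ball_zero_iff.1 hz.1

theorem subset_ball_of_isPreconnected (h : IsSchottkyFamily (ball (0 : ℂ) 1) c r) {Z : Set ℂ}
    (hZ : IsPreconnected Z) (hne : Z.Nonempty) (hsub : Z ⊆ ⋃ i, ball (c i) (r i)) :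
    ∃ i, Z ⊆ ball (c i) (r i) := by
  obtain ⟨z, hz⟩ := hne
  obtain ⟨i, hi⟩ := mem_iUnion.1 (hsub hz)
  refine ⟨i, hZ.subset_left_of_subset_union isOpen_ball
    (isOpen_iUnion fun j : {j // j ≠ i} => isOpen_ball (x := c j) (ε := r j)) ?_ ?_ ⟨z, hz, hi⟩⟩
  · rw [disjoint_iUnion_right]
    exact fun j => (h.2.2 j.2.symm).mono ball_subset_closedBall ball_subset_closedBall
  · intro w hw
    obtain ⟨j, hj⟩ := mem_iUnion.1 (hsub hw)
    by_cases hji : j = i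
    · exact Or.inl (hji ▸ hj)
    · exact Or.inr (mem_iUnion.2 ⟨⟨j, hji⟩, hj⟩)

theorem exists_mem_schottkySet_norm_gt (h : IsSchottkyFamily (ball (0 : ℂ) 1) c r) {ρ : ℝ}
    (hρ : ρ < 1) : ∃ z ∈ schottkySet c r, ρ < ‖z‖ := by
  by_contra! hcon
  obtain ⟨a, ha, ha1⟩ := exists_between (max_lt hρ one_pos)
  set Z : Set ℂ := (fun t : ℝ => (t : ℂ)) '' Ico a 1 with hZ
  have hZc : IsPreconnected Z :=
    isPreconnected_Ico.image _ Complex.continuous_ofReal.continuousOn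
  have ha0 : 0 < a := lt_of_le_of_lt (le_max_right _ _) ha
  obtain ⟨i, hi⟩ := subset_ball_of_isPreconnected h hZc ⟨_, a, ⟨le_rfl, ha1⟩, rfl⟩ (by
    rintro _ ⟨t, ht, rfl⟩
    have hn : ‖(t : ℂ)‖ = t := by
      rw [Complex.norm_real, Real.norm_of_nonneg (ha0.le.trans ht.1)]
    by_contra hb
    have := hcon t ⟨by rw [mem_ball_zero_iff, hn]; exact ht.2, hb⟩
    rw [hn] at this
    exact absurd this (not_le.2 ((lt_of_le_of_lt (le_max_left _ _) ha).trans_le ht.1)))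
  have h1 : (1 : ℂ) ∈ closure Z := by
    have := image_closure_subset_closure_image Complex.continuous_ofReal
      (mem_image_of_mem _ (show (1 : ℝ) ∈ closure (Ico a 1) by
        rw [closure_Ico ha1.ne]
        exact ⟨ha1.le, le_rfl⟩))
    simpa using this
  have h2 := h.2.1 i (closure_minimal (hi.trans ball_subset_closedBall) isClosed_closedBall h1)
  simp at h2

theorem isPreconnected_ball_diff_closedBall {c : ℂ} {r : ℝ} (hr : 0 < r)
    (h : closedBall c r ⊆ ball (0 : ℂ) 1) : IsPreconnected (ball (0 : ℂ) 1 \ closedBall c r) := by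
  obtain ⟨R₀, hR₀, hsub⟩ := exists_lt_subset_ball isClosed_closedBall h
  refine isPreconnected_of_forall_constant fun f hf x hx y hy => ?_
  obtain ⟨R, hR, hR1⟩ := exists_between (max_lt hR₀ (max_lt (mem_ball_zero_iff.1 hx.1)
    (mem_ball_zero_iff.1 hy.1)))
  have hRR : R₀ < R := lt_of_le_of_lt (le_max_left _ _) hR
  have hsph : sphere (0 : ℂ) R ⊆ ball (0 : ℂ) 1 \ closedBall c r := fun z hz => by
    rw [mem_sphere_zero_iff_norm] at hz
    refine ⟨by rw [mem_ball_zero_iff, hz]; exact hR1, fun hzc => ?_⟩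
    have := hsub hzc
    rw [mem_ball_zero_iff, hz] at this
    exact absurd this hRR.not_gt
  have key : ∀ x ∈ ball (0 : ℂ) 1 \ closedBall c r, ‖x‖ < R → ∃ z ∈ sphere (0 : ℂ) R,
      f x = f z := by
    intro x hx hxR
    have hxc : r < ‖x - c‖ := by
      have := hx.2
      rwa [mem_closedBall, not_le, dist_eq_norm] at this
    have hpos : 0 < ‖x - c‖ := hr.trans hxc
    set T := (R + ‖c‖) / ‖x - c‖ with hT
    have hT1 : 1 ≤ T := by
      rw [hT, one_le_div hpos]
      exact (norm_sub_le x c).trans (by linarith)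
    set p : ℝ → ℂ := fun t => c + t * (x - c) with hp
    have hpc : Continuous p := by fun_prop
    obtain ⟨t, ht, htR⟩ := intermediate_value_Icc hT1
      (f := fun t => ‖p t‖) (by fun_prop) (show R ∈ Icc ‖p 1‖ ‖p T‖ by
        refine ⟨by simpa [hp] using hxR.le, ?_⟩
        have h1 : ‖(T : ℂ) * (x - c)‖ = R + ‖c‖ := by
          rw [norm_mul, Complex.norm_real, Real.norm_of_nonneg (by linarith), hT,
            div_mul_cancel₀ _ hpos.ne']
        have h2 := norm_sub_le (p T) c
        rw [show p T - c = T * (x - c) by simp [hp], h1] at h2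
        linarith)
    have hxb : x ∈ ball (0 : ℂ) R := mem_ball_zero_iff.2 hxR
    refine ⟨p t, mem_sphere_zero_iff_norm.2 htR, ?_⟩
    have hpre : IsPreconnected (p '' Icc 1 t) := isPreconnected_Icc.image _ hpc.continuousOn
    refine hpre.constant (f := f) (hf.mono ?_) ⟨1, ⟨le_rfl, ht.1⟩, by simp [hp]⟩
      ⟨t, ⟨ht.1, le_rfl⟩, rfl⟩
    rintro _ ⟨s, hs, rfl⟩
    constructor
    · have hseg : p s ∈ segment ℝ x (p t) := by
        rcases eq_or_lt_of_le ht.1 with h1 | h1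
        · have : s = 1 := le_antisymm (h1 ▸ hs.2) hs.1
          rw [this]
          simpa [hp] using left_mem_segment ℝ x (p t)
        · refine ⟨(t - s) / (t - 1), (s - 1) / (t - 1), div_nonneg (by linarith [hs.2])
            (by linarith), div_nonneg (by linarith [hs.1]) (by linarith), ?_, ?_⟩
          · field_simp [(sub_pos.2 h1).ne']
            ring
          · have : (t : ℂ) - 1 ≠ 0 := by exact_mod_cast (sub_pos.2 h1).ne'
            simp only [hp, Complex.real_smul]
            push_cast
            field_simp
            ring
      refine (convex_ball (0 : ℂ) 1).segment_subset hx.1 ?_ hseg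
      rw [mem_ball_zero_iff]
      exact lt_of_eq_of_lt htR hR1
    · rw [mem_closedBall, not_le, dist_eq_norm, show p s - c = s * (x - c) by simp [hp], norm_mul,
        Complex.norm_real, Real.norm_of_nonneg (by linarith [hs.1])]
      nlinarith [hs.1]
  obtain ⟨z, hz, hxz⟩ := key x hx
    (lt_of_le_of_lt ((le_max_left _ _).trans (le_max_right _ _)) hR)
  obtain ⟨w, hw, hyw⟩ := key y hy
    (lt_of_le_of_lt ((le_max_right _ _).trans (le_max_right _ _)) hR)
  rw [hxz, hyw]
  exact (isPreconnected_sphere_complex 0 R).constant (hf.mono hsph) hz hw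

theorem exists_mem_segment_inter_sphere {a b c : ℂ} {r : ℝ} (ha : a ∉ ball c r)
    (hb : b ∈ ball c r) : ∃ z ∈ segment ℝ a b, z ∈ sphere c r := by
  have h1 := (convex_segment (𝕜 := ℝ) a b).isPreconnected.intermediate_value
    (f := fun z => dist z c) (right_mem_segment ℝ a b) (left_mem_segment ℝ a b) (by fun_prop)
  obtain ⟨z, hz, hzr⟩ := h1 ⟨(mem_ball.1 hb).le, not_lt.1 ha⟩
  exact ⟨z, hz, hzr⟩

theorem isPreconnected_schottkySet_diff_sphere (h : IsSchottkyFamily (ball (0 : ℂ) 1) c r)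
    (i : I) : IsPreconnected (schottkySet c r \ sphere (c i) (r i)) := by
  classical
  set S' := schottkySet c r \ sphere (c i) (r i) with hS'
  set D := ball (0 : ℂ) 1 \ closedBall (c i) (r i) with hD
  have hDo : IsOpen D := isOpen_ball.sdiff isClosed_closedBall
  have hS'D : S' ⊆ D := fun z hz => ⟨hz.1.1, fun hc => by
    rcases (mem_closedBall.1 hc).lt_or_eq with h1 | h1
    · exact notMem_ball_of_mem_schottkySet hz.1 i h1
    · exact hz.2 h1⟩
  have hDS' : ∀ z ∈ D, z ∉ S' → ∃ j, j ≠ i ∧ z ∈ ball (c j) (r j) := fun z hz hz' => by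
    have : z ∈ ⋃ j, ball (c j) (r j) := by
      by_contra hb
      exact hz' ⟨⟨hz.1, hb⟩, fun h => hz.2 (sphere_subset_closedBall h)⟩
    obtain ⟨j, hj⟩ := mem_iUnion.1 this
    exact ⟨j, fun hji => hz.2 (ball_subset_closedBall (hji ▸ hj)), hj⟩
  have hsph : ∀ j, j ≠ i → sphere (c j) (r j) ⊆ S' := fun j hj z hz =>
    ⟨sphere_subset_schottkySet h j hz, fun hz' => notMem_closedBall_of_mem_sphere h hj
      (sphere_subset_closedBall hz) (sphere_subset_closedBall hz')⟩
  refine isPreconnected_of_forall_constant fun f hf x hx y hy => ?_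
  set π : ℂ → ℂ := fun z =>
    if hz : ∃ j, j ≠ i ∧ z ∈ ball (c j) (r j) then c hz.choose + r hz.choose else z with hπ
  have hπS : ∀ z ∈ S', π z = z := fun z hz => by
    have : ¬ ∃ j, j ≠ i ∧ z ∈ ball (c j) (r j) := by
      rintro ⟨j, -, hj⟩
      exact notMem_ball_of_mem_schottkySet hz.1 j hj
    simp only [hπ, dif_neg this]
  have hπB : ∀ j, j ≠ i → ∀ z ∈ ball (c j) (r j), π z = c j + r j := fun j hj z hz => by
    have hex : ∃ j, j ≠ i ∧ z ∈ ball (c j) (r j) := ⟨j, hj, hz⟩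
    have : hex.choose = j := by
      by_contra hne
      exact notMem_closedBall_of_mem_sphere h hne
        (ball_subset_closedBall hex.choose_spec.2) (ball_subset_closedBall hz)
    simp only [hπ, dif_pos hex, this]
  have hpt : ∀ j, c j + r j ∈ sphere (c j) (r j) := fun j => by
    simp [(h.1 j).le]
  have hconst : ∀ j, j ≠ i → ∀ z ∈ ball (c j) (r j), ∀ w ∈ sphere (c j) (r j),
      f (π z) = f w := fun j hj z hz w hw => by
    rw [hπB j hj z hz]
    exact (isPreconnected_sphere_complex _ _).constant (hf.mono (hsph j hj)) (hpt j) hw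
  have hcont : ContinuousOn (fun z => f (π z)) D := by
    intro z hz
    by_cases hzS : z ∈ S'
    · have h1 : ∀ᶠ w in 𝓝[S'] z, f w = f z :=
        (hf z hzS).eventually (f := f) (isOpen_discrete {f z} |>.mem_nhds rfl)
      obtain ⟨ε, hε, hεs⟩ := Metric.mem_nhdsWithin_iff.1 h1
      refine ContinuousAt.continuousWithinAt ?_
      refine (continuousAt_const (y := f z)).congr ?_
      filter_upwards [ball_mem_nhds z hε, hDo.mem_nhds hz] with w hw hwD
      by_cases hwS : w ∈ S'
      · rw [hπS w hwS]
        exact (hεs ⟨hw, hwS⟩).symm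
      · obtain ⟨j, hj, hjw⟩ := hDS' w hwD hwS
        obtain ⟨q, hq, hqs⟩ := exists_mem_segment_inter_sphere
          (notMem_ball_of_mem_schottkySet hzS.1 j) hjw
        rw [hconst j hj w hjw q hqs]
        exact (hεs ⟨(convex_ball z ε).segment_subset (mem_ball_self hε) hw hq,
          hsph j hj hqs⟩).symm
    · obtain ⟨j, hj, hjz⟩ := hDS' z hz hzS
      refine ContinuousAt.continuousWithinAt ?_
      refine (continuousAt_const (y := f (π z))).congr ?_
      filter_upwards [isOpen_ball.mem_nhds hjz] with w hw
      rw [hπB j hj z hjz, hπB j hj w hw]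
  have := (isPreconnected_ball_diff_closedBall (h.1 i) (h.2.1 i)).constant hcont
    (hS'D hx) (hS'D hy)
  simpa only [hπS x hx, hπS y hy] using this

end Topology

theorem hasLogOn_sub_iff_of_isPreconnected {J Z : Set ℂ} (hJ : IsCompact J)
    (hZ : IsPreconnected Z) (hd : Disjoint Z J) {a b : ℂ} (ha : a ∈ Z) (hb : b ∈ Z)
    (hlog : HasLogOn (fun ζ => ζ - a) J) : HasLogOn (fun ζ => ζ - b) J := by
  rcases J.eq_empty_or_nonempty with rfl | hne
  · exact ⟨0, continuousOn_empty _, by simp⟩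
  have key : ∀ x ∉ J, ∃ ε > 0, ∀ y ∈ ball x ε, y ∉ J →
      HasLogOn (fun ζ => (ζ - y) / (ζ - x)) J := fun x hx => by
    refine ⟨infDist x J, (hJ.isClosed.notMem_iff_infDist_pos hne).1 hx, fun y hy hyJ => ?_⟩
    have h0 : ∀ ζ ∈ J, ζ - x ≠ 0 := fun ζ hζ h => hx (sub_eq_zero.1 h ▸ hζ)
    refine HasLogOn.of_norm_sub_one_lt
      (ContinuousOn.div (by fun_prop) (by fun_prop) h0) fun ζ hζ => ?_
    rw [div_sub_one (h0 ζ hζ), norm_div, div_lt_one (norm_pos_iff.2 (h0 ζ hζ)),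
      sub_sub_sub_cancel_left, ← dist_eq_norm, ← dist_eq_norm, dist_comm x, dist_comm ζ]
    exact lt_of_lt_of_le hy (infDist_le_dist_of_mem hζ)
  have h0 : ∀ x ∉ J, ∀ ζ ∈ J, ζ - x ≠ 0 := fun x hx ζ hζ h => hx (sub_eq_zero.1 h ▸ hζ)
  have hG : ∀ {P : Prop}, IsOpen {x | x ∉ J ∧ (HasLogOn (fun ζ => ζ - x) J ↔ P)} := fun {P} => by
    rw [Metric.isOpen_iff]
    rintro x ⟨hx, hxP⟩
    obtain ⟨ε, hε, h⟩ := key x hx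
    obtain ⟨δ, hδ, h'⟩ := Metric.isOpen_iff.1 hJ.isClosed.isOpen_compl x hx
    refine ⟨min ε δ, lt_min hε hδ, fun y hy => ?_⟩
    have hyJ : y ∉ J := h' (ball_subset_ball (min_le_right _ _) hy)
    have hl := h y (ball_subset_ball (min_le_left _ _) hy) hyJ
    refine ⟨hyJ, Iff.trans ⟨fun hy => ?_, fun hx => ?_⟩ hxP⟩
    · refine (hy.div hl).congr fun ζ hζ => ?_
      have := h0 y hyJ ζ hζ
      have := h0 x hx ζ hζ
      field_simp
    · refine (hx.mul hl).congr fun ζ hζ => ?_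
      have := h0 x ‹_› ζ hζ
      field_simp
  have hsub := hZ.subset_left_of_subset_union (hG (P := True)) (hG (P := False)) (by
      rw [Set.disjoint_left]
      rintro x ⟨-, h1⟩ ⟨-, h2⟩
      exact h2.1 (h1.2 trivial)) (fun x hx => by
      have hxJ : x ∉ J := Set.disjoint_left.1 hd hx
      by_cases h : HasLogOn (fun ζ => ζ - x) J
      · exact Or.inl ⟨hxJ, by simp [h]⟩
      · exact Or.inr ⟨hxJ, by simp [h]⟩)
    ⟨a, ha, Set.disjoint_left.1 hd ha, by simp [hlog]⟩
  exact (hsub hb).2.2 trivial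

theorem hasLogOn_sub_of_norm_ge {J : Set ℂ} {R : ℝ} (hJ : J ⊆ ball 0 R) {a : ℂ} (hR : 0 < R)
    (ha : R ≤ ‖a‖) : HasLogOn (fun ζ => ζ - a) J := by
  have ha0 : a ≠ 0 := norm_pos_iff.1 (hR.trans_le ha)
  refine ((HasLogOn.of_norm_sub_one_lt (u := fun ζ => (ζ - a) / (-a)) (by fun_prop)
    fun ζ hζ => ?_).mul (HasLogOn.const (neg_ne_zero.2 ha0))).congr fun ζ _ => by field_simp
  have : (ζ - a) / (-a) - 1 = ζ / (-a) := by field_simp; ring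
  rw [this, norm_div, norm_neg, div_lt_one (norm_pos_iff.2 ha0)]
  exact (mem_ball_zero_iff.1 (hJ hζ)).trans_le ha

/-- `f` and `g` are mutually inverse homeomorphisms between the Schottky sets in the unit disc
given by the two families of discs. -/
structure IsSchottkyHomeo {I J : Type*} (c : I → ℂ) (r : I → ℝ) (ct : J → ℂ) (rt : J → ℝ)
    (f g : ℂ → ℂ) : Prop where
  fam : IsSchottkyFamily (ball (0 : ℂ) 1) c r
  fam' : IsSchottkyFamily (ball (0 : ℂ) 1) ct rt
  cont : ContinuousOn f (schottkySet c r)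
  cont' : ContinuousOn g (schottkySet ct rt)
  maps : MapsTo f (schottkySet c r) (schottkySet ct rt)
  maps' : MapsTo g (schottkySet ct rt) (schottkySet c r)
  left_inv : ∀ z ∈ schottkySet c r, g (f z) = z
  right_inv : ∀ z ∈ schottkySet ct rt, f (g z) = z

namespace IsSchottkyHomeo

variable {I J : Type*} {c : I → ℂ} {r : I → ℝ} {ct : J → ℂ} {rt : J → ℝ} {f g : ℂ → ℂ}

theorem symm (H : IsSchottkyHomeo c r ct rt f g) : IsSchottkyHomeo ct rt c r g f :=
  ⟨H.fam', H.fam, H.cont', H.cont, H.maps', H.maps, H.right_inv, H.left_inv⟩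

theorem exists_sphere_subset_image (H : IsSchottkyHomeo c r ct rt f g) (i : I) :
    ∃ k, sphere (ct k) (rt k) ⊆ f '' sphere (c i) (r i) := by
  have hsph := sphere_subset_schottkySet H.fam i
  set Γ := f '' sphere (c i) (r i) with hΓ
  have hΓc : IsCompact Γ := (isCompact_sphere _ _).image_of_continuousOn (H.cont.mono hsph)
  have hΓS : Γ ⊆ schottkySet ct rt := by
    rintro _ ⟨z, hz, rfl⟩
    exact H.maps (hsph hz)
  obtain ⟨R, ⟨hR0, hR1⟩, hΓR⟩ := exists_pos_lt_subset_ball one_pos hΓc.isClosed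
    (hΓS.trans fun z hz => hz.1)
  have hg : MapsTo g Γ (sphere (c i) (r i)) := by
    rintro _ ⟨z, hz, rfl⟩
    rwa [H.left_inv z (hsph hz)]
  have hgc : ∀ ζ ∈ schottkySet ct rt, g ζ - c i ≠ 0 := fun ζ hζ h => by
    refine notMem_ball_of_mem_schottkySet (H.maps' hζ) i ?_
    rw [sub_eq_zero.1 h]
    exact mem_ball_self (H.fam.1 i)
  have hgcont : ContinuousOn (fun ζ => g ζ - c i) (schottkySet ct rt) :=
    H.cont'.sub continuousOn_const
  obtain ⟨k, hk⟩ : ∃ k, ¬ HasLogOn (fun ζ => ζ - ct k) Γ := by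
    by_contra! hall
    choose m hm using fun k => exists_hasInd (H.fam'.1 k)
      (hgcont.mono (sphere_subset_schottkySet H.fam' k))
      fun ζ hζ => hgc ζ (sphere_subset_schottkySet H.fam' k hζ)
    obtain ⟨A, -, U, hU, hU0, hUe⟩ := exists_factorization H.fam'.1 H.fam'.2.2
      (K := closedBall 0 R) H.fam'.2.1 rfl hgcont hgc hm
      (isCompact_closedBall 0 R) (closedBall_subset_ball hR1) ∅
    have hUlog := (hasLogOn_closedBall hR0 (hU.mono (closedBall_subset_ball hR1)) hU0).mono
      (hΓR.trans ball_subset_closedBall)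
    have h1 : HasLogOn (fun ζ => g ζ - c i) Γ :=
      (hUlog.mul (HasLogOn.prod fun k _ => (hall k).zpow (m k))).congr
        fun ζ hζ => hUe ζ (hΓS hζ)
    have h2 : HasLogOn (fun z => z - c i) (sphere (c i) (r i)) :=
      (h1.comp (H.cont.mono hsph) (mapsTo_image _ _)).congr
        fun z hz => by rw [H.left_inv z (hsph hz)]
    have := (HasInd.sub_self (H.fam.1 i)).unique (H.fam.1 i) (hasInd_zero_iff.2 h2)
    exact one_ne_zero this
  refine ⟨k, fun x hx => ?_⟩
  by_contra hxΓ
  have hball : Disjoint (ball (ct k) (rt k)) Γ := Set.disjoint_left.2 fun z hz hz' =>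
    notMem_ball_of_mem_schottkySet (hΓS hz') k hz
  have hbx : IsPreconnected (insert x (ball (ct k) (rt k))) := by
    refine (convex_ball (ct k) (rt k)).isPreconnected.subset_closure (subset_insert _ _) ?_
    rw [closure_ball _ (H.fam'.1 k).ne', insert_subset_iff]
    exact ⟨sphere_subset_closedBall hx, ball_subset_closedBall⟩
  have hxbad : ¬ HasLogOn (fun ζ => ζ - x) Γ := fun hx' => hk <|
    hasLogOn_sub_iff_of_isPreconnected hΓc hbx (by
      rw [Set.disjoint_insert_left]
      exact ⟨hxΓ, hball⟩) (mem_insert _ _)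
      (mem_insert_of_mem _ (mem_ball_self (H.fam'.1 k))) hx'
  have himg : f '' (schottkySet c r \ sphere (c i) (r i)) = schottkySet ct rt \ Γ := by
    ext ζ
    constructor
    · rintro ⟨z, hz, rfl⟩
      refine ⟨H.maps hz.1, ?_⟩
      rintro ⟨w, hw, hwz⟩
      have := congrArg g hwz
      rw [H.left_inv _ (hsph hw), H.left_inv _ hz.1] at this
      exact hz.2 (this ▸ hw)
    · rintro ⟨hζ, hζΓ⟩
      refine ⟨g ζ, ⟨H.maps' hζ, fun h => hζΓ ⟨g ζ, h, H.right_inv ζ hζ⟩⟩, H.right_inv ζ hζ⟩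
  have hpre : IsPreconnected (schottkySet ct rt \ Γ) := by
    rw [← himg]
    exact (isPreconnected_schottkySet_diff_sphere H.fam i).image _ (H.cont.mono sdiff_subset)
  obtain ⟨ζ, hζ, hζR⟩ := exists_mem_schottkySet_norm_gt H.fam' hR1
  have hζΓ : ζ ∉ Γ := fun h => absurd (mem_ball_zero_iff.1 (hΓR h)) hζR.not_gt
  exact hxbad <| hasLogOn_sub_iff_of_isPreconnected hΓc hpre disjoint_sdiff_left ⟨hζ, hζΓ⟩
    ⟨sphere_subset_schottkySet H.fam' k hx, hxΓ⟩ (hasLogOn_sub_of_norm_ge hΓR hR0 hζR.le)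

theorem eq_of_mem_sphere (H : IsSchottkyHomeo c r ct rt f g) {i j : I} {z : ℂ}
    (hi : z ∈ sphere (c i) (r i)) (hj : z ∈ sphere (c j) (r j)) : i = j := by
  by_contra hij
  exact notMem_closedBall_of_mem_sphere H.fam hij (sphere_subset_closedBall hi)
    (sphere_subset_closedBall hj)

theorem exists_image_sphere_eq (H : IsSchottkyHomeo c r ct rt f g) (i : I) :
    ∃ k, f '' sphere (c i) (r i) = sphere (ct k) (rt k) := by
  obtain ⟨k, hk⟩ := H.exists_sphere_subset_image i
  obtain ⟨j, hj⟩ := H.symm.exists_sphere_subset_image k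
  have hgf : g '' sphere (ct k) (rt k) ⊆ sphere (c i) (r i) := by
    rintro _ ⟨ζ, hζ, rfl⟩
    obtain ⟨z, hz, rfl⟩ := hk hζ
    rwa [H.left_inv z (sphere_subset_schottkySet H.fam i hz)]
  have hpt : c j + r j ∈ sphere (c j) (r j) := by simp [(H.fam.1 j).le]
  have hji : j = i := H.eq_of_mem_sphere hpt (hgf (hj hpt))
  subst hji
  refine ⟨k, Subset.antisymm ?_ hk⟩
  rintro _ ⟨z, hz, rfl⟩
  obtain ⟨ζ, hζ, rfl⟩ := hj hz
  rwa [H.right_inv ζ (sphere_subset_schottkySet H.fam' k hζ)]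

theorem exists_equiv (H : IsSchottkyHomeo c r ct rt f g) :
    ∃ σ : I ≃ J, ∀ i, f '' sphere (c i) (r i) = sphere (ct (σ i)) (rt (σ i)) := by
  choose σ hσ using H.exists_image_sphere_eq
  choose τ hτ using H.symm.exists_image_sphere_eq
  have hpt : ∀ i, c i + r i ∈ sphere (c i) (r i) := fun i => by simp [(H.fam.1 i).le]
  have hpt' : ∀ k, ct k + rt k ∈ sphere (ct k) (rt k) := fun k => by simp [(H.fam'.1 k).le]
  refine ⟨⟨σ, τ, fun i => ?_, fun k => ?_⟩, hσ⟩
  · refine H.eq_of_mem_sphere (z := c i + r i) ?_ (hpt i)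
    rw [← hτ, ← hσ]
    exact ⟨_, mem_image_of_mem _ (hpt i),
      H.left_inv _ (sphere_subset_schottkySet H.fam i (hpt i))⟩
  · refine H.symm.eq_of_mem_sphere (z := ct k + rt k) ?_ (hpt' k)
    rw [← hσ, ← hτ]
    exact ⟨_, mem_image_of_mem _ (hpt' k),
      H.right_inv _ (sphere_subset_schottkySet H.fam' k (hpt' k))⟩

theorem reindex (H : IsSchottkyHomeo c r ct rt f g) (σ : I ≃ J) :
    schottkySet (ct ∘ σ) (rt ∘ σ) = schottkySet ct rt ∧
      IsSchottkyHomeo c r (ct ∘ σ) (rt ∘ σ) f g := by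
  have h : schottkySet (ct ∘ σ) (rt ∘ σ) = schottkySet ct rt := by
    unfold schottkySet
    congr 1
    exact σ.surjective.iUnion_comp fun k => ball (ct k) (rt k)
  exact ⟨h, H.fam, ⟨fun i => H.fam'.1 _, fun i => H.fam'.2.1 _,
    fun i j hij => H.fam'.2.2 (σ.injective.ne hij)⟩, H.cont, h ▸ H.cont', h ▸ H.maps,
    h ▸ H.maps', H.left_inv, h ▸ H.right_inv⟩

end IsSchottkyHomeo

theorem exists_separated_net {α : Type*} [PseudoMetricSpace α] (K : Set α) {ρ : ℝ} (hρ : 0 ≤ ρ) :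
    ∃ N ⊆ K, (N.Pairwise fun x y => ρ ≤ dist x y) ∧ ∀ z ∈ K, ∃ x ∈ N, dist z x ≤ ρ := by
  obtain ⟨N, hN⟩ := zorn_subset {N : Set α | N ⊆ K ∧ N.Pairwise fun x y => ρ ≤ dist x y}
    fun C hC hchain => ⟨⋃₀ C, ⟨sUnion_subset fun N hN => (hC hN).1,
      (pairwise_sUnion hchain.directedOn).2 fun N hN => (hC hN).2⟩,
      fun N hN => subset_sUnion_of_mem hN⟩
  refine ⟨N, hN.1.1, hN.1.2, fun z hz => ?_⟩
  by_contra! hcon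
  have hins : insert z N ∈ {N : Set α | N ⊆ K ∧ N.Pairwise fun x y => ρ ≤ dist x y} := by
    refine ⟨insert_subset hz hN.1.1, hN.1.2.insert fun x hx _ => ?_⟩
    exact ⟨(hcon x hx).le, dist_comm z x ▸ (hcon x hx).le⟩
  have hzN : z ∈ N := hN.2 hins (subset_insert z N) (mem_insert z N)
  exact absurd (hcon z hzN) (by simpa using hρ)

theorem exists_volume_cthickening_le {K : Set ℂ} (hK : IsCompact K) (h0 : volume K = 0)
    {ε : ℝ≥0∞} (hε : 0 < ε) : ∃ δ > 0, volume (cthickening δ K) ≤ ε := by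
  have h := tendsto_measure_cthickening_of_isCompact (μ := volume) hK
  rw [h0] at h
  have h2 := h.eventually (ge_mem_nhds hε)
  obtain ⟨δ, hδ, hδ'⟩ := Metric.eventually_nhds_iff_ball.1 h2
  exact ⟨δ / 2, half_pos hδ, hδ' _ (by
    rw [mem_ball_zero_iff, Real.norm_of_nonneg (half_pos hδ).le]
    exact half_lt_self hδ)⟩

theorem volume_image_eq_zero_of_weakly_quasisymmetric {K : Set ℂ} (hK : IsCompact K)
    (hK0 : volume K = 0) {f : ℂ → ℂ} (hf : ContinuousOn f K) (hfK0 : volume (f '' K) = 0)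
    {H : ℝ} (hH : 1 ≤ H)
    (hqs : ∀ p ∈ K, ∀ q ∈ K, ∀ s ∈ K, dist p q ≤ dist p s →
      dist (f p) (f q) ≤ H * dist (f p) (f s))
    {h : ℂ → ℂ} {C : ℝ} (hC : 0 ≤ C)
    (hh : ∀ x ∈ K, ∀ y ∈ K, dist (h x) (h y) ≤ C * (dist x y + dist (f x) (f y))) :
    volume (h '' K) = 0 := by
  set M : ℝ≥0∞ := ENNReal.ofReal (8 * C ^ 2 * H ^ 2) with hM
  have key : ∀ ε : ℝ≥0∞, 0 < ε → volume (h '' K) ≤ M * (ε + ε) := by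
    intro ε hε
    obtain ⟨δ₁, hδ₁, h1⟩ := exists_volume_cthickening_le hK hK0 hε
    obtain ⟨δ₂, hδ₂, h2⟩ := exists_volume_cthickening_le (hK.image_of_continuousOn hf) hfK0 hε
    have huc := hK.uniformContinuousOn_of_continuous hf
    obtain ⟨δ₃, hδ₃, h3⟩ := Metric.uniformContinuousOn_iff.1 huc δ₂ hδ₂
    obtain ⟨ρ, hρ, hρ'⟩ := exists_between (lt_min hδ₁ hδ₃)
    have hρ₁ := hρ'.trans_le (min_le_left _ _)
    have hρ₃ := hρ'.trans_le (min_le_right _ _)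
    obtain ⟨N, hNK, hNs, hNc⟩ := exists_separated_net K hρ.le
    set d : ℂ → ℝ := fun x => sSup ((fun q => dist (f x) (f q)) '' (K ∩ closedBall x ρ)) with hd
    have hbdd : ∀ x ∈ K, ∀ b ∈ (fun q => dist (f x) (f q)) '' (K ∩ closedBall x ρ), b ≤ δ₂ := by
      rintro x hx _ ⟨q, hq, rfl⟩
      exact (h3 x hx q hq.1 (by rw [dist_comm]; exact hq.2.trans_lt hρ₃)).le
    have hself : ∀ x ∈ K, (0 : ℝ) ∈ (fun q => dist (f x) (f q)) '' (K ∩ closedBall x ρ) :=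
      fun x hx => ⟨x, ⟨hx, mem_closedBall_self hρ.le⟩, dist_self _⟩
    have hd0 : ∀ x ∈ K, 0 ≤ d x := fun x hx => le_csSup ⟨δ₂, hbdd x hx⟩ (hself x hx)
    have hdδ : ∀ x ∈ K, d x ≤ δ₂ := fun x hx => csSup_le ⟨_, hself x hx⟩ (hbdd x hx)
    have hdle : ∀ x ∈ K, ∀ q ∈ K, dist q x ≤ ρ → dist (f x) (f q) ≤ d x := fun x hx q hq hqx =>
      le_csSup ⟨δ₂, hbdd x hx⟩ ⟨q, ⟨hq, hqx⟩, rfl⟩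
    have hdist : ∀ x ∈ N, ∀ y ∈ N, x ≠ y → d x ≤ H * dist (f x) (f y) := fun x hx y hy hxy => by
      refine csSup_le ⟨_, hself x (hNK hx)⟩ ?_
      rintro _ ⟨q, hq, rfl⟩
      refine hqs x (hNK hx) q hq.1 y (hNK hy) ?_
      rw [dist_comm x q]
      exact le_trans hq.2 (hNs hx hy hxy)
    have hHp : 0 < H := by linarith
    have hdj : N.PairwiseDisjoint fun x => ball x (ρ / 2) := fun x hx y hy hxy =>
      ball_disjoint_ball (by linarith [hNs hx hy hxy])
    have hdj' : N.PairwiseDisjoint fun x => ball (f x) (d x / (2 * H)) := fun x hx y hy hxy => by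
      refine ball_disjoint_ball ?_
      have e1 := hdist x hx y hy hxy
      have e2 := hdist y hy x hx hxy.symm
      rw [dist_comm (f y)] at e2
      rw [← add_div, div_le_iff₀ (by positivity)]
      linarith
    have hNcount : N.Countable := hdj.countable_of_isOpen (fun x _ => isOpen_ball)
      fun x _ => nonempty_ball.2 (half_pos hρ)
    have hs1 : ∑' x : N, volume (ball (x : ℂ) (ρ / 2)) ≤ ε := by
      rw [← measure_biUnion hNcount hdj fun x _ => measurableSet_ball]
      refine le_trans (measure_mono (iUnion₂_subset fun x hx => ?_)) h1
      exact (ball_subset_closedBall.trans (closedBall_subset_closedBall (by linarith))).trans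
        (closedBall_subset_cthickening (hNK hx) _)
    have hs2 : ∑' x : N, volume (ball (f x) (d x / (2 * H))) ≤ ε := by
      rw [← measure_biUnion hNcount hdj' fun x _ => measurableSet_ball]
      refine le_trans (measure_mono (iUnion₂_subset fun x hx => ?_)) h2
      refine (ball_subset_closedBall.trans (closedBall_subset_closedBall ?_)).trans
        (closedBall_subset_cthickening (mem_image_of_mem f (hNK hx)) _)
      exact (div_le_self (hd0 x (hNK hx)) (by linarith)).trans (hdδ x (hNK hx))
    have hcov : h '' K ⊆ ⋃ x ∈ N, closedBall (h x) (C * (ρ + d x)) := by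
      rintro _ ⟨z, hz, rfl⟩
      obtain ⟨x, hx, hzx⟩ := hNc z hz
      refine mem_iUnion₂.2 ⟨x, hx, ?_⟩
      refine (hh z hz x (hNK hx)).trans (mul_le_mul_of_nonneg_left (add_le_add hzx ?_) hC)
      rw [dist_comm]
      exact hdle x (hNK hx) z hz hzx
    have hterm : ∀ x ∈ N, volume (closedBall (h x) (C * (ρ + d x))) ≤
        M * (volume (ball x (ρ / 2)) + volume (ball (f x) (d x / (2 * H)))) := fun x hx => by
      have hdx := hd0 x (hNK hx)
      rw [Complex.volume_closedBall, Complex.volume_ball, Complex.volume_ball, ← add_mul,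
        ← mul_assoc]
      gcongr
      rw [← ENNReal.ofReal_pow (by positivity), ← ENNReal.ofReal_pow (by positivity),
        ← ENNReal.ofReal_pow (by positivity), ← ENNReal.ofReal_add (by positivity) (by positivity),
        hM, ← ENNReal.ofReal_mul (by positivity)]
      refine ENNReal.ofReal_le_ofReal ?_
      have e1 : 8 * C ^ 2 * H ^ 2 * ((ρ / 2) ^ 2 + (d x / (2 * H)) ^ 2)
          = 2 * C ^ 2 * (H ^ 2 * ρ ^ 2 + d x ^ 2) := by
        field_simp
        ring
      rw [e1]
      have e2 : ρ ^ 2 ≤ H ^ 2 * ρ ^ 2 := le_mul_of_one_le_left (by positivity)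
        (one_le_pow₀ hH)
      nlinarith [mul_nonneg (sq_nonneg C) (sq_nonneg (ρ - d x)), mul_nonneg (sq_nonneg C)
        (sub_nonneg.2 e2)]
    calc volume (h '' K) ≤ volume (⋃ x ∈ N, closedBall (h x) (C * (ρ + d x))) :=
          measure_mono hcov
      _ ≤ ∑' x : N, volume (closedBall (h x) (C * (ρ + d x))) :=
          measure_biUnion_le volume hNcount _
      _ ≤ ∑' x : N, M * (volume (ball (x : ℂ) (ρ / 2)) + volume (ball (f x) (d x / (2 * H)))) :=
          ENNReal.tsum_le_tsum fun x => hterm x x.2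
      _ = M * (∑' x : N, volume (ball (x : ℂ) (ρ / 2))
            + ∑' x : N, volume (ball (f x) (d x / (2 * H)))) := by
          rw [ENNReal.tsum_mul_left, ENNReal.tsum_add]
      _ ≤ M * (ε + ε) := by gcongr
  have htend : Tendsto (fun ε : ℝ≥0∞ => M * (ε + ε)) (𝓝[>] 0) (𝓝 0) := by
    have : Tendsto (fun ε : ℝ≥0∞ => M * (ε + ε)) (𝓝 0) (𝓝 (M * (0 + 0))) :=
      ENNReal.Tendsto.const_mul (tendsto_id.add tendsto_id) (Or.inr ENNReal.ofReal_ne_top)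
    simp only [add_zero, mul_zero] at this
    exact this.mono_left nhdsWithin_le_nhds
  refine le_antisymm (ge_of_tendsto htend ?_) zero_le
  filter_upwards [self_mem_nhdsWithin] with ε hε using key ε hε

/-- Lipschitz images in the plane of the graph of `f` over `S` are null sets. -/
def HasNullGraph (f : ℂ → ℂ) (S : Set ℂ) : Prop :=
  ∀ (h : ℂ → ℂ) (C : ℝ), 0 ≤ C →
    (∀ x ∈ S, ∀ y ∈ S, dist (h x) (h y) ≤ C * (dist x y + dist (f x) (f y))) →
    volume (h '' S) = 0

theorem HasNullGraph.symm {f g : ℂ → ℂ} {S T : Set ℂ} (hN : HasNullGraph f S)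
    (hf : MapsTo f S T) (hg : MapsTo g T S) (hgf : ∀ z ∈ S, g (f z) = z)
    (hfg : ∀ z ∈ T, f (g z) = z) : HasNullGraph g T := fun h C hC hh => by
  have := hN (h ∘ f) C hC fun x hx y hy => by
    have := hh (f x) (hf hx) (f y) (hf hy)
    rw [hgf x hx, hgf y hy] at this
    rw [add_comm (dist x y)]
    exact this
  refine measure_mono_null ?_ this
  rintro _ ⟨z, hz, rfl⟩
  exact ⟨g z, hg hz, by simp [hfg z hz]⟩

theorem HasNullGraph.conj {f : ℂ → ℂ} {S : Set ℂ} (hN : HasNullGraph f S) :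
    HasNullGraph (fun z => (starRingEnd ℂ) (f z)) S := fun h C hC hh =>
  hN h C hC fun x hx y hy => by simpa only [Complex.dist_conj_conj] using hh x hx y hy

theorem hasNullGraph_of_locallyQuasisymmetricOn {I : Type*} {c : I → ℂ} {r : I → ℝ}
    (hS0 : volume (schottkySet c r) = 0) {f : ℂ → ℂ}
    (hf : ContinuousOn f (schottkySet c r)) (hf0 : volume (f '' schottkySet c r) = 0)
    (hqs : LocallyQuasisymmetricOn f (schottkySet c r)) :
    HasNullGraph f (schottkySet c r) := by
  intro h C hC hh
  set K : ℕ → Set ℂ := fun n => closedBall 0 (1 - 1 / ((n : ℝ) + 1)) ∩ (⋃ i, ball (c i) (r i))ᶜ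
    with hK
  have hKc : ∀ n, IsCompact (K n) := fun n =>
    (isCompact_closedBall _ _).inter_right (isOpen_iUnion fun i => isOpen_ball).isClosed_compl
  have hKS : ∀ n, K n ⊆ schottkySet c r := fun n z hz => by
    refine ⟨?_, hz.2⟩
    have h1 := mem_closedBall_zero_iff.1 hz.1
    have : 0 < 1 / ((n : ℝ) + 1) := by positivity
    exact mem_ball_zero_iff.2 (by linarith)
  have hcov : h '' schottkySet c r ⊆ ⋃ n, h '' K n := by
    rintro _ ⟨z, hz, rfl⟩
    have hz1 : 0 < 1 - ‖z‖ := sub_pos.2 (norm_lt_one_of_mem_schottkySet hz)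
    obtain ⟨n, hn⟩ := exists_nat_one_div_lt hz1
    exact mem_iUnion.2 ⟨n, z, ⟨mem_closedBall_zero_iff.2 (by linarith), hz.2⟩, rfl⟩
  refine measure_mono_null hcov (measure_iUnion_null fun n => ?_)
  obtain ⟨η, hη⟩ := hqs (K n) (hKS n) (hKc n)
  refine volume_image_eq_zero_of_weakly_quasisymmetric (hKc n)
    (measure_mono_null (hKS n) hS0) (hf.mono (hKS n))
    (measure_mono_null (image_mono (hKS n)) hf0) (H := max 1 (η 1)) (le_max_left _ _) ?_ hC
    fun x hx y hy => hh x (hKS n hx) y (hKS n hy)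
  intro p hp q hq s hs hpq
  refine (hη p hp q hq s hs 1 (by simpa using hpq)).trans ?_
  gcongr
  exact le_max_right _ _

theorem hasLogOn_sub_div_sub {X : Set ℂ} {φ : ℂ → ℂ} (hφ : ContinuousOn φ X) {a b : ℂ}
    (ha : ∀ z ∈ X, ‖a‖ < ‖φ z‖) (hb : ∀ z ∈ X, ‖b‖ < ‖φ z‖) :
    HasLogOn (fun z => (φ z - a) / (φ z - b)) X := by
  have hne : ∀ z ∈ X, φ z ≠ 0 := fun z hz => norm_pos_iff.1 ((norm_nonneg a).trans_lt (ha z hz))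
  have key : ∀ e : ℂ, (∀ z ∈ X, ‖e‖ < ‖φ z‖) → HasLogOn (fun z => 1 - e / φ z) X := by
    intro e he
    refine .of_norm_sub_one_lt (continuousOn_const.sub (continuousOn_const.div hφ hne)) ?_
    intro z hz
    have h0 := norm_pos_iff.2 (hne z hz)
    have : 1 - e / φ z - 1 = -(e / φ z) := by ring
    rw [this, norm_neg, norm_div, div_lt_one h0]
    exact he z hz
  refine ((key a ha).div (key b hb)).congr fun z hz => ?_
  have h0 := hne z hz
  rw [one_sub_div h0, one_sub_div h0, div_div_div_cancel_right₀ h0]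

namespace IsSchottkyHomeo

variable {I : Type*} {c : I → ℂ} {r : I → ℝ} {ct : I → ℂ} {rt : I → ℝ} {f g : ℂ → ℂ}

theorem exists_norm_gt (H : IsSchottkyHomeo c r ct rt f g) {ρ : ℝ} (hρ : ρ < 1) :
    ∃ R < 1, ∀ z ∈ schottkySet c r, R < ‖z‖ → ρ < ‖f z‖ := by
  set K := schottkySet ct rt ∩ closedBall 0 ρ with hK
  have hKe : K = closedBall 0 ρ \ ⋃ i, ball (ct i) (rt i) := by
    ext z
    simp only [hK, schottkySet, mem_inter_iff, Set.mem_sdiff, mem_closedBall]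
    constructor
    · rintro ⟨⟨_, h⟩, h'⟩
      exact ⟨h', h⟩
    · rintro ⟨h, h'⟩
      exact ⟨⟨h.trans_lt hρ, h'⟩, h⟩
  have hKc : IsCompact K := by
    rw [hKe]
    exact (isCompact_closedBall 0 ρ).diff (isOpen_iUnion fun _ => isOpen_ball)
  have hgc : ContinuousOn g K := H.cont'.mono inter_subset_left
  by_cases hne : K.Nonempty
  · obtain ⟨w, hw, hmax⟩ := hKc.exists_isMaxOn hne hgc.norm
    refine ⟨‖g w‖, norm_lt_one_of_mem_schottkySet (H.maps' hw.1), fun z hz hlt => ?_⟩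
    by_contra! hcon
    have hz' : f z ∈ K := ⟨H.maps hz, by simpa using hcon⟩
    have := hmax hz'
    simp only [mem_ofPred_eq, H.left_inv z hz] at this
    linarith
  · refine ⟨0, one_pos, fun z hz _ => ?_⟩
    by_contra! hcon
    exact hne ⟨f z, H.maps hz, by simpa using hcon⟩

theorem injOn (H : IsSchottkyHomeo c r ct rt f g) : InjOn f (schottkySet c r) :=
  fun z hz w hw h => by rw [← H.left_inv z hz, ← H.left_inv w hw, h]

theorem mapsTo_sphere (hsph : ∀ i, f '' sphere (c i) (r i) = sphere (ct i) (rt i)) (i : I) :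
    MapsTo f (sphere (c i) (r i)) (sphere (ct i) (rt i)) :=
  fun _ hz => hsph i ▸ mem_image_of_mem f hz

theorem image_sphere_symm (H : IsSchottkyHomeo c r ct rt f g)
    (hsph : ∀ i, f '' sphere (c i) (r i) = sphere (ct i) (rt i)) (i : I) :
    g '' sphere (ct i) (rt i) = sphere (c i) (r i) := by
  rw [← hsph i, image_image]
  exact (image_congr fun z hz => H.left_inv z (sphere_subset_schottkySet H.fam i hz)).trans
    (image_id' _)

/-- The winding number of a homeomorphism between two peripheral circles and that of its inverse
are inverse to each other. -/
theorem ind_mul_ind (H : IsSchottkyHomeo c r ct rt f g)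
    (hsph : ∀ i, f '' sphere (c i) (r i) = sphere (ct i) (rt i)) {i : I} {m n : ℤ}
    (hm : HasInd (fun z => f z - ct i) (c i) (r i) m)
    (hn : HasInd (fun z => g z - c i) (ct i) (rt i) n) : m * n = 1 := by
  have hs := sphere_subset_schottkySet H.fam i
  have h := HasInd.comp (H.fam'.1 i) hn (H.cont.mono hs) (mapsTo_sphere hsph i) hm (H.fam.1 i)
  exact (h.congr fun z hz => by rw [H.left_inv z (hs hz)]).unique (H.fam.1 i)
    (.sub_self (H.fam.1 i))

theorem exists_ind (H : IsSchottkyHomeo c r ct rt f g)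
    (hsph : ∀ i, f '' sphere (c i) (r i) = sphere (ct i) (rt i)) (i : I) :
    ∃ ε : ℤ, HasInd (fun z => f z - ct i) (c i) (r i) ε ∧ (ε = 1 ∨ ε = -1) := by
  have hs := sphere_subset_schottkySet H.fam i
  have hs' := sphere_subset_schottkySet H.fam' i
  obtain ⟨m, hm⟩ := exists_hasInd (H.fam.1 i) ((H.cont.mono hs).sub continuousOn_const)
    fun z hz => sub_ne_zero_of_mem_sphere (H.fam'.1 i) (mapsTo_sphere hsph i hz)
  obtain ⟨n, hn⟩ := exists_hasInd (H.fam'.1 i) ((H.cont'.mono hs').sub continuousOn_const)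
    fun z hz => sub_ne_zero_of_mem_sphere (H.fam.1 i)
      (mapsTo_sphere (H.image_sphere_symm hsph) i hz)
  exact ⟨m, hm, Int.eq_one_or_neg_one_of_mul_eq_one (H.ind_mul_ind hsph hm hn)⟩

theorem hasInd_sub_of_mem_ball (H : IsSchottkyHomeo c r ct rt f g)
    (hsph : ∀ i, f '' sphere (c i) (r i) = sphere (ct i) (rt i)) {i : I} {ε : ℤ}
    (hε : HasInd (fun z => f z - ct i) (c i) (r i) ε) {a : ℂ} (ha : a ∈ ball (ct i) (rt i)) :
    HasInd (fun z => f z - a) (c i) (r i) ε := by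
  simpa using HasInd.comp (H.fam'.1 i) (.sub_of_mem_ball ha)
    (H.cont.mono (sphere_subset_schottkySet H.fam i)) (mapsTo_sphere hsph i) hε (H.fam.1 i)

theorem hasInd_sub_of_notMem_closedBall (H : IsSchottkyHomeo c r ct rt f g)
    (hsph : ∀ i, f '' sphere (c i) (r i) = sphere (ct i) (rt i)) {i : I} {a : ℂ}
    (ha : a ∉ closedBall (ct i) (rt i)) : HasInd (fun z => f z - a) (c i) (r i) 0 := by
  obtain ⟨ε, hε, -⟩ := H.exists_ind hsph i
  simpa using HasInd.comp (H.fam'.1 i) (.sub_of_notMem_closedBall ha)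
    (H.cont.mono (sphere_subset_schottkySet H.fam i)) (mapsTo_sphere hsph i) hε (H.fam.1 i)

theorem center_ne (H : IsSchottkyHomeo c r ct rt f g) {z : ℂ} (hz : z ∈ schottkySet c r) {i : I}
    {a : ℂ} (ha : a ∈ ball (ct i) (rt i)) : f z - a ≠ 0 := fun h =>
  notMem_ball_of_mem_schottkySet (H.maps hz) i (sub_eq_zero.1 h ▸ ha)

theorem ind_eq (H : IsSchottkyHomeo c r ct rt f g)
    (hsph : ∀ i, f '' sphere (c i) (r i) = sphere (ct i) (rt i)) {i j : I} {m n : ℤ}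
    (hm : HasInd (fun z => f z - ct i) (c i) (r i) m)
    (hn : HasInd (fun z => f z - ct j) (c j) (r j) n) : m = n := by
  classical
  by_cases hij : i = j
  · subst hij
    exact hm.unique (H.fam.1 i) hn
  have hci : ct i ∈ ball (ct i) (rt i) := mem_ball_self (H.fam'.1 i)
  have hcj : ct j ∈ ball (ct j) (rt j) := mem_ball_self (H.fam'.1 j)
  have hnorm : ∀ k, ‖ct k‖ < 1 := fun k => by
    simpa using H.fam'.2.1 k (mem_closedBall_self (H.fam'.1 k).le)
  have hout : ∀ {k l}, k ≠ l → ct k ∉ closedBall (ct l) (rt l) := fun hkl =>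
    notMem_closedBall_of_mem_sphere H.fam' hkl (mem_closedBall_self (H.fam'.1 _).le)
  obtain ⟨R, hR, hfar⟩ := H.exists_norm_gt (max_lt (hnorm i) (hnorm j))
  have hind : ∀ k, HasInd (fun z => (f z - ct i) / (f z - ct j)) (c k) (r k)
      ((if k = i then m else 0) - if k = j then n else 0) := by
    refine fun k => HasInd.div (H.fam.1 k) ?_ ?_
    · split_ifs with h
      · subst h; exact hm
      · exact H.hasInd_sub_of_notMem_closedBall hsph (hout (Ne.symm h))
    · split_ifs with h
      · subst h; exact hn
      · exact H.hasInd_sub_of_notMem_closedBall hsph (hout (Ne.symm h))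
  obtain ⟨A, hA, hsum⟩ := exists_sum_ind_eq_zero H.fam.1 H.fam.2.2 H.fam.2.1 rfl
    ((H.cont.sub continuousOn_const).div (H.cont.sub continuousOn_const)
      fun z hz => H.center_ne hz hcj)
    (fun z hz => div_ne_zero (H.center_ne hz hci) (H.center_ne hz hcj)) hind hR
    (hasLogOn_sub_div_sub (H.cont.mono inter_subset_left)
      (fun z hz => (le_max_left _ _).trans_lt (hfar z hz.1 hz.2))
      (fun z hz => (le_max_right _ _).trans_lt (hfar z hz.1 hz.2))) {i, j}
  have hi : i ∈ A := hA (by simp)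
  have hj : j ∈ A := hA (by simp)
  simp only [Finset.sum_sub_distrib, Finset.sum_ite_eq', hi, hj, if_true] at hsum
  omega

end IsSchottkyHomeo

/-- A homeomorphism between Schottky sets in the unit disc which matches the peripheral circles
with equal indices and preserves their orientation. -/
structure IsOrientedSchottkyHomeo {I : Type*} (c : I → ℂ) (r : I → ℝ) (ct : I → ℂ) (rt : I → ℝ)
    (f g : ℂ → ℂ) : Prop extends IsSchottkyHomeo c r ct rt f g where
  image_sphere : ∀ i, f '' sphere (c i) (r i) = sphere (ct i) (rt i)
  ind : ∀ i, HasInd (fun z => f z - ct i) (c i) (r i) 1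

namespace IsOrientedSchottkyHomeo

variable {I : Type*} {c : I → ℂ} {r : I → ℝ} {ct : I → ℂ} {rt : I → ℝ} {f g : ℂ → ℂ}

theorem symm (H : IsOrientedSchottkyHomeo c r ct rt f g) :
    IsOrientedSchottkyHomeo ct rt c r g f where
  toIsSchottkyHomeo := H.toIsSchottkyHomeo.symm
  image_sphere := H.image_sphere_symm H.image_sphere
  ind i := by
    obtain ⟨ε, hε, -⟩ := H.toIsSchottkyHomeo.symm.exists_ind
      (H.image_sphere_symm H.image_sphere) i
    have := H.ind_mul_ind H.image_sphere (H.ind i) hε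
    rwa [show ε = 1 by omega] at hε

end IsOrientedSchottkyHomeo

theorem star_mem_sphere_iff {c z : ℂ} {r : ℝ} :
    starRingEnd ℂ z ∈ sphere (starRingEnd ℂ c) r ↔ z ∈ sphere c r := by
  rw [mem_sphere, mem_sphere, Complex.dist_conj_conj]

open ComplexConjugate in
theorem IsSchottkyHomeo.conj {I : Type*} {c : I → ℂ} {r : I → ℝ} {ct : I → ℂ} {rt : I → ℝ}
    {f g : ℂ → ℂ} (H : IsSchottkyHomeo c r ct rt f g) :
    IsSchottkyHomeo c r (fun i => conj (ct i)) rt (fun z => conj (f z)) (fun z => g (conj z)) := by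
  have hmem : ∀ z, conj z ∈ schottkySet (fun i => conj (ct i)) rt ↔ z ∈ schottkySet ct rt := by
    intro z
    simp only [schottkySet, Set.mem_sdiff, mem_ball_zero_iff, mem_iUnion, RCLike.norm_conj]
    simp only [mem_ball, Complex.dist_conj_conj]
  have hmaps : MapsTo (fun z => conj z) (schottkySet (fun i => conj (ct i)) rt)
      (schottkySet ct rt) := fun z hz => by
    rw [← hmem, Complex.conj_conj]
    exact hz
  refine ⟨H.fam, ⟨H.fam'.1, fun i z hz => ?_, fun i j hij => ?_⟩,
    Complex.continuous_conj.comp_continuousOn H.cont,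
    H.cont'.comp Complex.continuous_conj.continuousOn hmaps, fun z hz => ?_, fun z hz => ?_,
    fun z hz => ?_, fun z hz => ?_⟩
  · have := H.fam'.2.1 i (show conj z ∈ _ by
      rw [mem_closedBall, ← Complex.dist_conj_conj, Complex.conj_conj]; exact hz)
    simpa using this
  · refine Set.disjoint_left.2 fun z hz hz' => (Set.disjoint_left.1 (H.fam'.2.2 hij) :
      ∀ ⦃a⦄, _ → a ∉ _) (a := conj z) ?_ ?_
    · rw [mem_closedBall, ← Complex.dist_conj_conj, Complex.conj_conj]; exact hz
    · rw [mem_closedBall, ← Complex.dist_conj_conj, Complex.conj_conj]; exact hz'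
  · exact (hmem _).2 (H.maps hz)
  · exact H.maps' (hmaps hz)
  · simp only [Complex.conj_conj]; exact H.left_inv z hz
  · simp only [H.right_inv _ (hmaps hz), Complex.conj_conj]

open ComplexConjugate in
/-- After composing with complex conjugation if necessary, a homeomorphism between Schottky sets
preserves the orientation of the peripheral circles. -/
theorem IsSchottkyHomeo.oriented_or_conj {I : Type*} {c : I → ℂ} {r : I → ℝ} {ct : I → ℂ}
    {rt : I → ℝ} {f g : ℂ → ℂ} (H : IsSchottkyHomeo c r ct rt f g)
    (hsph : ∀ i, f '' sphere (c i) (r i) = sphere (ct i) (rt i)) :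
    IsOrientedSchottkyHomeo c r ct rt f g ∨ IsOrientedSchottkyHomeo c r (fun i => conj (ct i)) rt
      (fun z => conj (f z)) (fun z => g (conj z)) := by
  by_cases hall : ∀ i, HasInd (fun z => f z - ct i) (c i) (r i) 1
  · exact Or.inl ⟨H, hsph, hall⟩
  push Not at hall
  obtain ⟨j, hj⟩ := hall
  have hneg : ∀ i, HasInd (fun z => f z - ct i) (c i) (r i) (-1) := fun i => by
    obtain ⟨ε, hε, h1⟩ := H.exists_ind hsph i
    obtain ⟨ε', hε', h1'⟩ := H.exists_ind hsph j
    have := H.ind_eq hsph hε hε'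
    have : ε = -1 := by
      rcases h1' with h | h
      · exact absurd (h ▸ hε') hj
      · omega
    rwa [this] at hε
  refine Or.inr ⟨H.conj, fun i => ?_, fun i => ?_⟩
  · ext z
    constructor
    · rintro ⟨w, hw, rfl⟩
      exact star_mem_sphere_iff.2 (mapsTo_sphere hsph i hw)
    · intro hz
      have : conj z ∈ sphere (ct i) (rt i) := by
        rw [← star_mem_sphere_iff, Complex.conj_conj]; exact hz
      rw [← hsph i] at this
      obtain ⟨w, hw, h⟩ := this
      exact ⟨w, hw, by simp only [h, Complex.conj_conj]⟩
  · have hr := H.fam'.1 i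
    refine (hneg i).inv.of_hasLogOn_div (H.fam.1 i) ?_
    refine (HasLogOn.const (a := ((rt i ^ 2 : ℝ) : ℂ)) ?_).congr fun z hz => ?_
    · exact_mod_cast (pow_pos hr 2).ne'
    · have h : ‖f z - ct i‖ = rt i := mem_sphere_iff_norm.1 (mapsTo_sphere hsph i hz)
      rw [div_inv_eq_mul, ← map_sub, mul_comm, Complex.mul_conj, Complex.normSq_eq_norm_sq, h]

theorem abs_arg_one_add_sub_arg_one_add_inv_lt {w : ℂ} (hw : w ≠ 0) (h1 : 1 + w ∈ Complex.slitPlane)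
    (h2 : 1 + w⁻¹ ∈ Complex.slitPlane) : |(1 + w).arg - (1 + w⁻¹).arg| < Real.pi := by
  have key : ∀ v : ℂ, 0 < v.im → 1 + v ∈ Complex.slitPlane → 1 + v⁻¹ ∈ Complex.slitPlane →
      |(1 + v).arg - (1 + v⁻¹).arg| < Real.pi := by
    intro v hv h1 h2
    have hv0 : v ≠ 0 := by rintro rfl; simp at hv
    have hA : 0 < (1 + v).arg := by
      rcases (Complex.arg_nonneg_iff.2 (by simpa using hv.le : 0 ≤ (1 + v).im)).lt_or_eq with h | h
      · exact h
      · have := Complex.arg_eq_zero_iff.1 h.symm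
        simp at this
        linarith [this.2]
    have hB : (1 + v⁻¹).arg < 0 := by
      rw [Complex.arg_neg_iff]
      simp only [Complex.add_im, Complex.one_im, zero_add, Complex.inv_im, neg_div, neg_lt_zero]
      exact div_pos hv (Complex.normSq_pos.2 hv0)
    have hsin : 0 < Real.sin ((1 + v).arg - (1 + v⁻¹).arg) := by
      have n1 := norm_pos_iff.2 (Complex.slitPlane_ne_zero h1)
      have n2 := norm_pos_iff.2 (Complex.slitPlane_ne_zero h2)
      rw [Real.sin_sub, Complex.sin_arg, Complex.sin_arg, Complex.cos_arg (norm_pos_iff.1 n1),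
        Complex.cos_arg (norm_pos_iff.1 n2)]
      have e : (1 + v).im / ‖1 + v‖ * ((1 + v⁻¹).re / ‖1 + v⁻¹‖)
          - (1 + v).re / ‖1 + v‖ * ((1 + v⁻¹).im / ‖1 + v⁻¹‖)
          = ((1 + v) * (starRingEnd ℂ) (1 + v⁻¹)).im / (‖1 + v‖ * ‖1 + v⁻¹‖) := by
        simp only [Complex.mul_im, Complex.conj_re, Complex.conj_im]
        field_simp
        ring
      rw [e]
      refine div_pos ?_ (mul_pos n1 n2)
      have e2 : (1 + v) * (starRingEnd ℂ) (1 + v⁻¹) = v * ((Complex.normSq (1 + v⁻¹) : ℝ) : ℂ) := by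
        rw [← Complex.mul_conj, ← mul_assoc, mul_add, mul_inv_cancel₀ hv0, mul_one, add_comm v]
      rw [e2, Complex.im_mul_ofReal]
      exact mul_pos hv (Complex.normSq_pos.2 (norm_pos_iff.1 n2))
    have hle : (1 + v).arg - (1 + v⁻¹).arg < 2 * Real.pi := by
      linarith [Complex.arg_le_pi (1 + v), Complex.neg_pi_lt_arg (1 + v⁻¹)]
    rw [abs_of_pos (by linarith)]
    by_contra! hcon
    have := Real.sin_nonpos_of_nonpos_of_neg_pi_le
      (x := (1 + v).arg - (1 + v⁻¹).arg - 2 * Real.pi) (by linarith) (by linarith)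
    rw [Real.sin_sub_two_pi] at this
    linarith
  rcases lt_trichotomy w.im 0 with h | h | h
  · have := key w⁻¹ (by
      rw [Complex.inv_im]; exact div_pos (neg_pos.2 h) (Complex.normSq_pos.2 hw)) h2 (by rwa [inv_inv])
    rwa [inv_inv, abs_sub_comm] at this
  · have hr : ∀ v : ℂ, v.im = 0 → v ∈ Complex.slitPlane → v.arg = 0 := fun v hv hs =>
      Complex.arg_eq_zero_iff.2 ⟨(hs.resolve_right (not_not.2 hv)).le, hv⟩
    rw [hr _ (by simp [h]) h1, hr _ (by simp [Complex.inv_im, h]) h2]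
    simpa using Real.pi_pos
  · exact key w h h1 h2

theorem div_sub_mem_slitPlane {x y a c : ℂ} {r : ℝ} (ha : a ∈ ball c r) (hx : x ∈ closedBall c r)
    (hy : y ∉ ball c r) (hxy : y ≠ x) : (y - x) / (y - a) ∈ Complex.slitPlane := by
  have hya : y - a ≠ 0 := fun h => hy (sub_eq_zero.1 h ▸ ha)
  rw [Complex.mem_slitPlane_iff_not_le_zero]
  intro hle
  obtain ⟨hre, him⟩ := Complex.le_def.1 hle
  set q := (y - x) / (y - a) with hq
  have hqe : q = ((q.re : ℝ) : ℂ) := Complex.ext (by simp) (by simpa using him)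
  have hre' : q.re ≤ 0 := by simpa using hre
  have hne : q.re ≠ 0 := fun h0 => by
    rw [h0, Complex.ofReal_zero, hq, div_eq_zero_iff] at hqe
    exact hqe.elim (fun h => hxy (sub_eq_zero.1 h)) hya
  set s : ℝ := -q.re with hs
  have hspos : 0 < s := by rcases hre'.lt_or_eq with h | h <;> [linarith; exact absurd h hne]
  have e : (1 + s) • (y - c) = (x - c) + s • (a - c) := by
    have : y - x = q * (y - a) := by rw [hq, div_mul_cancel₀ _ hya]
    rw [hqe, show q.re = -s by rw [hs]; ring] at this
    simp only [Complex.real_smul]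
    push_cast at this ⊢
    linear_combination this
  have h1 : (1 + s) * ‖y - c‖ ≤ ‖x - c‖ + s * ‖a - c‖ := by
    calc (1 + s) * ‖y - c‖ = ‖(1 + s) • (y - c)‖ := by
          rw [norm_smul, Real.norm_of_nonneg (by linarith)]
      _ ≤ _ := by
          rw [e]
          refine (norm_add_le _ _).trans (by rw [norm_smul, Real.norm_of_nonneg hspos.le])
  rw [mem_ball_iff_norm] at ha hy
  rw [mem_closedBall_iff_norm] at hx
  push Not at hy
  nlinarith

/-- Radial projection from an interior point is injective on a circle. -/
theorem eq_of_sub_eq_real_mul_sub {x y a c : ℂ} {r s : ℝ} (ha : a ∈ ball c r)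
    (hx : x ∈ sphere c r) (hy : y ∈ sphere c r) (hs : 0 < s) (h : x - a = s * (y - a)) : x = y := by
  by_contra hne
  have hout : ∀ {z}, z ∈ sphere c r → z ∉ ball c r := fun hz hz' =>
    (mem_ball.1 hz').ne (mem_sphere.1 hz)
  have hya : y - a ≠ 0 := fun h => hout hy (sub_eq_zero.1 h ▸ ha)
  have hsc : (s : ℂ) ≠ 0 := by exact_mod_cast hs.ne'
  have h1 := div_sub_mem_slitPlane ha (sphere_subset_closedBall hx) (hout hy) (Ne.symm hne)
  have h2 := div_sub_mem_slitPlane ha (sphere_subset_closedBall hy) (hout hx) hne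
  have e1 : (y - x) / (y - a) = ((1 - s : ℝ) : ℂ) := by
    rw [div_eq_iff hya]; push_cast; linear_combination -h
  have e2 : (x - y) / (x - a) = ((1 - s⁻¹ : ℝ) : ℂ) := by
    rw [div_eq_iff (h ▸ mul_ne_zero hsc hya), h]
    push_cast
    field_simp
    linear_combination h
  rw [e1, Complex.ofReal_mem_slitPlane] at h1
  rw [e2, Complex.ofReal_mem_slitPlane] at h2
  have := (one_lt_inv₀ hs).2 (by linarith)
  linarith

theorem HasInd.exists_lift {u : ℂ → ℂ} {c : ℂ} {r : ℝ} {n : ℤ} (hr : 0 < r) (h : HasInd u c r n) :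
    ∃ Λ : ℝ → ℂ, Continuous Λ ∧ (∀ t, u (circleMap c r t) = Complex.exp (Λ t)) ∧
      ∀ t, Λ (t + 2 * Real.pi) = Λ t + 2 * Real.pi * n * Complex.I := by
  obtain ⟨L, hL, hexp⟩ := h
  have hm : ∀ t, circleMap c r t ∈ sphere c r := fun t => circleMap_mem_sphere c hr.le t
  refine ⟨fun t => L (circleMap c r t) + n * (Real.log r + t * Complex.I),
    (hL.comp_continuous (continuous_circleMap c r) hm).add (by fun_prop), fun t => ?_, fun t => ?_⟩
  · have h1 := hexp _ (hm t)
    have h0 : circleMap c r t - c ≠ 0 := sub_ne_zero_of_mem_sphere hr (hm t)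
    have h2 : Complex.exp (Real.log r + t * Complex.I) = circleMap c r t - c := by
      rw [Complex.exp_add, ← Complex.ofReal_exp, Real.exp_log hr, circleMap]
      ring
    rw [Complex.exp_add, ← h1, Complex.exp_int_mul, h2, mul_assoc, ← zpow_add₀ h0]
    simp
  · simp only [circleMap_add_two_pi]
    push_cast
    ring

theorem strictMono_im_lift {φ : ℂ → ℂ} {c c₁ a : ℂ} {r r₁ : ℝ} (hr : 0 < r)
    (hm : MapsTo φ (sphere c r) (sphere c₁ r₁)) (hinj : InjOn φ (sphere c r)) (ha : a ∈ ball c₁ r₁)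
    {Λ : ℝ → ℂ} (hΛ : Continuous Λ) (hexp : ∀ t, φ (circleMap c r t) - a = Complex.exp (Λ t))
    (hper : ∀ t, Λ (t + 2 * Real.pi) = Λ t + 2 * Real.pi * (1 : ℤ) * Complex.I) :
    StrictMono fun t => (Λ t).im := by
  have hc : Continuous fun t => (Λ t).im := Complex.continuous_im.comp hΛ
  have hS : ∀ t, circleMap c r t ∈ sphere c r := fun t => circleMap_mem_sphere c hr.le t
  have him : Function.Periodic (fun t => (Λ t).im - t) (2 * Real.pi) := fun t => by
    simp only [hper t]
    simp
  have hi : Function.Injective fun t => (Λ t).im := by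
    intro s t hst
    simp only at hst
    have h1 : φ (circleMap c r s) - a
        = (Real.exp ((Λ s).re - (Λ t).re) : ℝ) * (φ (circleMap c r t) - a) := by
      rw [hexp, hexp, Complex.ofReal_exp, ← Complex.exp_add]
      congr 1
      exact Complex.ext (by simp) (by simp [hst])
    have h2 := hinj (hS s) (hS t) (eq_of_sub_eq_real_mul_sub ha (hm (hS s)) (hm (hS t))
      (Real.exp_pos _) h1)
    obtain ⟨n, hn⟩ := (circleMap_eq_circleMap_iff c hr.ne').1 h2
    have hn' : s = t + n * (2 * Real.pi) := by
      have := congrArg Complex.im hn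
      simpa using this
    have := him.int_mul n t
    simp only [← hn', hst] at this
    linarith
  refine (hc.strictMono_of_inj hi).resolve_right fun hanti => ?_
  have h1 := hanti (show (0 : ℝ) < 0 + 2 * Real.pi by linarith [Real.pi_pos])
  have h2 := him 0
  simp only at h1 h2
  linarith [Real.pi_pos]

theorem lt_of_isPreconnected_of_ne {s : Set ℝ} (hs : IsPreconnected s) {h : ℝ → ℝ}
    (hc : ContinuousOn h s) {b : ℝ} (hb : ∀ t ∈ s, h t ≠ b) {u v : ℝ} (hu : u ∈ s) (hv : v ∈ s)
    (hlt : h u < b) : h v < b := by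
  by_contra! hge
  obtain ⟨t, ht, hbt⟩ := hs.intermediate_value hu hv hc ⟨hlt.le, hge⟩
  exact hb t ht hbt

/-- If a Jordan parametrisation of a circle enters and leaves a disc, then it is inside the disc
along an arc and outside along the complementary arc. -/
theorem exists_arcs {G : ℂ → ℂ} {c c₁ c₂ : ℂ} {r r₁ r₂ : ℝ} (hr : 0 < r)
    (hG : ContinuousOn G (sphere c r)) (hm : MapsTo G (sphere c r) (sphere c₂ r₂))
    (hinj : InjOn G (sphere c r)) {x y : ℂ} (hx : x ∈ sphere c r) (hxo : G x ∉ closedBall c₁ r₁)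
    (hy : y ∈ sphere c r) (hyi : G y ∈ ball c₁ r₁) :
    ∃ t₁ t₂ : ℝ, t₁ < t₂ ∧ t₂ < t₁ + 2 * Real.pi ∧
      (∀ t ∈ Icc t₁ t₂, G (circleMap c r t) ∈ closedBall c₁ r₁) ∧
      ∀ t ∈ Icc t₂ (t₁ + 2 * Real.pi), G (circleMap c r t) ∉ ball c₁ r₁ := by
  have hS : ∀ t, circleMap c r t ∈ sphere c r := fun t => circleMap_mem_sphere c hr.le t
  have hΓ : Continuous fun t => G (circleMap c r t) := hG.comp_continuous (continuous_circleMap c r) hS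
  set h : ℝ → ℝ := fun t => dist (G (circleMap c r t)) c₁ with hh
  have hc : Continuous h := hΓ.dist continuous_const
  have hper : ∀ t, h (t + 2 * Real.pi) = h t := fun t => by simp only [hh, circleMap_add_two_pi]
  have hne : ∀ {s t}, |s - t| < 2 * Real.pi → s ≠ t →
      G (circleMap c r s) ≠ G (circleMap c r t) := fun hst hn he =>
    hn (eq_of_circleMap_eq hr.ne' hst (hinj (hS _) (hS _) he))
  obtain ⟨t₀, rfl⟩ : ∃ t₀, circleMap c r t₀ = x := by
    have : x ∈ range (circleMap c r) := by rwa [range_circleMap, abs_of_pos hr]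
    exact this
  obtain ⟨s₀, rfl⟩ : ∃ t₀, circleMap c r t₀ = y := by
    have : y ∈ range (circleMap c r) := by rwa [range_circleMap, abs_of_pos hr]
    exact this
  obtain ⟨s, hs, hse⟩ := (periodic_circleMap c r).exists_mem_Ioc Real.two_pi_pos s₀ t₀
  rw [hse] at hyi
  have h0 : r₁ < h t₀ := not_le.1 hxo
  have h0' : r₁ < h (t₀ + 2 * Real.pi) := by rwa [hper]
  have hs1 : h s < r₁ := hyi
  obtain ⟨t₁, ht₁, e₁⟩ := intermediate_value_Icc' hs.1.le hc.continuousOn ⟨hs1.le, h0.le⟩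
  obtain ⟨t₂, ht₂, e₂⟩ := intermediate_value_Icc hs.2 hc.continuousOn ⟨hs1.le, h0'.le⟩
  have a1 : t₀ < t₁ := lt_of_le_of_ne ht₁.1 fun he => by rw [he] at h0; linarith
  have a2 : t₁ < s := lt_of_le_of_ne ht₁.2 fun he => by rw [← he] at hs1; linarith
  have a3 : s < t₂ := lt_of_le_of_ne ht₂.1 fun he => by rw [he] at hs1; linarith
  have a4 : t₂ < t₀ + 2 * Real.pi := lt_of_le_of_ne ht₂.2 fun he => by rw [← he] at h0'; linarith
  have hcc : c₁ ≠ c₂ := by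
    rintro rfl
    have q1 := mem_sphere.1 (hm (hS t₁))
    have q2 := mem_sphere.1 (hm (hS s))
    simp only [hh] at e₁ hs1
    linarith
  have hfar : ∀ t, t ≠ t₁ → t ≠ t₂ → |t - t₁| < 2 * Real.pi → |t - t₂| < 2 * Real.pi → h t ≠ r₁ := by
    intro t n1 n2 d1 d2 he
    rcases EuclideanGeometry.eq_of_dist_eq_of_dist_eq_of_finrank_eq_two Complex.finrank_real_complex
      hcc (hne (s := t₁) (t := t₂) (by rw [abs_lt]; constructor <;> linarith) (by linarith)) e₁ e₂ he
      (hm (hS _)) (hm (hS _)) (hm (hS _)) with h' | h'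
    · exact hne d1 n1 h'
    · exact hne d2 n2 h'
  have hin : ∀ t ∈ Ioo t₁ t₂, h t ≠ r₁ := fun t ht => hfar t ht.1.ne' ht.2.ne
    (by rw [abs_lt]; constructor <;> linarith [ht.1, ht.2])
    (by rw [abs_lt]; constructor <;> linarith [ht.1, ht.2])
  have hout : ∀ t ∈ Ioo t₂ (t₁ + 2 * Real.pi), h t ≠ r₁ := fun t ht =>
    hfar t (by linarith [ht.1]) ht.1.ne'
    (by rw [abs_lt]; constructor <;> linarith [ht.1, ht.2])
    (by rw [abs_lt]; constructor <;> linarith [ht.1, ht.2])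
  refine ⟨t₁, t₂, by linarith, by linarith, fun t ht => ?_, fun t ht hball => ?_⟩
  · rw [mem_closedBall]
    rcases ht.1.eq_or_lt with rfl | h1
    · exact e₁.le
    rcases ht.2.eq_or_lt with rfl | h2
    · exact e₂.le
    exact (lt_of_isPreconnected_of_ne isPreconnected_Ioo hc.continuousOn hin ⟨a2, a3⟩ ⟨h1, h2⟩
      hs1).le
  · have hlt : h t < r₁ := hball
    rcases ht.1.eq_or_lt with rfl | h1
    · linarith
    rcases ht.2.eq_or_lt with rfl | h2
    · rw [hper] at hlt; linarith
    have := lt_of_isPreconnected_of_ne isPreconnected_Ioo hc.continuousOn hout ⟨h1, h2⟩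
      (v := t₀ + 2 * Real.pi) ⟨a4, by linarith⟩ hlt
    linarith

theorem lift_sub_lift_eq {A B : ℝ → ℂ} (hA : Continuous A) (hB : Continuous B) {s : Set ℝ}
    (hs : IsPreconnected s) {q : ℝ → ℂ} (hq : ContinuousOn q s)
    (hslit : ∀ t ∈ s, q t ∈ Complex.slitPlane)
    (he : ∀ t ∈ s, Complex.exp (A t) = q t * Complex.exp (B t)) {u v : ℝ} (hu : u ∈ s)
    (hv : v ∈ s) : (A u).im - (B u).im - (q u).arg = (A v).im - (B v).im - (q v).arg := by
  have := eqOn_const_of_exp_eq_one (d := fun t => A t - B t - Complex.log (q t)) hs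
    ((hA.sub hB).continuousOn.sub (hq.clog hslit)) (fun t ht => by
      have hq0 := Complex.slitPlane_ne_zero (hslit t ht)
      rw [Complex.exp_sub, Complex.exp_sub, Complex.exp_log hq0, he t ht,
        mul_div_cancel_right₀ _ (Complex.exp_ne_zero _), div_self hq0]) hu hv
  simpa [Complex.log_im] using congrArg Complex.im this

/-- The difference of two fixed point free orientation preserving embeddings of a circle onto
round circles has nonnegative winding number. -/
theorem ind_sub_nonneg {φ G : ℂ → ℂ} {c c₁ c₂ : ℂ} {r r₁ r₂ : ℝ} (hr : 0 < r) (hr₁ : 0 < r₁)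
    (hr₂ : 0 < r₂) (hφm : MapsTo φ (sphere c r) (sphere c₁ r₁)) (hφi : InjOn φ (sphere c r))
    (hφ1 : HasInd (fun z => φ z - c₁) c r 1) (hGm : MapsTo G (sphere c r) (sphere c₂ r₂))
    (hGi : InjOn G (sphere c r)) (hG1 : HasInd (fun z => G z - c₂) c r 1) {n : ℤ}
    (hn : HasInd (fun z => φ z - G z) c r n) : 0 ≤ n := by
  have hφc : ContinuousOn φ (sphere c r) := by
    exact ((hφ1.continuousOn hr).add (continuousOn_const (c := c₁))).congr fun z _ => by simp
  have hGc : ContinuousOn G (sphere c r) := by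
    exact ((hG1.continuousOn hr).add (continuousOn_const (c := c₂))).congr fun z _ => by simp
  have hφG : ∀ z ∈ sphere c r, φ z ≠ G z := fun z hz => sub_ne_zero.1 (hn.ne_zero hz)
  have hDc := hφc.sub hGc
  have hout : ∀ z ∈ sphere c r, φ z ∉ ball c₁ r₁ := fun z hz h =>
    (mem_ball.1 h).ne (mem_sphere.1 (hφm hz))
  by_cases hdis : Disjoint (ball c₁ r₁) (ball c₂ r₂)
  · have hdist : r₁ + r₂ ≤ ‖c₂ - c₁‖ := by
      rw [← dist_eq_norm, dist_comm]
      exact (disjoint_ball_ball_iff hr₁ hr₂).1 hdis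
    set w := starRingEnd ℂ (c₁ - c₂) with hw
    have hw0 : w ≠ 0 := by
      rw [hw, ← norm_pos_iff, RCLike.norm_conj, norm_sub_rev]
      linarith
    have hlog : HasLogOn (fun z => (φ z - G z) * w) (sphere c r) := by
      refine .of_slitPlane (hDc.mul continuousOn_const) fun z hz => ?_
      have h1 : -((φ z - c₁) * w).re ≤ r₁ * ‖c₂ - c₁‖ := by
        refine (neg_le_abs _).trans ((Complex.abs_re_le_norm _).trans ?_)
        rw [norm_mul, hw, RCLike.norm_conj, mem_sphere_iff_norm.1 (hφm hz), norm_sub_rev]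
      have h2 : ((G z - c₂) * w).re ≤ r₂ * ‖c₂ - c₁‖ := by
        refine (Complex.re_le_norm _).trans ?_
        rw [norm_mul, hw, RCLike.norm_conj, mem_sphere_iff_norm.1 (hGm hz), norm_sub_rev]
      have h3 : ((φ z - G z) * w).re
          = ((φ z - c₁) * w).re - ((G z - c₂) * w).re + ‖c₂ - c₁‖ * ‖c₂ - c₁‖ := by
        have : (φ z - G z) * w = (φ z - c₁) * w - (G z - c₂) * w + (c₁ - c₂) * w := by ring
        rw [this, Complex.add_re, Complex.sub_re, hw, Complex.mul_conj, Complex.ofReal_re,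
          Complex.normSq_eq_norm_sq, norm_sub_rev]
        ring
      have h4 : 0 ≤ ((φ z - G z) * w).re := by
        nlinarith [norm_nonneg (c₂ - c₁)]
      have h5 : (φ z - G z) * w ≠ 0 := mul_ne_zero (sub_ne_zero.2 (hφG z hz)) hw0
      by_contra hns
      rw [Complex.mem_slitPlane_iff] at hns
      push Not at hns
      exact h5 (Complex.ext (le_antisymm hns.1 h4) hns.2)
    have : HasLogOn (fun z => φ z - G z) (sphere c r) :=
      (hlog.div (.const hw0)).congr fun z _ => (mul_div_cancel_right₀ _ hw0).symm
    exact ((hn.unique hr (hasInd_zero_iff.2 this))).ge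
  obtain ⟨a, ha1, ha2⟩ := Set.not_disjoint_iff.1 hdis
  have hφa : HasInd (fun z => φ z - a) c r 1 := by
    simpa using HasInd.comp hr₁ (.sub_of_mem_ball ha1) hφc hφm hφ1 hr
  have hGa : HasInd (fun z => G z - a) c r 1 := by
    simpa using HasInd.comp hr₂ (.sub_of_mem_ball ha2) hGc hGm hG1 hr
  have hq1 : ContinuousOn (fun z => (φ z - G z) / (φ z - a)) (sphere c r) :=
    hDc.div (hφc.sub continuousOn_const) fun z hz => hφa.ne_zero hz
  have hq2 : ContinuousOn (fun z => (G z - φ z) / (G z - a)) (sphere c r) :=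
    (hGc.sub hφc).div (hGc.sub continuousOn_const) fun z hz => hGa.ne_zero hz
  have hslit1 : ∀ z ∈ sphere c r, G z ∈ closedBall c₁ r₁ →
      (φ z - G z) / (φ z - a) ∈ Complex.slitPlane := fun z hz h =>
    div_sub_mem_slitPlane ha1 h (hout z hz) (hφG z hz)
  have hslit2 : ∀ z ∈ sphere c r, G z ∉ ball c₁ r₁ →
      (G z - φ z) / (G z - a) ∈ Complex.slitPlane := fun z hz h =>
    div_sub_mem_slitPlane ha1 (sphere_subset_closedBall (hφm hz)) h (hφG z hz).symm
  by_cases hA : ∀ z ∈ sphere c r, G z ∈ closedBall c₁ r₁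
  · have := hφa.of_hasLogOn_div hr (.of_slitPlane hq1 fun z hz => hslit1 z hz (hA z hz))
    exact (hn.unique hr this).symm ▸ zero_le_one
  by_cases hB : ∀ z ∈ sphere c r, G z ∉ ball c₁ r₁
  · have h1 := hGa.of_hasLogOn_div hr (.of_slitPlane hq2 fun z hz => hslit2 z hz (hB z hz))
    have h2 : HasInd (fun z => φ z - G z) c r 1 := h1.of_hasLogOn_div hr
      ((HasLogOn.const (neg_ne_zero.2 one_ne_zero)).congr fun z hz => by
        rw [← neg_sub, neg_div, div_self (h1.ne_zero hz)])
    exact (hn.unique hr h2).symm ▸ zero_le_one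
  push Not at hA hB
  obtain ⟨x, hx, hxo⟩ := hA
  obtain ⟨y, hy, hyi⟩ := hB
  obtain ⟨t₁, t₂, h12, h21, hI, hJ⟩ := exists_arcs hr hGc hGm hGi hx hxo hy hyi
  obtain ⟨D, hDcont, hDe, hDp⟩ := hn.exists_lift hr
  obtain ⟨P, hPc, hPe, hPp⟩ := hφa.exists_lift hr
  obtain ⟨Q, hQc, hQe, hQp⟩ := hGa.exists_lift hr
  have hPm := strictMono_im_lift hr hφm hφi ha1 hPc hPe hPp h12
  have hQm := strictMono_im_lift hr hGm hGi ha2 hQc hQe hQp h21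
  have hS : ∀ t, circleMap c r t ∈ sphere c r := fun t => circleMap_mem_sphere c hr.le t
  have hcm := continuous_circleMap c r
  have E1 := lift_sub_lift_eq hDcont hPc isPreconnected_Icc
    (q := fun t => (φ (circleMap c r t) - G (circleMap c r t)) / (φ (circleMap c r t) - a))
    (hq1.comp_continuous hcm hS).continuousOn (fun t ht => hslit1 _ (hS t) (hI t ht))
    (fun t _ => by rw [← hDe, ← hPe, div_mul_cancel₀ _ (hφa.ne_zero (hS t))])
    (right_mem_Icc.2 h12.le) (left_mem_Icc.2 h12.le)
  have E2 := lift_sub_lift_eq (B := fun t => Q t + Real.pi * Complex.I) hDcont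
    (hQc.add continuous_const) isPreconnected_Icc
    (q := fun t => (G (circleMap c r t) - φ (circleMap c r t)) / (G (circleMap c r t) - a))
    (hq2.comp_continuous hcm hS).continuousOn (fun t ht => hslit2 _ (hS t) (hJ t ht))
    (fun t _ => by
      have := hGa.ne_zero (hS t)
      rw [← hDe, Complex.exp_add, ← hQe, Complex.exp_pi_mul_I]
      field_simp
      ring)
    (left_mem_Icc.2 h21.le) (right_mem_Icc.2 h21.le)
  have hπ : ∀ t, G (circleMap c r t) ∈ closedBall c₁ r₁ → G (circleMap c r t) ∉ ball c₁ r₁ →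
      |((φ (circleMap c r t) - G (circleMap c r t)) / (φ (circleMap c r t) - a)).arg -
        ((G (circleMap c r t) - φ (circleMap c r t)) / (G (circleMap c r t) - a)).arg| < Real.pi := by
    intro t h1 h2
    have s1 := hslit1 _ (hS t) h1
    have s2 := hslit2 _ (hS t) h2
    have n1 := hφa.ne_zero (hS t)
    have n2 := hGa.ne_zero (hS t)
    set p := φ (circleMap c r t)
    set g := G (circleMap c r t)
    have e1 : (p - g) / (p - a) = 1 + -((g - a) / (p - a)) := by field_simp; ring
    have e2 : (g - p) / (g - a) = 1 + (-((g - a) / (p - a)))⁻¹ := by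
      rw [← neg_inv, inv_div]; field_simp; ring
    rw [e1] at s1
    rw [e2] at s2
    rw [e1, e2]
    exact abs_arg_one_add_sub_arg_one_add_inv_lt (neg_ne_zero.2 (div_ne_zero n2 n1)) s1 s2
  have d2 := abs_lt.1 (hπ t₂ (hI _ (right_mem_Icc.2 h12.le)) (hJ _ (left_mem_Icc.2 h21.le)))
  have d1 := abs_lt.1 (hπ t₁ (hI _ (left_mem_Icc.2 h12.le)) (by
    have := hJ _ (right_mem_Icc.2 h21.le)
    rwa [circleMap_add_two_pi] at this))
  simp only [hDp, hQp, circleMap_add_two_pi] at E2 hQm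
  simp at E1 E2 hQm hPm
  have hfin : -(2 * Real.pi) < 2 * Real.pi * n := by linarith [d1.1, d1.2, d2.1, d2.2]
  have : (-1 : ℝ) < n := by nlinarith [Real.pi_pos]
  have : (-1 : ℤ) < n := by exact_mod_cast this
  omega

theorem norm_sub_eq_mul_norm_sub_of_mul_eq_sq {o v z : ℂ} {s t r : ℝ} (hr : 0 < r) (hv : ‖v‖ = 1)
    (hst : s * t = r ^ 2) (hz : z ∈ sphere o r) :
    ‖z - (o + s * v)‖ = |s| / r * ‖z - (o + t * v)‖ := by
  have key : ∀ x : ℝ, ‖z - (o + x * v)‖ ^ 2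
      = r ^ 2 + x ^ 2 - 2 * x * ((z - o) * (starRingEnd ℂ) v).re := fun x => by
    have h1 : ‖z - o‖ = r := mem_sphere_iff_norm.1 hz
    have h2 : (z - o) * (starRingEnd ℂ) (x * v) = x * ((z - o) * (starRingEnd ℂ) v) := by
      rw [map_mul, Complex.conj_ofReal]; ring
    rw [← sub_sub, ← Complex.normSq_eq_norm_sq, Complex.normSq_sub, Complex.normSq_eq_norm_sq,
      Complex.normSq_eq_norm_sq, h1, norm_mul, hv, Complex.norm_real, h2, Complex.re_ofReal_mul,
      mul_one, Real.norm_eq_abs, sq_abs]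
    ring
  rw [← sq_eq_sq₀ (norm_nonneg _) (by positivity), mul_pow, key, key, div_pow, sq_abs,
    div_mul_eq_mul_div, eq_div_iff (pow_pos hr 2).ne']
  set X := ((z - o) * (starRingEnd ℂ) v).re
  linear_combination (2 * s * X - (s * t + r ^ 2)) * hst

/-- Two disjoint closed discs have a pair of points which are inverse to each other with respect to
both boundary circles. -/
theorem exists_common_inverse_points {c₁ c₂ : ℂ} {r₁ r₂ : ℝ} (hr₁ : 0 < r₁) (hr₂ : 0 < r₂)
    (hd : Disjoint (closedBall c₁ r₁) (closedBall c₂ r₂)) :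
    ∃ p ∈ ball c₁ r₁, ∃ q ∈ ball c₂ r₂, (∃ κ : ℝ, 0 < κ ∧ ∀ z ∈ sphere c₁ r₁, ‖z - p‖ = κ * ‖z - q‖) ∧
      ∃ κ : ℝ, 0 < κ ∧ ∀ z ∈ sphere c₂ r₂, ‖z - p‖ = κ * ‖z - q‖ := by
  set d := ‖c₂ - c₁‖ with hdd
  have hlt : r₁ + r₂ < d := by
    rw [hdd, ← dist_eq_norm, dist_comm]
    exact (disjoint_closedBall_closedBall_iff hr₁.le hr₂.le).1 hd
  have hd0 : 0 < d := by linarith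
  obtain ⟨x, ⟨hx0, hx1⟩, hx⟩ := intermediate_value_Ioo hr₁.le
    (f := fun x => (d - x) * (d * x - r₁ ^ 2) - r₂ ^ 2 * x) (by fun_prop) (show (0 : ℝ) ∈ _ by
      constructor
      · nlinarith [mul_pos hd0 (pow_pos hr₁ 2)]
      · have : 0 < r₁ * ((d - r₁) - r₂) * ((d - r₁) + r₂) :=
          mul_pos (mul_pos hr₁ (by linarith)) (by linarith)
        nlinarith)
  simp only at hx
  set y := r₁ ^ 2 / x with hy
  have hxy : x * y = r₁ ^ 2 := by rw [hy]; field_simp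
  have hxy' : (x - d) * (y - d) = r₂ ^ 2 := by
    rw [hy]; field_simp; linarith
  set v : ℂ := (c₂ - c₁) / d with hv
  have hv1 : ‖v‖ = 1 := by
    rw [hv, norm_div, Complex.norm_real, Real.norm_of_nonneg hd0.le, div_self hd0.ne']
  have hc₂ : c₂ = c₁ + d * v := by
    have : (d : ℂ) ≠ 0 := by exact_mod_cast hd0.ne'
    rw [hv, mul_div_cancel₀ _ this]; ring
  have ht : ∀ t : ℝ, c₁ + t * v = c₂ + ((t - d : ℝ) : ℂ) * v := fun t => by
    rw [hc₂]; push_cast; ring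
  refine ⟨c₁ + x * v, ?_, c₁ + y * v, ?_, ⟨|x| / r₁, by positivity, fun z hz =>
    norm_sub_eq_mul_norm_sub_of_mul_eq_sq hr₁ hv1 hxy hz⟩, ⟨|x - d| / r₂, ?_, fun z hz => ?_⟩⟩
  · rw [mem_ball_iff_norm, add_sub_cancel_left, norm_mul, hv1, Complex.norm_real, mul_one,
      Real.norm_of_nonneg hx0.le]
    exact hx1
  · rw [ht, mem_ball_iff_norm, add_sub_cancel_left, norm_mul, hv1, Complex.norm_real, mul_one,
      Real.norm_eq_abs]
    refine abs_lt_of_sq_lt_sq ?_ hr₂.le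
    have h1 : r₂ < d - x := by linarith
    have h2 : (y - d) ^ 2 * (d - x) ^ 2 = r₂ ^ 2 * r₂ ^ 2 := by
      rw [← hxy']; ring
    have h3 : r₂ ^ 2 < (d - x) ^ 2 := by nlinarith
    by_contra! hcon
    nlinarith [pow_pos hr₂ 2]
  · exact div_pos (abs_pos.2 (by linarith)) hr₂
  · rw [ht x, ht y]
    exact norm_sub_eq_mul_norm_sub_of_mul_eq_sq hr₂ hv1 hxy' hz

/-- A Möbius transformation without pole in a closed disc maps the boundary circle to a circle,
preserving the orientation. -/
theorem exists_image_circle_of_moebius {p q α c : ℂ} {r : ℝ} (hr : 0 < r) (hpq : p ≠ q)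
    (hα : α ≠ 0) (hq : q ∉ closedBall c r) :
    ∃ (c' : ℂ) (r' : ℝ), 0 < r' ∧
      MapsTo (fun w => α * ((w - p) / (w - q))) (sphere c r) (sphere c' r') ∧
      InjOn (fun w => α * ((w - p) / (w - q))) (sphere c r) ∧
      HasInd (fun w => α * ((w - p) / (w - q)) - c') c r 1 := by
  set d := c - q with hd
  have hrd : r < ‖d‖ := by
    rw [mem_closedBall_iff_norm, norm_sub_rev] at hq
    exact not_le.1 hq
  set D : ℝ := ‖d‖ ^ 2 - r ^ 2 with hD
  have hD0 : 0 < D := by rw [hD]; nlinarith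
  have hDc : (D : ℂ) ≠ 0 := by exact_mod_cast hD0.ne'
  set β := α * (q - p) with hβ
  have hβ0 : β ≠ 0 := mul_ne_zero hα (sub_ne_zero.2 hpq.symm)
  have hne : ∀ w ∈ sphere c r, w - q ≠ 0 := fun w hw h =>
    hq (sphere_subset_closedBall (sub_eq_zero.1 h ▸ hw))
  set c' := α + β * (starRingEnd ℂ) d / D with hc'
  have key : ∀ w ∈ sphere c r, α * ((w - p) / (w - q)) - c'
      = -(β / D) * ((w - c) * ((starRingEnd ℂ) (w - q) / (w - q))) := fun w hw => by
    have h0 := hne w hw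
    have h1 : (w - c) * (starRingEnd ℂ) (w - c) = (r : ℂ) ^ 2 := by
      rw [Complex.mul_conj, Complex.normSq_eq_norm_sq, mem_sphere_iff_norm.1 hw]
      push_cast; rfl
    have h2 : (D : ℂ) = d * (starRingEnd ℂ) d - (r : ℂ) ^ 2 := by
      rw [Complex.mul_conj, Complex.normSq_eq_norm_sq, hD]
      push_cast; rfl
    have h3 : (starRingEnd ℂ) (w - q) = (starRingEnd ℂ) (w - c) + (starRingEnd ℂ) d := by
      rw [← map_add, hd]; ring_nf
    have h4 : (D : ℂ) - (starRingEnd ℂ) d * (w - q) = -((w - c) * (starRingEnd ℂ) (w - q)) := by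
      rw [h2, h3, mul_add, h1, hd]
      ring
    have h5 : α * ((w - p) / (w - q)) - c'
        = β / D * ((D - (starRingEnd ℂ) d * (w - q)) / (w - q)) := by
      rw [hc', hβ]
      field_simp
      ring
    rw [h5, h4]
    field_simp
  refine ⟨c', ‖β‖ / D * r, by positivity, fun w hw => ?_, fun w hw w' hw' h => ?_, ?_⟩
  · have h0 := norm_ne_zero_iff.2 (hne w hw)
    rw [mem_sphere_iff_norm]
    simp only
    rw [key w hw, norm_mul, norm_mul, norm_div, RCLike.norm_conj, div_self h0, norm_neg, norm_div,
      Complex.norm_real, Real.norm_of_nonneg hD0.le, mem_sphere_iff_norm.1 hw, mul_one]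
  · have h1 := mul_left_cancel₀ hα h
    rw [div_eq_div_iff (hne w hw) (hne w' hw')] at h1
    have h2 : (q - p) * (w - w') = 0 := by linear_combination -h1
    exact sub_eq_zero.1 ((mul_eq_zero.1 h2).resolve_left (sub_ne_zero.2 hpq.symm))
  · refine HasInd.of_hasLogOn_div hr (.sub_self hr) ?_
    have hq0 := hasInd_zero_iff.1 (HasInd.sub_of_notMem_closedBall hq)
    have hn : HasLogOn (fun w => ((‖w - q‖ ^ 2 : ℝ) : ℂ)) (sphere c r) := by
      refine .of_slitPlane (by fun_prop) fun w hw => ?_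
      rw [Complex.ofReal_mem_slitPlane]
      exact pow_pos (norm_pos_iff.2 (hne w hw)) 2
    refine ((HasLogOn.const (neg_ne_zero.2 (div_ne_zero hβ0 hDc))).mul
      (hn.div (hq0.mul hq0))).congr fun w hw => ?_
    have h0 := hne w hw
    have h1 := sub_ne_zero_of_mem_sphere hr hw
    rw [key w hw, ← Complex.normSq_eq_norm_sq, ← Complex.mul_conj]
    field_simp

theorem exists_mem_ball_notMem_of_volume_eq_zero {N : Set ℂ} (hN : volume N = 0) (a₀ : ℂ) {δ : ℝ}
    (hδ : 0 < δ) (κ κ' : ℝ) :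
    ∃ a ∈ ball a₀ δ, a ∉ N ∧ a ≠ 0 ∧ ‖a‖ ≠ κ ∧ ‖a‖ ≠ κ' := by
  have hs : ∀ t : ℝ, volume (sphere (0 : ℂ) t) = 0 := fun t => Measure.addHaar_sphere _ _ _
  have h0 : volume (N ∪ sphere 0 0 ∪ sphere 0 κ ∪ sphere 0 κ') = 0 :=
    measure_union_null (measure_union_null (measure_union_null hN (hs _)) (hs _)) (hs _)
  have hpos : volume (ball a₀ δ \ (N ∪ sphere 0 0 ∪ sphere 0 κ ∪ sphere 0 κ')) ≠ 0 := by
    rw [measure_sdiff_null h0]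
    exact (measure_ball_pos volume a₀ hδ).ne'
  obtain ⟨a, ha, hna⟩ := nonempty_of_measure_ne_zero hpos
  simp only [mem_union, mem_sphere_zero_iff_norm, norm_eq_zero, not_or] at hna
  exact ⟨a, ha, hna.1.1.1, hna.1.1.2, hna.1.2, hna.2⟩

theorem hasInd_sub_const_of_norm_eq {u : ℂ → ℂ} {c a : ℂ} {r κ : ℝ} (hr : 0 < r)
    (hu : HasInd u c r 0) (hκ : ∀ z ∈ sphere c r, ‖u z‖ = κ) (ha : a ≠ 0) (hne : ‖a‖ ≠ κ) :
    HasInd (fun z => u z - a) c r 0 := by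
  have huc := hu.continuousOn hr
  rw [hasInd_zero_iff] at *
  rcases hne.lt_or_gt with h | h
  · have h1 : HasLogOn (fun z => 1 - a / u z) (sphere c r) := by
      refine .of_norm_sub_one_lt (continuousOn_const.sub (continuousOn_const.div huc
        fun z hz => hu.ne_zero hz)) fun z hz => ?_
      have h0 := norm_pos_iff.2 (hu.ne_zero hz)
      rw [sub_sub_cancel_left, norm_neg, norm_div, div_lt_one h0, hκ z hz]
      exact h
    refine (hu.mul h1).congr fun z hz => ?_
    have h0 := hu.ne_zero hz
    field_simp
  · have h1 : HasLogOn (fun z => 1 - u z / a) (sphere c r) := by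
      refine .of_norm_sub_one_lt (continuousOn_const.sub (huc.div_const a)) fun z hz => ?_
      rw [sub_sub_cancel_left, norm_neg, norm_div, div_lt_one (norm_pos_iff.2 ha), hκ z hz]
      exact h
    refine ((HasLogOn.const (neg_ne_zero.2 ha)).mul h1).congr fun z hz => ?_
    field_simp
    ring

section

open ComplexConjugate

theorem one_sub_conj_mul_ne_zero {q z : ℂ} (hq : ‖q‖ < 1) (hz : ‖z‖ ≤ 1) : 1 - conj q * z ≠ 0 := by
  intro h
  have h1 : ‖conj q * z‖ = 1 := by rw [← sub_eq_zero.1 h, norm_one]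
  rw [norm_mul, RCLike.norm_conj] at h1
  nlinarith [norm_nonneg q, norm_nonneg z]

theorem norm_one_sub_conj_mul_sq (q z : ℂ) :
    ‖1 - conj q * z‖ ^ 2 = ‖z - q‖ ^ 2 + (1 - ‖z‖ ^ 2) * (1 - ‖q‖ ^ 2) := by
  simp only [← Complex.normSq_eq_norm_sq, Complex.normSq_apply, Complex.sub_re, Complex.sub_im,
    Complex.mul_re, Complex.mul_im, Complex.conj_re, Complex.conj_im, Complex.one_re, Complex.one_im]
  ring

theorem one_sub_norm_sq_pos {q : ℂ} (hq : ‖q‖ < 1) : 0 < 1 - ‖q‖ ^ 2 := by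
  nlinarith [norm_nonneg q]

theorem one_sub_norm_sq_ne_zero {q : ℂ} (hq : ‖q‖ < 1) : (1 : ℂ) - (‖q‖ : ℂ) ^ 2 ≠ 0 := by
  exact_mod_cast (one_sub_norm_sq_pos hq).ne'

/-- The Möbius transformation `z ↦ (z - p) / (z - q)` maps the unit circle to the circle centred
at `moebiusCenter p q`. -/
def moebiusCenter (p q : ℂ) : ℂ := (1 - conj q * p) / (1 - (‖q‖ : ℂ) ^ 2)

theorem sub_div_sub_sub_moebiusCenter {p q z : ℂ} (hq : ‖q‖ < 1) (hz : z ≠ q) :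
    (z - p) / (z - q) - moebiusCenter p q
      = (q - p) / (1 - (‖q‖ : ℂ) ^ 2) * ((1 - conj q * z) / (z - q)) := by
  have h0 := one_sub_norm_sq_ne_zero hq
  have h1 := sub_ne_zero.2 hz
  have h2 : (‖q‖ : ℂ) ^ 2 = q * conj q := by
    rw [Complex.mul_conj, Complex.normSq_eq_norm_sq]; push_cast; rfl
  rw [moebiusCenter]
  field_simp
  rw [h2]
  ring

theorem norm_sub_div_sub_sub_moebiusCenter {p q z : ℂ} (hq : ‖q‖ < 1) (hz : z ≠ q) :
    ‖(z - p) / (z - q) - moebiusCenter p q‖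
      = ‖q - p‖ / (1 - ‖q‖ ^ 2) * (‖1 - conj q * z‖ / ‖z - q‖) := by
  have h : (1 : ℂ) - (‖q‖ : ℂ) ^ 2 = ((1 - ‖q‖ ^ 2 : ℝ) : ℂ) := by push_cast; rfl
  rw [sub_div_sub_sub_moebiusCenter hq hz, norm_mul, norm_div, norm_div, h, Complex.norm_real,
    Real.norm_of_nonneg (one_sub_norm_sq_pos hq).le]

theorem norm_sub_div_le_norm_sub_moebiusCenter {p q z : ℂ} (hq : ‖q‖ < 1) (hz : ‖z‖ ≤ 1)
    (hzq : z ≠ q) : ‖q - p‖ / (1 - ‖q‖ ^ 2) ≤ ‖(z - p) / (z - q) - moebiusCenter p q‖ := by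
  have h0 := one_sub_norm_sq_pos hq
  have h1 : 0 < ‖z - q‖ := norm_pos_iff.2 (sub_ne_zero.2 hzq)
  rw [norm_sub_div_sub_sub_moebiusCenter hq hzq]
  refine le_mul_of_one_le_right (by positivity) ((one_le_div h1).2 ?_)
  refine le_of_sq_le_sq ?_ (norm_nonneg _)
  rw [norm_one_sub_conj_mul_sq]
  have : 0 ≤ 1 - ‖z‖ ^ 2 := by nlinarith [norm_nonneg z]
  nlinarith [mul_nonneg this h0.le]

theorem exists_norm_moebiusCenter_sub_le (p : ℂ) {q : ℂ} (hq : ‖q‖ < 1) :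
    ∃ C : ℝ, ∃ R < 1, ∀ z : ℂ, R < ‖z‖ → ‖z‖ < 1 →
      ‖(z - p) / (z - q) - moebiusCenter p q‖ ≤ ‖q - p‖ / (1 - ‖q‖ ^ 2) + C * (1 - ‖z‖) := by
  set s := ‖q - p‖ / (1 - ‖q‖ ^ 2) with hs
  have h0 := one_sub_norm_sq_pos hq
  have hs0 : 0 ≤ s := by positivity
  have hq1 : 0 < 1 - ‖q‖ := by linarith
  refine ⟨s * (8 / (1 - ‖q‖)), (1 + ‖q‖) / 2, by linarith, fun z hz hz1 => ?_⟩
  have hzq : z ≠ q := by rintro rfl; linarith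
  have h1 : (1 - ‖q‖) / 2 ≤ ‖z - q‖ := by linarith [norm_sub_norm_le z q]
  have h1' : 0 < ‖z - q‖ := by linarith
  have h2 : 1 - ‖q‖ ≤ ‖1 - conj q * z‖ := by
    have := norm_sub_norm_le (1 : ℂ) (conj q * z)
    rw [norm_one, norm_mul, RCLike.norm_conj] at this
    nlinarith [norm_nonneg q]
  have h3 := norm_one_sub_conj_mul_sq q z
  rw [norm_sub_div_sub_sub_moebiusCenter hq hzq, mul_assoc, ← mul_one_add]
  refine mul_le_mul_of_nonneg_left ?_ hs0
  have h4 : ‖1 - conj q * z‖ ≤ ‖z - q‖ + 4 * (1 - ‖z‖) := by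
    by_contra! hcon
    have e1 : 4 * (1 - ‖z‖) * (1 - ‖q‖) <
        (‖1 - conj q * z‖ - ‖z - q‖) * (‖1 - conj q * z‖ + ‖z - q‖) := by
      have : 0 < 1 - ‖z‖ := by linarith
      nlinarith
    have e2 : (1 - ‖z‖ ^ 2) * (1 - ‖q‖ ^ 2) ≤ 4 * (1 - ‖z‖) * (1 - ‖q‖) := by
      have : (1 + ‖z‖) * (1 + ‖q‖) ≤ 4 := by nlinarith [norm_nonneg q, norm_nonneg z]
      have h5 : 0 ≤ (1 - ‖z‖) * (1 - ‖q‖) := mul_nonneg (by linarith) hq1.le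
      nlinarith
    nlinarith
  rw [div_le_iff₀ h1', add_mul, one_mul]
  have h5 : 4 * (1 - ‖z‖) ≤ 8 / (1 - ‖q‖) * (1 - ‖z‖) * ‖z - q‖ := by
    rw [div_mul_eq_mul_div, div_mul_eq_mul_div, le_div_iff₀ hq1]
    have : 0 < 1 - ‖z‖ := by linarith
    nlinarith
  linarith

theorem exists_norm_mul_moebiusCenter_sub_lt {p q a₀ : ℂ} (hq : ‖q‖ < 1) {b : ℝ}
    (hb : ‖a₀‖ * (‖q - p‖ / (1 - ‖q‖ ^ 2)) < b) :
    ∃ R < 1, ∃ δ > 0, ∀ a ∈ ball a₀ δ, ∀ z : ℂ, R < ‖z‖ → ‖z‖ < 1 →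
      ‖a₀ * moebiusCenter p q - a * ((z - p) / (z - q))‖ < b := by
  obtain ⟨C, R, hR, hC⟩ := exists_norm_moebiusCenter_sub_le p hq
  set s := ‖q - p‖ / (1 - ‖q‖ ^ 2) with hs
  have hC' : ∀ z : ℂ, R < ‖z‖ → ‖z‖ < 1 →
      ‖(z - p) / (z - q) - moebiusCenter p q‖ ≤ s + |C| * (1 - ‖z‖) := fun z h1 h2 =>
    (hC z h1 h2).trans (by gcongr; exact le_abs_self C)
  have hcont : Continuous fun x : ℝ => ‖a₀‖ * (s + |C| * x) + x * (‖moebiusCenter p q‖ + s + |C|) := by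
    fun_prop
  have hev : ∀ᶠ x in 𝓝 (0 : ℝ), ‖a₀‖ * (s + |C| * x) + x * (‖moebiusCenter p q‖ + s + |C|) < b :=
    hcont.continuousAt.eventually_lt continuousAt_const (by simpa using hb)
  obtain ⟨x, hx, hx0, hx1⟩ := ((hev.filter_mono nhdsWithin_le_nhds).and
    (Ioo_mem_nhdsGT (show (0 : ℝ) < 1 from one_pos))).exists
  refine ⟨max R (1 - x), max_lt hR (by linarith), x, hx0, fun a ha z hz hz1 => ?_⟩
  have hzR := (le_max_left _ _).trans_lt hz
  have hzx : 1 - ‖z‖ ≤ x := by linarith [(le_max_right R (1 - x)).trans_lt hz]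
  have h1 := hC' z hzR hz1
  have hx' : |C| * (1 - ‖z‖) ≤ |C| * x := by gcongr
  have h2 : ‖(z - p) / (z - q)‖ ≤ ‖moebiusCenter p q‖ + s + |C| := by
    have := norm_le_norm_add_norm_sub (moebiusCenter p q) ((z - p) / (z - q))
    rw [norm_sub_rev] at this
    have : |C| * x ≤ |C| := mul_le_of_le_one_right (abs_nonneg C) hx1.le
    linarith
  have e : a₀ * moebiusCenter p q - a * ((z - p) / (z - q))
      = -(a₀ * ((z - p) / (z - q) - moebiusCenter p q) + (a - a₀) * ((z - p) / (z - q))) := by ring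
  rw [e, norm_neg]
  refine (norm_add_le _ _).trans_lt (lt_of_le_of_lt ?_ hx)
  rw [norm_mul, norm_mul]
  have ha' : ‖a - a₀‖ ≤ x := (mem_ball_iff_norm.1 ha).le
  gcongr
  exact h1.trans (by linarith)

/-- The pseudo-hyperbolic distance in the unit disc. -/
def pseudoHypDist (p q : ℂ) : ℝ := ‖p - q‖ / ‖1 - conj q * p‖

theorem norm_sub_div_eq_pseudoHypDist_mul {p q : ℂ} (hp : ‖p‖ < 1) (hq : ‖q‖ < 1) :
    ‖q - p‖ / (1 - ‖q‖ ^ 2) = pseudoHypDist p q * ‖moebiusCenter p q‖ := by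
  have h : (1 : ℂ) - (‖q‖ : ℂ) ^ 2 = ((1 - ‖q‖ ^ 2 : ℝ) : ℂ) := by push_cast; rfl
  have h1 := norm_ne_zero_iff.2 (one_sub_conj_mul_ne_zero hq hp.le)
  rw [moebiusCenter, norm_div, h, Complex.norm_real, Real.norm_of_nonneg (one_sub_norm_sq_pos hq).le,
    pseudoHypDist, norm_sub_rev q p, div_mul_div_comm, mul_comm ‖1 - conj q * p‖,
    mul_div_mul_right _ _ h1]

theorem moebiusCenter_ne_zero {p q : ℂ} (hp : ‖p‖ < 1) (hq : ‖q‖ < 1) : moebiusCenter p q ≠ 0 :=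
  div_ne_zero (one_sub_conj_mul_ne_zero hq hp.le) (one_sub_norm_sq_ne_zero hq)

theorem exists_norm_sub_div_sub_le (p : ℂ) {q c : ℂ} {r : ℝ} (hq : q ∈ ball c r) :
    ∃ M : ℝ, 0 ≤ M ∧ (∀ z ∉ ball c r, ‖(z - p) / (z - q)‖ ≤ M) ∧
      ∀ z ∉ ball c r, ∀ w ∉ ball c r,
        ‖(z - p) / (z - q) - (w - p) / (w - q)‖ ≤ M * ‖z - w‖ := by
  set η := r - ‖q - c‖ with hη
  have hη0 : 0 < η := by rw [mem_ball_iff_norm] at hq; linarith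
  have hfar : ∀ z ∉ ball c r, η ≤ ‖z - q‖ := fun z hz => by
    rw [mem_ball_iff_norm, not_lt] at hz
    have := norm_sub_le_norm_sub_add_norm_sub z q c
    linarith
  have hne : ∀ z ∉ ball c r, z - q ≠ 0 := fun z hz =>
    norm_pos_iff.1 (hη0.trans_le (hfar z hz))
  refine ⟨1 + ‖q - p‖ / η + ‖q - p‖ / η ^ 2, by positivity, fun z hz => ?_, fun z hz w hw => ?_⟩
  · have h0 := hne z hz
    have e : (z - p) / (z - q) = 1 + (q - p) / (z - q) := by field_simp; ring
    have h1 : ‖(q - p) / (z - q)‖ ≤ ‖q - p‖ / η := by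
      rw [norm_div]; gcongr; exact hfar z hz
    have h2 := norm_add_le (1 : ℂ) ((q - p) / (z - q))
    rw [norm_one] at h2
    rw [e]
    have : 0 ≤ ‖q - p‖ / η ^ 2 := by positivity
    linarith
  · have h0 := hne z hz
    have h1 := hne w hw
    have e : (z - p) / (z - q) - (w - p) / (w - q) = -((q - p) / ((z - q) * (w - q)) * (z - w)) := by
      field_simp; ring
    have h2 : ‖(q - p) / ((z - q) * (w - q))‖ ≤ ‖q - p‖ / η ^ 2 := by
      rw [norm_div, norm_mul, sq]
      gcongr
      exacts [hfar z hz, hfar w hw]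
    rw [e, norm_neg, norm_mul]
    gcongr
    have : 0 ≤ ‖q - p‖ / η := by positivity
    linarith

namespace IsOrientedSchottkyHomeo

variable {I : Type*} {c : I → ℂ} {r : I → ℝ} {ct : I → ℂ} {rt : I → ℝ} {f g : ℂ → ℂ}

/-- The index of a Möbius transformation composed with a homeomorphism of Schottky sets. -/
theorem exists_circle_moebius_comp (H : IsOrientedSchottkyHomeo c r ct rt f g) {p q α : ℂ}
    (hpq : p ≠ q) (hα : α ≠ 0) {i : I} (hq : q ∉ closedBall (ct i) (rt i)) :
    ∃ (c' : ℂ) (r' : ℝ), 0 < r' ∧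
      MapsTo (fun z => α * ((f z - p) / (f z - q))) (sphere (c i) (r i)) (sphere c' r') ∧
      InjOn (fun z => α * ((f z - p) / (f z - q))) (sphere (c i) (r i)) ∧
      HasInd (fun z => α * ((f z - p) / (f z - q)) - c') (c i) (r i) 1 := by
  have hs := sphere_subset_schottkySet H.fam i
  have hm := IsSchottkyHomeo.mapsTo_sphere H.image_sphere i
  obtain ⟨c', r', hr', h1, h2, h3⟩ := exists_image_circle_of_moebius (H.fam'.1 i) hpq hα hq
  refine ⟨c', r', hr', h1.comp hm, h2.comp (H.injOn.mono hs) hm, ?_⟩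
  simpa using HasInd.comp (H.fam'.1 i) h3 (H.cont.mono hs) hm (H.ind i) (H.fam.1 i)

theorem refl (h : IsSchottkyFamily (ball (0 : ℂ) 1) c r) : IsOrientedSchottkyHomeo c r c r id id where
  fam := h
  fam' := h
  cont := continuousOn_id
  cont' := continuousOn_id
  maps := mapsTo_id _
  maps' := mapsTo_id _
  left_inv _ _ := rfl
  right_inv _ _ := rfl
  image_sphere _ := image_id _
  ind i := .sub_self (h.1 i)

theorem ind_moebius_comp (H : IsOrientedSchottkyHomeo c r ct rt f g) {p q : ℂ} {k l : I}
    (hkl : k ≠ l) (hp : p ∈ ball (ct k) (rt k)) (hq : q ∈ ball (ct l) (rt l)) :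
    HasInd (fun z => (f z - p) / (f z - q)) (c k) (r k) 1 ∧
    HasInd (fun z => (f z - p) / (f z - q)) (c l) (r l) (-1) ∧
    ∀ i, i ≠ k → i ≠ l → HasInd (fun z => (f z - p) / (f z - q)) (c i) (r i) 0 := by
  have hin : ∀ {i a}, a ∈ ball (ct i) (rt i) → HasInd (fun z => f z - a) (c i) (r i) 1 :=
    fun {i} _ ha => H.hasInd_sub_of_mem_ball H.image_sphere (H.ind i) ha
  have hout : ∀ {i j a}, a ∈ ball (ct j) (rt j) → i ≠ j → HasInd (fun z => f z - a) (c i) (r i) 0 :=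
    fun ha hij => H.hasInd_sub_of_notMem_closedBall H.image_sphere
      (notMem_closedBall_of_mem_sphere H.fam' hij.symm (ball_subset_closedBall ha))
  refine ⟨?_, ?_, fun i hik hil => ?_⟩
  · simpa using (hin hp).div (H.fam.1 k) (hout hq hkl)
  · simpa using (hout hp hkl.symm).div (H.fam.1 l) (hin hq)
  · simpa using (hout hp hik).div (H.fam.1 i) (hout hq hil)

theorem volume_image_moebius_div_eq_zero (H : IsOrientedSchottkyHomeo c r ct rt f g)
    (hN : HasNullGraph f (schottkySet c r)) {k l : I} {p q p' q' : ℂ}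
    (hp : p ∈ ball (c k) (r k)) (hq' : q' ∈ ball (ct l) (rt l)) :
    volume ((fun z => (f z - p') / (f z - q') * ((z - q) / (z - p))) '' schottkySet c r) = 0 := by
  obtain ⟨M, hM0, hMb, hMl⟩ := exists_norm_sub_div_sub_le q hp
  obtain ⟨N, hN0, hNb, hNl⟩ := exists_norm_sub_div_sub_le p' hq'
  refine hN _ (M * N) (mul_nonneg hM0 hN0) fun x hx y hy => ?_
  have hxk := notMem_ball_of_mem_schottkySet hx k
  have hyk := notMem_ball_of_mem_schottkySet hy k
  have hxl := notMem_ball_of_mem_schottkySet (H.maps hx) l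
  have hyl := notMem_ball_of_mem_schottkySet (H.maps hy) l
  simp only [dist_eq_norm]
  have e : (f x - p') / (f x - q') * ((x - q) / (x - p))
      - (f y - p') / (f y - q') * ((y - q) / (y - p))
      = (f x - p') / (f x - q') * ((x - q) / (x - p) - (y - q) / (y - p))
        + ((f x - p') / (f x - q') - (f y - p') / (f y - q')) * ((y - q) / (y - p)) := by ring
  rw [e]
  refine (norm_add_le _ _).trans ?_
  rw [norm_mul, norm_mul]
  calc _ ≤ N * (M * ‖x - y‖) + N * ‖f x - f y‖ * M := by
        gcongr
        exacts [hNb _ hxl, hMl _ hxk _ hyk, hNl _ hxl _ hyl, hMb _ hyk]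
    _ = _ := by ring

theorem pseudoHypDist_le_of_inverse_points (H : IsOrientedSchottkyHomeo c r ct rt f g)
    (hN : HasNullGraph f (schottkySet c r)) {k l : I} (hkl : k ≠ l) {p q p' q' : ℂ}
    (hp : p ∈ ball (c k) (r k)) (hq : q ∈ ball (c l) (r l))
    (hp' : p' ∈ ball (ct k) (rt k)) (hq' : q' ∈ ball (ct l) (rt l))
    (hk : ∃ κ : ℝ, 0 < κ ∧ ∀ z ∈ sphere (c k) (r k), ‖z - p‖ = κ * ‖z - q‖)
    (hl : ∃ κ : ℝ, 0 < κ ∧ ∀ z ∈ sphere (c l) (r l), ‖z - p‖ = κ * ‖z - q‖)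
    (hk' : ∃ κ : ℝ, 0 < κ ∧ ∀ z ∈ sphere (ct k) (rt k), ‖z - p'‖ = κ * ‖z - q'‖)
    (hl' : ∃ κ : ℝ, 0 < κ ∧ ∀ z ∈ sphere (ct l) (rt l), ‖z - p'‖ = κ * ‖z - q'‖) :
    pseudoHypDist p' q' ≤ pseudoHypDist p q := by
  by_contra! hlt
  have Hid := refl H.fam
  have hlt1 : ∀ {i z}, z ∈ ball (c i) (r i) → ‖z‖ < 1 := fun h => by
    simpa using H.fam.2.1 _ (ball_subset_closedBall h)
  have hlt1' : ∀ {i z}, z ∈ ball (ct i) (rt i) → ‖z‖ < 1 := fun h => by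
    simpa using H.fam'.2.1 _ (ball_subset_closedBall h)
  have hpq : p ≠ q := by
    rintro rfl
    exact notMem_closedBall_of_mem_sphere H.fam hkl (ball_subset_closedBall hp)
      (ball_subset_closedBall hq)
  have hpq' : p' ≠ q' := by
    rintro rfl
    exact notMem_closedBall_of_mem_sphere H.fam' hkl (ball_subset_closedBall hp')
      (ball_subset_closedBall hq')
  have nzp : ∀ z ∈ schottkySet c r, z - p ≠ 0 := fun z hz => Hid.center_ne hz hp
  have nzq : ∀ z ∈ schottkySet c r, z - q ≠ 0 := fun z hz => Hid.center_ne hz hq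
  have nfp : ∀ z ∈ schottkySet c r, f z - p' ≠ 0 := fun z hz => H.center_ne hz hp'
  have nfq : ∀ z ∈ schottkySet c r, f z - q' ≠ 0 := fun z hz => H.center_ne hz hq'
  set d := moebiusCenter p q with hd
  set d' := moebiusCenter p' q' with hd'
  have hd0 : d ≠ 0 := moebiusCenter_ne_zero (hlt1 hp) (hlt1 hq)
  have hd0' : d' ≠ 0 := moebiusCenter_ne_zero (hlt1' hp') (hlt1' hq')
  set a₀ := d' / d with ha₀
  have ha₀d : a₀ * d = d' := div_mul_cancel₀ _ hd0
  have hb : ‖a₀‖ * (‖q - p‖ / (1 - ‖q‖ ^ 2)) < ‖q' - p'‖ / (1 - ‖q'‖ ^ 2) := by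
    rw [norm_sub_div_eq_pseudoHypDist_mul (hlt1 hp) (hlt1 hq),
      norm_sub_div_eq_pseudoHypDist_mul (hlt1' hp') (hlt1' hq'), mul_left_comm, ← norm_mul, ← hd,
      ha₀d]
    exact mul_lt_mul_of_pos_right hlt (norm_pos_iff.2 hd0')
  obtain ⟨R, hR, δ, hδ, hclose⟩ := exists_norm_mul_moebiusCenter_sub_lt (hlt1 hq) hb
  rw [← hd, ha₀d] at hclose
  obtain ⟨κ₁, hκ₁, hk⟩ := hk
  obtain ⟨κ₂, hκ₂, hl⟩ := hl
  obtain ⟨κ₃, hκ₃, hk'⟩ := hk'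
  obtain ⟨κ₄, hκ₄, hl'⟩ := hl'
  obtain ⟨a, haδ, haQ, ha0, hak, hal⟩ := exists_mem_ball_notMem_of_volume_eq_zero
    (H.volume_image_moebius_div_eq_zero hN (q := q) (p' := p') hp hq') a₀ hδ (κ₃ / κ₁) (κ₄ / κ₂)
  set Q : ℂ → ℂ := fun z => (f z - p') / (f z - q') * ((z - q) / (z - p)) with hQ
  have hQa : ∀ z ∈ schottkySet c r, Q z - a ≠ 0 := fun z hz h =>
    haQ ⟨z, hz, sub_eq_zero.1 h⟩
  have hQe : ∀ z, Q z = (f z - p') / (f z - q') / ((z - p) / (z - q)) := fun z => by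
    rw [hQ, div_div_eq_mul_div, mul_div_assoc]
  have hQnorm : ∀ {i : I} {κ κ' : ℝ}, 0 < κ → (∀ z ∈ sphere (c i) (r i), ‖z - p‖ = κ * ‖z - q‖) →
      (∀ z ∈ sphere (ct i) (rt i), ‖z - p'‖ = κ' * ‖z - q'‖) →
      ∀ z ∈ sphere (c i) (r i), ‖Q z‖ = κ' / κ := by
    intro i κ κ' hκ h h' z hz
    have hzS := sphere_subset_schottkySet H.fam i hz
    have n1 := norm_ne_zero_iff.2 (nzq z hzS)
    have n2 := norm_ne_zero_iff.2 (nfq z hzS)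
    rw [hQe, norm_div, norm_div, norm_div, h z hz,
      h' _ (IsSchottkyHomeo.mapsTo_sphere H.image_sphere i hz), mul_div_cancel_right₀ _ n1,
      mul_div_cancel_right₀ _ n2]
  obtain ⟨i1, i2, i3⟩ := Hid.ind_moebius_comp hkl hp hq
  obtain ⟨j1, j2, j3⟩ := H.ind_moebius_comp hkl hp' hq'
  have hind : ∀ i, ∃ n : ℤ, 0 ≤ n ∧ (i = l → n = 1) ∧
      HasInd (fun z => (Q z - a) * (f z - q')) (c i) (r i) n := by
    intro i
    have hri := H.fam.1 i
    have hsS := sphere_subset_schottkySet H.fam i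
    have hfq0 : i ≠ l → HasInd (fun z => f z - q') (c i) (r i) 0 := fun hil =>
      H.hasInd_sub_of_notMem_closedBall H.image_sphere
        (notMem_closedBall_of_mem_sphere H.fam' hil.symm (ball_subset_closedBall hq'))
    by_cases hil : i = l
    · subst hil
      have h0 : HasInd Q (c i) (r i) 0 := (j2.div hri i2).congr fun z _ => hQe z
      have h1 := hasInd_sub_const_of_norm_eq hri h0 (hQnorm hκ₂ hl hl') ha0 hal
      refine ⟨1, zero_le_one, fun _ => rfl, ?_⟩
      simpa using h1.mul hri (H.hasInd_sub_of_mem_ball H.image_sphere (H.ind i) hq')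
    by_cases hik : i = k
    · subst hik
      have h0 : HasInd Q (c i) (r i) 0 := (j1.div hri i1).congr fun z _ => hQe z
      have h1 := hasInd_sub_const_of_norm_eq hri h0 (hQnorm hκ₁ hk hk') ha0 hak
      refine ⟨0, le_rfl, fun h => absurd h hil, ?_⟩
      simpa using h1.mul hri (hfq0 hil)
    · obtain ⟨c₁, r₁, hr₁, hm₁, hi₁, hind₁⟩ := H.exists_circle_moebius_comp hpq' one_ne_zero
        (notMem_closedBall_of_mem_sphere H.fam' (Ne.symm hil) (ball_subset_closedBall hq'))
      obtain ⟨c₂, r₂, hr₂, hm₂, hi₂, hind₂⟩ := Hid.exists_circle_moebius_comp hpq ha0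
        (notMem_closedBall_of_mem_sphere H.fam (Ne.symm hil) (ball_subset_closedBall hq))
      simp only [one_mul, id] at hm₁ hi₁ hind₁ hm₂ hi₂ hind₂
      have hz := i3 i hik hil
      have hQz : ∀ z ∈ sphere (c i) (r i), Q z - a
          = ((f z - p') / (f z - q') - a * ((z - p) / (z - q))) / ((z - p) / (z - q)) := by
        intro z hzs
        have hz0 : (z - p) / (z - q) ≠ 0 := hz.ne_zero hzs
        rw [hQe, sub_div ((f z - p') / (f z - q')), mul_div_cancel_right₀ _ hz0]
      have hcont : ContinuousOn
          (fun z => (f z - p') / (f z - q') - a * ((z - p) / (z - q))) (sphere (c i) (r i)) :=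
        ((j3 i hik hil).continuousOn hri).sub (continuousOn_const.mul (hz.continuousOn hri))
      obtain ⟨n, hn⟩ := exists_hasInd hri hcont fun z hzs h => by
        have := hQz z hzs
        rw [h, zero_div] at this
        exact hQa z (hsS hzs) this
      refine ⟨n, ind_sub_nonneg hri hr₁ hr₂ hm₁ hi₁ hind₁ hm₂ hi₂ hind₂ hn,
        fun h => absurd h hil, ?_⟩
      have h1 : HasInd (fun z => Q z - a) (c i) (r i) n := by
        simpa using (hn.div hri hz).congr hQz
      simpa using h1.mul hri (hfq0 hil)
  choose n hn0 hn1 hn using hind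
  have hQc : ContinuousOn Q (schottkySet c r) :=
    ((H.cont.sub continuousOn_const).div (H.cont.sub continuousOn_const) nfq).mul
      ((continuousOn_id.sub continuousOn_const).div (continuousOn_id.sub continuousOn_const) nzp)
  have hlog : HasLogOn (fun z => (Q z - a) * (f z - q'))
      (schottkySet c r ∩ {z | max R (max ‖p‖ ‖q‖) < ‖z‖}) := by
    have hfX := H.cont.mono (inter_subset_left (t := {z : ℂ | max R (max ‖p‖ ‖q‖) < ‖z‖}))
    have hzX : ContinuousOn (fun z : ℂ => z)
      (schottkySet c r ∩ {z | max R (max ‖p‖ ‖q‖) < ‖z‖}) := continuousOn_id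
    have hgap : ∀ z ∈ schottkySet c r ∩ {z : ℂ | max R (max ‖p‖ ‖q‖) < ‖z‖},
        ‖d' - a * ((z - p) / (z - q))‖ < ‖(f z - p') / (f z - q') - d'‖ := fun z hz =>
      (hclose a haδ z ((le_max_left _ _).trans_lt hz.2) (norm_lt_one_of_mem_schottkySet hz.1)).trans_le
        (norm_sub_div_le_norm_sub_moebiusCenter (hlt1' hq')
          (norm_lt_one_of_mem_schottkySet (H.maps hz.1)).le (sub_ne_zero.1 (nfq z hz.1)))
    have l1 : HasLogOn (fun z => 1 + (d' - a * ((z - p) / (z - q))) /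
        ((f z - p') / (f z - q') - d')) (schottkySet c r ∩ {z | max R (max ‖p‖ ‖q‖) < ‖z‖}) := by
      refine .of_norm_sub_one_lt (continuousOn_const.add (ContinuousOn.div ?_ ?_ fun z hz => ?_))
        fun z hz => ?_
      · exact continuousOn_const.sub (continuousOn_const.mul ((hzX.sub continuousOn_const).div
          (hzX.sub continuousOn_const) fun z hz => nzq z hz.1))
      · exact ((hfX.sub continuousOn_const).div (hfX.sub continuousOn_const)
          fun z hz => nfq z hz.1).sub continuousOn_const
      · exact norm_pos_iff.1 ((norm_nonneg _).trans_lt (hgap z hz))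
      · rw [add_sub_cancel_left, norm_div, div_lt_one ((norm_nonneg _).trans_lt (hgap z hz))]
        exact hgap z hz
    have l2 : HasLogOn (fun z => 1 - conj q' * f z)
        (schottkySet c r ∩ {z | max R (max ‖p‖ ‖q‖) < ‖z‖}) := by
      refine .of_norm_sub_one_lt (continuousOn_const.sub (continuousOn_const.mul hfX)) fun z hz => ?_
      rw [sub_sub_cancel_left, norm_neg, norm_mul, RCLike.norm_conj]
      exact mul_lt_one_of_nonneg_of_lt_one_left (norm_nonneg _) (hlt1' hq')
        (norm_lt_one_of_mem_schottkySet (H.maps hz.1)).le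
    have hmax : ∀ z ∈ schottkySet c r ∩ {z : ℂ | max R (max ‖p‖ ‖q‖) < ‖z‖},
        ‖p‖ < ‖z‖ ∧ ‖q‖ < ‖z‖ := fun z hz => max_lt_iff.1 (max_lt_iff.1 hz.2).2
    have l3 := hasLogOn_sub_div_sub hzX (fun z hz => (hmax z hz).2) fun z hz => (hmax z hz).1
    have l4 : HasLogOn (fun _ => (q' - p') / (1 - (‖q'‖ : ℂ) ^ 2))
        (schottkySet c r ∩ {z | max R (max ‖p‖ ‖q‖) < ‖z‖}) :=
      .const (div_ne_zero (sub_ne_zero.2 hpq'.symm) (one_sub_norm_sq_ne_zero (hlt1' hq')))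
    refine (((l4.mul l2).mul l1).mul l3).congr fun z hz => ?_
    have n1 := nzp z hz.1
    have n2 := nzq z hz.1
    have n3 := nfq z hz.1
    have hne : (f z - p') / (f z - q') - d' ≠ 0 :=
      norm_pos_iff.1 ((norm_nonneg _).trans_lt (hgap z hz))
    have e1 : (q' - p') / (1 - (‖q'‖ : ℂ) ^ 2) * (1 - conj q' * f z)
        = ((f z - p') / (f z - q') - d') * (f z - q') := by
      rw [hd', sub_div_sub_sub_moebiusCenter (hlt1' hq') (sub_ne_zero.1 n3), mul_assoc,
        div_mul_cancel₀ _ n3]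
    have e2 : ((f z - p') / (f z - q') - d') * (1 + (d' - a * ((z - p) / (z - q))) /
        ((f z - p') / (f z - q') - d')) = (f z - p') / (f z - q') - a * ((z - p) / (z - q)) := by
      rw [mul_add, mul_div_cancel₀ _ hne]; ring
    rw [e1, mul_right_comm _ (f z - q'), e2]
    simp only [hQ]
    field_simp
  obtain ⟨A, hA, hsum⟩ := exists_sum_ind_eq_zero H.fam.1 H.fam.2.2 H.fam.2.1 rfl
    ((hQc.sub continuousOn_const).mul (H.cont.sub continuousOn_const))
    (fun z hz => mul_ne_zero (hQa z hz) (nfq z hz)) hn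
    (max_lt hR (max_lt (hlt1 hp) (hlt1 hq))) hlog {l}
  have := Finset.single_le_sum (f := n) (fun i _ => hn0 i) (hA (Finset.mem_singleton_self l))
  rw [hsum, hn1 l rfl] at this
  omega

theorem exists_pseudoHypDist_eq (H : IsOrientedSchottkyHomeo c r ct rt f g)
    (hN : HasNullGraph f (schottkySet c r)) {k l : I} (hkl : k ≠ l) :
    ∃ p ∈ ball (c k) (r k), ∃ q ∈ ball (c l) (r l), ∃ p' ∈ ball (ct k) (rt k),
      ∃ q' ∈ ball (ct l) (rt l), pseudoHypDist p' q' = pseudoHypDist p q := by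
  obtain ⟨p, hp, q, hq, hk, hl⟩ :=
    exists_common_inverse_points (H.fam.1 k) (H.fam.1 l) (H.fam.2.2 hkl)
  obtain ⟨p', hp', q', hq', hk', hl'⟩ :=
    exists_common_inverse_points (H.fam'.1 k) (H.fam'.1 l) (H.fam'.2.2 hkl)
  exact ⟨p, hp, q, hq, p', hp', q', hq',
    (H.pseudoHypDist_le_of_inverse_points hN hkl hp hq hp' hq' hk hl hk' hl').antisymm
      (H.symm.pseudoHypDist_le_of_inverse_points
        (hN.symm H.maps H.maps' H.left_inv H.right_inv) hkl hp' hq' hp hq hk' hl' hk hl)⟩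

end IsOrientedSchottkyHomeo

end

theorem finite_setOf_le_radius {I : Type*} {c : I → ℂ} {r : I → ℝ}
    (h : IsSchottkyFamily (ball (0 : ℂ) 1) c r) {η : ℝ} (hη : 0 < η) : {i | η ≤ r i}.Finite := by
  refine (Measure.finite_const_le_meas_of_disjoint_iUnion (volume : Measure ℂ)
    (As := fun i => ball (c i) (r i)) (measure_ball_pos volume (0 : ℂ) hη)
    (fun i => measurableSet_ball) (fun i j hij => ?_) ?_).subset fun i hi => ?_
  · exact (h.2.2 hij).mono ball_subset_closedBall ball_subset_closedBall
  · exact ne_top_of_le_ne_top (measure_ball_lt_top (x := (0 : ℂ)) (r := 1)).ne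
      (measure_mono (iUnion_subset fun i => ball_subset_closedBall.trans (h.2.1 i)))
  · rw [mem_ofPred_eq, ← Measure.addHaar_ball_center volume (c i) η]
    exact measure_mono (ball_subset_ball hi)

theorem exists_closedBall_subset_ball {I : Type*} {c : I → ℂ} {r : I → ℝ}
    (h : IsSchottkyFamily (ball (0 : ℂ) 1) c r) (h0 : volume (schottkySet c r) = 0) {P : ℂ}
    (hP : P ∈ schottkySet c r) {ε : ℝ} (hε : 0 < ε) :
    ∃ i, closedBall (c i) (r i) ⊆ ball P ε := by
  set F := {i | ε / 4 ≤ r i} with hF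
  have hfin : F.Finite := finite_setOf_le_radius h (by positivity)
  set V : Set ℂ := ball P (ε / 2) ∩ ball 0 1 ∩
    (⋃ i ∈ F ∩ {i | P ∉ closedBall (c i) (r i)}, closedBall (c i) (r i))ᶜ with hV
  have hVo : IsOpen V := (isOpen_ball.inter isOpen_ball).inter
    ((hfin.subset inter_subset_left).isClosed_biUnion fun i _ => isClosed_closedBall).isOpen_compl
  have hPV : P ∈ V := ⟨⟨mem_ball_self (by positivity), hP.1⟩, by
    simp only [mem_compl_iff, mem_iUnion, not_exists]
    exact fun i hi => hi.2⟩
  obtain ⟨W, hWo, hWne, hWV, hWF⟩ : ∃ W : Set ℂ, IsOpen W ∧ W.Nonempty ∧ W ⊆ V ∧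
      ∀ i ∈ F, Disjoint W (closedBall (c i) (r i)) := by
    have hVF : ∀ i ∈ F, P ∉ closedBall (c i) (r i) → ∀ x ∈ V, x ∉ closedBall (c i) (r i) :=
      fun i hi hiP x hx hxi => hx.2 (mem_biUnion (show i ∈ F ∩ _ from ⟨hi, hiP⟩) hxi)
    by_cases hex : ∃ i, P ∈ closedBall (c i) (r i)
    · obtain ⟨i, hi⟩ := hex
      refine ⟨V \ closedBall (c i) (r i), hVo.sdiff isClosed_closedBall, ?_, sdiff_subset,
        fun j hj => Set.disjoint_left.2 fun x hx hxj => ?_⟩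
      · rw [nonempty_iff_ne_empty, Ne, sdiff_eq_empty]
        intro hsub
        refine notMem_ball_of_mem_schottkySet hP i ?_
        rw [← interior_closedBall _ (h.1 i).ne']
        exact interior_maximal hsub hVo hPV
      · by_cases hji : j = i
        · exact hx.2 (hji ▸ hxj)
        · exact hVF j hj (fun hPj => Set.disjoint_left.1 (h.2.2 hji) hPj hi) x hx.1 hxj
    · exact ⟨V, hVo, ⟨P, hPV⟩, subset_rfl, fun i hi => Set.disjoint_left.2
        (hVF i hi fun hPi => hex ⟨i, hPi⟩)⟩
  obtain ⟨i, x, hxW, hxi⟩ : ∃ i, ∃ x ∈ W, x ∈ ball (c i) (r i) := by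
    by_contra! hcon
    refine (hWo.measure_pos volume hWne).ne' (measure_mono_null (fun x hx => ?_) h0)
    refine ⟨(hWV hx).1.2, ?_⟩
    simp only [mem_iUnion, not_exists]
    exact fun i => hcon i x hx
  have hri : r i < ε / 4 := by
    by_contra! hi
    exact Set.disjoint_left.1 (hWF i hi) hxW (ball_subset_closedBall hxi)
  refine ⟨i, fun y hy => ?_⟩
  have h1 : dist x P < ε / 2 := (hWV hxW).1.1
  have h2 := mem_ball.1 hxi
  have h3 := mem_closedBall.1 hy
  rw [mem_ball]
  linarith [dist_triangle4_right y P (c i) x, dist_triangle y (c i) P, dist_triangle_right (c i) P x,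
    dist_comm P x, dist_comm x (c i)]

theorem continuousAt_pseudoHypDist {p q : ℂ} (hp : ‖p‖ < 1) (hq : ‖q‖ < 1) :
    ContinuousAt (fun x : ℂ × ℂ => pseudoHypDist x.1 x.2) (p, q) := by
  unfold pseudoHypDist
  refine ContinuousAt.div (by fun_prop) ?_ (norm_ne_zero_iff.2 (one_sub_conj_mul_ne_zero hq hp.le))
  exact (continuous_const.sub ((Complex.continuous_conj.comp continuous_snd).mul
    continuous_fst)).norm.continuousAt

theorem IsOrientedSchottkyHomeo.pseudoHypDist_eq {I : Type*} {c : I → ℂ} {r : I → ℝ} {ct : I → ℂ}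
    {rt : I → ℝ} {f g : ℂ → ℂ} (H : IsOrientedSchottkyHomeo c r ct rt f g)
    (hN : HasNullGraph f (schottkySet c r)) (h0 : volume (schottkySet c r) = 0) {P Q : ℂ}
    (hP : P ∈ schottkySet c r) (hQ : Q ∈ schottkySet c r) :
    pseudoHypDist (f P) (f Q) = pseudoHypDist P Q := by
  rcases eq_or_ne P Q with rfl | hPQ
  · simp [pseudoHypDist]
  have hnear : ∀ P ∈ schottkySet c r, ∀ ε > 0, ∃ i, closedBall (c i) (r i) ⊆ ball P ε ∧
      closedBall (ct i) (rt i) ⊆ ball (f P) ε := by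
    intro P hP ε hε
    obtain ⟨δ, hδ, hδf⟩ := Metric.continuousOn_iff.1 H.cont P hP ε hε
    obtain ⟨i, hi⟩ := exists_closedBall_subset_ball H.fam h0 hP (lt_min hε hδ)
    refine ⟨i, hi.trans (ball_subset_ball (min_le_left _ _)), ?_⟩
    rw [← convexHull_sphere_eq_closedBall _ (H.fam'.1 i).le, ← H.image_sphere i]
    refine convexHull_min ?_ (convex_ball _ _)
    rintro _ ⟨z, hz, rfl⟩
    exact hδf z (sphere_subset_schottkySet H.fam i hz)
      ((hi (sphere_subset_closedBall hz)).trans_le (min_le_right _ _))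
  have key : ∀ n : ℕ, ∃ p q p' q' : ℂ, pseudoHypDist p' q' = pseudoHypDist p q ∧
      dist p P ≤ 1 / ((n : ℝ) + 1) ∧ dist q Q ≤ 1 / ((n : ℝ) + 1) ∧
      dist p' (f P) ≤ 1 / ((n : ℝ) + 1) ∧ dist q' (f Q) ≤ 1 / ((n : ℝ) + 1) := by
    intro n
    have hd : 0 < dist P Q := dist_pos.2 hPQ
    have hε : 0 < min (1 / ((n : ℝ) + 1)) (dist P Q / 2) := by positivity
    obtain ⟨k, hk, hk'⟩ := hnear P hP _ hε
    obtain ⟨l, hl, hl'⟩ := hnear Q hQ _ hε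
    have hkl : k ≠ l := by
      rintro rfl
      have hc := mem_closedBall_self (x := c k) (H.fam.1 k).le
      have h1 := (mem_ball.1 (hk hc)).trans_le (min_le_right _ _)
      have h2 := (mem_ball.1 (hl hc)).trans_le (min_le_right _ _)
      linarith [dist_triangle_left P Q (c k)]
    obtain ⟨p, hp, q, hq, p', hp', q', hq', he⟩ := H.exists_pseudoHypDist_eq hN hkl
    have hle := min_le_left (1 / ((n : ℝ) + 1)) (dist P Q / 2)
    exact ⟨p, q, p', q', he, (hk (ball_subset_closedBall hp)).le.trans hle,
      (hl (ball_subset_closedBall hq)).le.trans hle,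
      (hk' (ball_subset_closedBall hp')).le.trans hle,
      (hl' (ball_subset_closedBall hq')).le.trans hle⟩
  choose p q p' q' he hp hq hp' hq' using key
  have hlim : ∀ {u : ℕ → ℂ} {a : ℂ}, (∀ n : ℕ, dist (u n) a ≤ 1 / ((n : ℝ) + 1)) →
      Tendsto u atTop (𝓝 a) := fun h => tendsto_iff_dist_tendsto_zero.2
    (squeeze_zero (fun _ => dist_nonneg) h tendsto_one_div_add_atTop_nhds_zero_nat)
  have h1 := (continuousAt_pseudoHypDist (norm_lt_one_of_mem_schottkySet hP)
    (norm_lt_one_of_mem_schottkySet hQ)).tendsto.comp ((hlim hp).prodMk_nhds (hlim hq))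
  have h2 := (continuousAt_pseudoHypDist (norm_lt_one_of_mem_schottkySet (H.maps hP))
    (norm_lt_one_of_mem_schottkySet (H.maps hQ))).tendsto.comp
      ((hlim hp').prodMk_nhds (hlim hq'))
  exact tendsto_nhds_unique h2 (h1.congr fun n => (he n).symm)

section

open ComplexConjugate

theorem norm_sub_sq_eq_of_pseudoHypDist_eq {x y x' y' : ℂ} (hx : ‖x‖ < 1) (hy : ‖y‖ < 1)
    (hxx : ‖x'‖ = ‖x‖) (hyy : ‖y'‖ = ‖y‖) (h : pseudoHypDist x' y' = pseudoHypDist x y) :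
    ‖x' - y'‖ ^ 2 = ‖x - y‖ ^ 2 := by
  have hK : 0 < (1 - ‖x‖ ^ 2) * (1 - ‖y‖ ^ 2) :=
    mul_pos (one_sub_norm_sq_pos hx) (one_sub_norm_sq_pos hy)
  have h2 : pseudoHypDist x' y' ^ 2 = pseudoHypDist x y ^ 2 := by rw [h]
  unfold pseudoHypDist at h2
  rw [div_pow, div_pow, norm_one_sub_conj_mul_sq, norm_one_sub_conj_mul_sq, hxx, hyy,
    div_eq_div_iff (by positivity) (by positivity)] at h2
  exact mul_right_cancel₀ hK.ne' (by linarith)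

theorem pseudoHypDist_moebius {a z w : ℂ} (ha : ‖a‖ < 1) (hz : ‖z‖ < 1) (hw : ‖w‖ < 1) :
    pseudoHypDist ((z - a) / (1 - conj a * z)) ((w - a) / (1 - conj a * w))
      = pseudoHypDist z w := by
  have h1 := one_sub_conj_mul_ne_zero ha hz.le
  have h2 := one_sub_conj_mul_ne_zero ha hw.le
  have h2' : 1 - a * conj w ≠ 0 := by simpa using (map_ne_zero (starRingEnd ℂ)).2 h2
  have h3 : (1 : ℂ) - conj a * a ≠ 0 := one_sub_conj_mul_ne_zero ha ha.le
  have e1 : (z - a) / (1 - conj a * z) - (w - a) / (1 - conj a * w)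
      = (z - w) * (1 - conj a * a) / ((1 - conj a * z) * (1 - conj a * w)) := by
    rw [div_sub_div _ _ h1 h2]
    congr 1
    ring
  have e2 : 1 - conj ((w - a) / (1 - conj a * w)) * ((z - a) / (1 - conj a * z))
      = (1 - conj w * z) * (1 - conj a * a) / ((1 - conj a * z) * conj (1 - conj a * w)) := by
    simp only [map_div₀, map_sub, map_mul, map_one, Complex.conj_conj]
    rw [div_mul_div_comm, one_sub_div (mul_ne_zero h2' h1), mul_comm (1 - a * conj w)]
    congr 1
    ring
  rw [pseudoHypDist, e1, e2, norm_div, norm_div, norm_mul, norm_mul, norm_mul, norm_mul,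
    RCLike.norm_conj, div_div_div_cancel_right₀ (mul_ne_zero (norm_ne_zero_iff.2 h1)
      (norm_ne_zero_iff.2 h2)), mul_div_mul_right _ _ (norm_ne_zero_iff.2 h3), pseudoHypDist]

/-- Two families of vectors in the plane with equal Gram matrices differ by a rotation or a
reflection. -/
theorem exists_eq_mul_or_eq_mul_conj {ι : Type*} {X : Set ι} {x y : ι → ℂ}
    (h : ∀ i ∈ X, ∀ j ∈ X, (y i * conj (y j)).re = (x i * conj (x j)).re) :
    ∃ u : ℂ, u ≠ 0 ∧ ((∀ i ∈ X, y i = u * x i) ∨ ∀ i ∈ X, y i = u * conj (x i)) := by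
  have hsq : ∀ i ∈ X, Complex.normSq (y i) = Complex.normSq (x i) := fun i hi => by
    simpa only [Complex.mul_conj, Complex.ofReal_re] using h i hi i hi
  by_cases hex : ∃ k ∈ X, x k ≠ 0
  · obtain ⟨k, hk, hxk⟩ := hex
    have hyk : y k ≠ 0 := by
      rwa [← Complex.normSq_pos, hsq k hk, Complex.normSq_pos]
    have hyk' : conj (y k) ≠ 0 := (map_ne_zero _).2 hyk
    have hxk' : conj (x k) ≠ 0 := (map_ne_zero _).2 hxk
    have hprod : ∀ i ∈ X, ∀ j ∈ X, (y i * conj (y k)).im * (y j * conj (y k)).im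
        = (x i * conj (x k)).im * (x j * conj (x k)).im := by
      intro i hi j hj
      have h1 := h i hi j hj
      have h2 := h i hi k hk
      have h3 := h j hj k hk
      have h4 := hsq k hk
      have e : ∀ a b c : ℂ, (a * conj c).im * (b * conj c).im
          = Complex.normSq c * (a * conj b).re - (a * conj c).re * (b * conj c).re := by
        intro a b c
        simp only [Complex.mul_re, Complex.mul_im, Complex.conj_re, Complex.conj_im,
          Complex.normSq_apply]
        ring
      rw [e, e, h1, h2, h3, h4]
    have hor : (∀ i ∈ X, (y i * conj (y k)).im = (x i * conj (x k)).im) ∨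
        ∀ i ∈ X, (y i * conj (y k)).im = -(x i * conj (x k)).im := by
      by_cases hall : ∀ i ∈ X, (x i * conj (x k)).im = 0
      · refine Or.inl fun i hi => ?_
        have := hprod i hi i hi
        rw [hall i hi, mul_zero, mul_self_eq_zero] at this
        rw [this, hall i hi]
      · push Not at hall
        obtain ⟨l, hl, hl0⟩ := hall
        rcases mul_self_eq_mul_self_iff.1 (hprod l hl l hl) with he | he
        · refine Or.inl fun i hi => mul_left_cancel₀ hl0 ?_
          rw [← hprod l hl i hi, he]
        · refine Or.inr fun i hi => mul_left_cancel₀ hl0 ?_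
          rw [mul_neg, ← hprod l hl i hi, he, neg_mul, neg_neg]
    rcases hor with hor | hor
    · refine ⟨conj (x k) / conj (y k), div_ne_zero hxk' hyk', Or.inl fun i hi => ?_⟩
      have := Complex.ext (h i hi k hk) (hor i hi)
      rw [div_mul_eq_mul_div, eq_div_iff hyk', this, mul_comm]
    · refine ⟨x k / conj (y k), div_ne_zero hxk hyk', Or.inr fun i hi => ?_⟩
      have : y i * conj (y k) = conj (x i * conj (x k)) :=
        Complex.ext (by rw [h i hi k hk, Complex.conj_re]) (by rw [hor i hi, Complex.conj_im])
      rw [div_mul_eq_mul_div, eq_div_iff hyk', this, map_mul, Complex.conj_conj, mul_comm]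
  · push Not at hex
    refine ⟨1, one_ne_zero, Or.inl fun i hi => ?_⟩
    have := hsq i hi
    rw [hex i hi, map_zero, Complex.normSq_eq_zero] at this
    rw [this, hex i hi, mul_zero]

theorem exists_moebius_of_eq_mul {u ζ₀ w₀ : ℂ} (hu : u ≠ 0) (hζ₀ : ‖ζ₀‖ < 1) (hw₀ : ‖w₀‖ < 1) :
    ∃ a b c d : ℂ, a * d - b * c = 1 ∧ ∀ ζ w : ℂ, ‖ζ‖ < 1 → ‖w‖ < 1 →
      (w - w₀) / (1 - conj w₀ * w) = u * ((ζ - ζ₀) / (1 - conj ζ₀ * ζ)) →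
        c * ζ + d ≠ 0 ∧ w = (a * ζ + b) / (c * ζ + d) := by
  have h1 : 1 - conj ζ₀ * ζ₀ ≠ 0 := one_sub_conj_mul_ne_zero hζ₀ hζ₀.le
  have h2 : 1 - conj w₀ * w₀ ≠ 0 := one_sub_conj_mul_ne_zero hw₀ hw₀.le
  obtain ⟨s, hs⟩ := IsAlgClosed.exists_pow_nat_eq
    (u * ((1 - conj ζ₀ * ζ₀) * (1 - conj w₀ * w₀))) two_pos
  have hs0 : s ≠ 0 := fun h => mul_ne_zero hu (mul_ne_zero h1 h2) (by rw [← hs, h]; simp)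
  refine ⟨(u - w₀ * conj ζ₀) / s, (w₀ - u * ζ₀) / s, (conj w₀ * u - conj ζ₀) / s,
    (1 - conj w₀ * u * ζ₀) / s, ?_, fun ζ w hζ hw h => ?_⟩
  · rw [div_mul_div_comm, div_mul_div_comm, ← sub_div, div_eq_one_iff_eq (mul_ne_zero hs0 hs0), ← sq,
      hs]
    ring
  · have n1 := one_sub_conj_mul_ne_zero hζ₀ hζ.le
    have n2 := one_sub_conj_mul_ne_zero hw₀ hw.le
    rw [mul_div_assoc', div_eq_div_iff n2 n1] at h
    have key : ((conj w₀ * u - conj ζ₀) * ζ + (1 - conj w₀ * u * ζ₀)) * (1 - conj w₀ * w)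
        = (1 - conj ζ₀ * ζ) * (1 - conj w₀ * w₀) := by
      linear_combination (-conj w₀) * h
    have hne : (conj w₀ * u - conj ζ₀) * ζ + (1 - conj w₀ * u * ζ₀) ≠ 0 := fun h0 => by
      rw [h0, zero_mul] at key
      exact mul_ne_zero n1 h2 key.symm
    have e1 : (conj w₀ * u - conj ζ₀) / s * ζ + (1 - conj w₀ * u * ζ₀) / s
        = ((conj w₀ * u - conj ζ₀) * ζ + (1 - conj w₀ * u * ζ₀)) / s := by ring
    have e2 : (u - w₀ * conj ζ₀) / s * ζ + (w₀ - u * ζ₀) / s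
        = ((u - w₀ * conj ζ₀) * ζ + (w₀ - u * ζ₀)) / s := by ring
    rw [e1, e2, div_div_div_cancel_right₀ hs0, eq_div_iff hne]
    exact ⟨div_ne_zero hne hs0, by linear_combination h⟩

theorem exists_moebius_of_pseudoHypDist_eq {S : Set ℂ} {f : ℂ → ℂ} (hS : ∀ z ∈ S, ‖z‖ < 1)
    (hf : ∀ z ∈ S, ‖f z‖ < 1)
    (h : ∀ z ∈ S, ∀ w ∈ S, pseudoHypDist (f z) (f w) = pseudoHypDist z w) :
    ∃ a b c d : ℂ, a * d - b * c = 1 ∧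
      ((∀ z ∈ S, c * z + d ≠ 0 ∧ f z = (a * z + b) / (c * z + d)) ∨
        ∀ z ∈ S, c * conj z + d ≠ 0 ∧ f z = (a * conj z + b) / (c * conj z + d)) := by
  rcases S.eq_empty_or_nonempty with rfl | ⟨z₀, hz₀⟩
  · exact ⟨1, 0, 0, 1, by simp⟩
  set A : ℂ → ℂ := fun z => (z - z₀) / (1 - conj z₀ * z) with hA
  set B : ℂ → ℂ := fun z => (f z - f z₀) / (1 - conj (f z₀) * f z) with hB
  have hA0 : A z₀ = 0 := by simp [hA]
  have hB0 : B z₀ = 0 := by simp [hB]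
  have hnorm : ∀ z ∈ S, ‖B z‖ = ‖A z‖ := fun z hz => by
    simpa only [hA, hB, pseudoHypDist, norm_div] using h z hz z₀ hz₀
  have hA1 : ∀ z ∈ S, ‖A z‖ < 1 := fun z hz => by
    have h1 := norm_one_sub_conj_mul_sq z₀ z
    have h2 := mul_pos (one_sub_norm_sq_pos (hS z hz)) (one_sub_norm_sq_pos (hS z₀ hz₀))
    rw [hA, norm_div, div_lt_one (norm_pos_iff.2 (one_sub_conj_mul_ne_zero (hS z₀ hz₀) (hS z hz).le))]
    exact lt_of_pow_lt_pow_left₀ 2 (norm_nonneg _) (by linarith)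
  have hgram : ∀ z ∈ S, ∀ w ∈ S, (B z * conj (B w)).re = (A z * conj (A w)).re := by
    intro z hz w hw
    have h1 : pseudoHypDist (B z) (B w) = pseudoHypDist (A z) (A w) := by
      rw [pseudoHypDist_moebius (hf z₀ hz₀) (hf z hz) (hf w hw),
        pseudoHypDist_moebius (hS z₀ hz₀) (hS z hz) (hS w hw), h z hz w hw]
    have h2 := norm_sub_sq_eq_of_pseudoHypDist_eq (hA1 z hz) (hA1 w hw) (hnorm z hz) (hnorm w hw) h1
    rw [← Complex.normSq_eq_norm_sq, ← Complex.normSq_eq_norm_sq, Complex.normSq_sub,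
      Complex.normSq_sub, Complex.normSq_eq_norm_sq, Complex.normSq_eq_norm_sq, hnorm z hz,
      hnorm w hw, Complex.normSq_eq_norm_sq, Complex.normSq_eq_norm_sq] at h2
    linarith
  obtain ⟨u, hu, hAB | hAB⟩ := exists_eq_mul_or_eq_mul_conj hgram
  · obtain ⟨a, b, c, d, hdet, hm⟩ := exists_moebius_of_eq_mul hu (hS z₀ hz₀) (hf z₀ hz₀)
    exact ⟨a, b, c, d, hdet, Or.inl fun z hz => hm z (f z) (hS z hz) (hf z hz) (hAB z hz)⟩
  · obtain ⟨a, b, c, d, hdet, hm⟩ := exists_moebius_of_eq_mul hu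
      (ζ₀ := conj z₀) (by rw [RCLike.norm_conj]; exact hS z₀ hz₀) (hf z₀ hz₀)
    refine ⟨a, b, c, d, hdet, Or.inr fun z hz => hm (conj z) (f z)
      (by rw [RCLike.norm_conj]; exact hS z hz) (hf z hz) ?_⟩
    have := hAB z hz
    simpa only [hA, hB, map_div₀, map_sub, map_mul, map_one] using this

theorem pseudoHypDist_conj_conj (z w : ℂ) :
    pseudoHypDist (conj z) (conj w) = pseudoHypDist z w := by
  have : 1 - conj (conj w) * conj z = conj (1 - conj w * z) := by simp
  rw [pseudoHypDist, this, ← map_sub, RCLike.norm_conj, RCLike.norm_conj, pseudoHypDist]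

end

theorem IsHomeoOn.exists_isSchottkyHomeo {I J : Type*} {c : I → ℂ} {r : I → ℝ} {ct : J → ℂ}
    {rt : J → ℝ} {f : ℂ → ℂ} (hf : IsHomeoOn f (schottkySet c r) (schottkySet ct rt))
    (h : IsSchottkyFamily (ball (0 : ℂ) 1) c r) (h' : IsSchottkyFamily (ball (0 : ℂ) 1) ct rt) :
    ∃ g, IsSchottkyHomeo c r ct rt f g := by
  classical
  obtain ⟨e, he⟩ := hf
  refine ⟨fun w => if hw : w ∈ schottkySet ct rt then e.symm ⟨w, hw⟩ else 0, h, h', ?_, ?_, ?_, ?_,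
    fun z hz => ?_, fun w hw => ?_⟩
  · rw [continuousOn_iff_continuous_domRestrict]
    exact (continuous_subtype_val.comp e.continuous).congr he
  · rw [continuousOn_iff_continuous_domRestrict]
    exact (continuous_subtype_val.comp e.symm.continuous).congr fun w => by simp
  · exact fun z hz => he ⟨z, hz⟩ ▸ (e ⟨z, hz⟩).2
  · intro w hw
    simp [hw]
  · have hz' : f z ∈ schottkySet ct rt := he ⟨z, hz⟩ ▸ (e ⟨z, hz⟩).2
    rw [dif_pos hz', show (⟨f z, hz'⟩ : schottkySet ct rt) = e ⟨z, hz⟩ from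
      Subtype.ext (he ⟨z, hz⟩).symm, e.symm_apply_apply]
  · rw [dif_pos hw, ← he, e.apply_symm_apply]

/-- A locally quasisymmetric homeomorphism between measure-zero relative
Schottky sets in the unit disc is the restriction of a Möbius transformation, possibly
pre-composed with complex conjugation. -/
theorem schottky_rigidity_unit_disc
    (S St : Set ℂ) (f : ℂ → ℂ)
    (hS : IsRelativeSchottkySet (ball (0 : ℂ) 1) S) (hS0 : volume S = 0)
    (hSt : IsRelativeSchottkySet (ball (0 : ℂ) 1) St) (hSt0 : volume St = 0)
    (hf : IsHomeoOn f S St) (hqs : LocallyQuasisymmetricOn f S) :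
    ∃ a b c d : ℂ, a * d - b * c = 1 ∧
      ((∀ z ∈ S, c * z + d ≠ 0 ∧ f z = (a * z + b) / (c * z + d)) ∨
       (∀ z ∈ S, c * (starRingEnd ℂ) z + d ≠ 0 ∧
          f z = (a * (starRingEnd ℂ) z + b) / (c * (starRingEnd ℂ) z + d))) := by
  obtain ⟨-, I, c, r, hc, rfl⟩ := hS
  obtain ⟨-, J, ct, rt, hct, rfl⟩ := hSt
  obtain ⟨g, H⟩ := hf.exists_isSchottkyHomeo hc hct
  obtain ⟨σ, hσ⟩ := H.exists_equiv
  have hN : HasNullGraph f (schottkySet c r) := hasNullGraph_of_locallyQuasisymmetricOn hS0 H.cont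
    (measure_mono_null H.maps.image_subset hSt0) hqs
  refine exists_moebius_of_pseudoHypDist_eq (fun z hz => norm_lt_one_of_mem_schottkySet hz)
    (fun z hz => norm_lt_one_of_mem_schottkySet (H.maps hz)) fun z hz w hw => ?_
  rcases (H.reindex σ).2.oriented_or_conj hσ with hor | hor
  · exact hor.pseudoHypDist_eq hN hS0 hz hw
  · rw [← pseudoHypDist_conj_conj]
    exact hor.pseudoHypDist_eq hN.conj hS0 hz hw
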